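/- With the above hypotheses, reg_x^S(S/J) = 0 and reg_y^S(S/J) = n−1. -/

import Mathlib

open MvPolynomial

noncomputable section

/-- The bigraded polynomial ring `S = k[x₁,…,xₙ,y₁,…,y_p]`. -/
abbrev PolyS (k : Type) [Field k] (n p : ℕ) : Type := MvPolynomial (Fin n ⊕ Fin p) k

/-- The bigrading with `deg xᵢ = (1,0)` and `deg yⱼ = (0,1)`. -/
def bideg (n p : ℕ) : (Fin n ⊕ Fin p) → ℤ × ℤ :=
  Sum.elim (fun _ => ((1 : ℤ), (0 : ℤ))) (fun _ => ((0 : ℤ), (1 : ℤ)))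

/-- The bihomogeneous component of `S` of bidegree `d`. -/
def piece (k : Type) [Field k] (n p : ℕ) (d : ℤ × ℤ) : Submodule k (PolyS k n p) :=
  weightedHomogeneousSubmodule k (bideg n p) d

/-- The sequence `z` defined by `[z₁ … z_m] = [x₁ … xₙ]·φ`. -/
def zseq (k : Type) [Field k] (n m p : ℕ) (φ : Matrix (Fin n) (Fin m) (PolyS k n p))
    (j : Fin m) : PolyS k n p :=
  ∑ i : Fin n, X (Sum.inl i) * φ i j

/-- The ideal of `t × t` minors of a matrix. -/
def minorsIdeal {R : Type} [CommRing R] {a b : ℕ} (t : ℕ) (φ : Matrix (Fin a) (Fin b) R) :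
    Ideal R :=
  Ideal.span { d : R | ∃ (r : Fin t ↪ Fin a) (c : Fin t ↪ Fin b),
    d = (φ.submatrix r c).det }

/-- `J = (z₁,…,z_m) + Iₙ(φ)`. -/
def resJ (k : Type) [Field k] (n m p : ℕ) (φ : Matrix (Fin n) (Fin m) (PolyS k n p)) :
    Ideal (PolyS k n p) :=
  Ideal.span (Set.range (zseq k n m p φ)) ⊔ minorsIdeal n φ

/-- The height of an ideal. -/
def idealHeight {R : Type} [CommRing R] (I : Ideal R) : ℕ∞ :=
  ⨅ (P : PrimeSpectrum R) (_ : I ≤ P.asIdeal), Order.height P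

/-- `grade I ≥ t`: there is a regular sequence of length `t` inside `I`. -/
def gradeGE {R : Type} [CommRing R] (I : Ideal R) (t : ℕ) : Prop :=
  ∃ rs : List R, rs.length = t ∧ (∀ r ∈ rs, r ∈ I) ∧ RingTheory.Sequence.IsRegular R rs

/-- The ideal `(x₁,…,xₙ)` of `S`. -/
def xIdeal (k : Type) [Field k] (n p : ℕ) : Ideal (PolyS k n p) :=
  Ideal.span (Set.range fun i : Fin n => (X (Sum.inl i) : PolyS k n p))

/-- The geometric residual intersection condition: `(z)_𝔭 = (x)_𝔭` for all primes
`𝔭 ⊇ (x)` of height at most `m`. -/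
def geomResCond (k : Type) [Field k] (n m p : ℕ)
    (φ : Matrix (Fin n) (Fin m) (PolyS k n p)) : Prop :=
  ∀ P : PrimeSpectrum (PolyS k n p), xIdeal k n p ≤ P.asIdeal →
    Order.height P ≤ (m : ℕ∞) →
    Ideal.map (algebraMap (PolyS k n p) (Localization.AtPrime P.asIdeal))
        (Ideal.span (Set.range (zseq k n m p φ)))
      = Ideal.map (algebraMap (PolyS k n p) (Localization.AtPrime P.asIdeal))
          (xIdeal k n p)

/-- The multiplicity `r(i,j)`. -/
def rMult (n m i j : ℕ) : ℕ :=
  (n + i - 2 * j - 2).choose (i - 1 - j) * (n + i - 1 - j).choose j *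
    m.choose (n + i - 1 - j)

/-- The predicted bigraded Betti numbers of `S/J`: `C(m,i)` in bidegree `(i,i)` for
`0 ≤ i ≤ n-1`, and `r(i,a)` in bidegree `(a, n+i-1-a)` for `1 ≤ i ≤ m` and
`max{0, i-(m-n+1)} ≤ a ≤ min{i-1, n-1}`. -/
def bettiFormula (n m : ℕ) (i : ℕ) (d : ℤ × ℤ) : ℕ :=
  if i ≤ n - 1 ∧ d.1 = (i : ℤ) ∧ d.2 = (i : ℤ) then m.choose i
  else if 1 ≤ i ∧ i ≤ m ∧ ((i - (m - n + 1) : ℕ) : ℤ) ≤ d.1 ∧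
      d.1 ≤ ((min (i - 1) (n - 1) : ℕ) : ℤ) ∧ d.2 = (n : ℤ) + (i : ℤ) - 1 - d.1 then
    rMult n m i d.1.toNat
  else 0

/-- Index type of the free bigraded module with multiplicities `β i`. -/
def RIdx (β : ℕ → ℤ × ℤ → ℕ) (i : ℕ) : Type := { q : (ℤ × ℤ) × ℕ // q.2 < β i q.1 }

/-- The free bigraded `S`-module `⊕_{(a,b)} S(-a,-b)^{β i (a,b)}`. -/
abbrev FMod (k : Type) [Field k] (n p : ℕ) (β : ℕ → ℤ × ℤ → ℕ) (i : ℕ) : Type :=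
  RIdx β i →₀ PolyS k n p

/-- `v` lies in the bigraded component of bidegree `d` of `FMod β i`
(the generator indexed by `q` sits in bidegree `q.1.1`, so its coefficient must lie in
`S(-q.1.1)_d = S_{d - q.1.1}`). -/
def inPiece (k : Type) [Field k] (n p : ℕ) (β : ℕ → ℤ × ℤ → ℕ) (i : ℕ) (d : ℤ × ℤ)
    (v : FMod k n p β i) : Prop :=
  ∀ q : RIdx β i, v q ∈ piece k n p (d - q.1.1)

/-- The irrelevant ideal of `S`, generated by all the variables. -/
def varIdeal (k : Type) [Field k] (n p : ℕ) : Ideal (PolyS k n p) :=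
  Ideal.span (Set.range (X : (Fin n ⊕ Fin p) → PolyS k n p))

/-- `β` records the shifts of a bigraded free resolution of `S/J` over `S`:
there are bidegree-preserving `S`-linear maps forming an exact sequence
`⋯ → F_{i+1} → F_i → ⋯ → F_0 → S/J → 0` where `F_i = ⊕ S(-a,-b)^{β i (a,b)}`
(since `β i = 0` for large `i`, this is a finite resolution). -/
def IsBigradedFreeRes (k : Type) [Field k] (n p : ℕ) (J : Ideal (PolyS k n p))
    (β : ℕ → ℤ × ℤ → ℕ) : Prop :=
  ∃ (f : ∀ i : ℕ, FMod k n p β (i + 1) →ₗ[PolyS k n p] FMod k n p β i)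
    (π : FMod k n p β 0 →ₗ[PolyS k n p] (PolyS k n p ⧸ J)),
    Function.Surjective π ∧ Function.Exact (f 0) π ∧
    (∀ i, Function.Exact (f (i + 1)) (f i)) ∧
    (∀ i d v, inPiece k n p β (i + 1) d v → inPiece k n p β i d (f i v)) ∧
    (∀ d v, inPiece k n p β 0 d v →
      π v ∈ (piece k n p d).map (Ideal.Quotient.mkₐ k J).toLinearMap)

/-- `β` records the shifts of a *minimal* bigraded free resolution of `S/J` over `S`,
i.e. a bigraded free resolution whose differentials have image inside `𝔪·F` where `𝔪`
is the ideal generated by all the variables.  The multiplicities `β i (a,b)` of a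
minimal bigraded free resolution are exactly the bigraded Betti numbers
`β_{i,(a,b)}(S/J) = dim_k Tor_i(S/J, k)_{(a,b)}`. -/
def IsMinBigradedFreeRes (k : Type) [Field k] (n p : ℕ) (J : Ideal (PolyS k n p))
    (β : ℕ → ℤ × ℤ → ℕ) : Prop :=
  ∃ (f : ∀ i : ℕ, FMod k n p β (i + 1) →ₗ[PolyS k n p] FMod k n p β i)
    (π : FMod k n p β 0 →ₗ[PolyS k n p] (PolyS k n p ⧸ J)),
    Function.Surjective π ∧ Function.Exact (f 0) π ∧
    (∀ i, Function.Exact (f (i + 1)) (f i)) ∧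
    (∀ i d v, inPiece k n p β (i + 1) d v → inPiece k n p β i d (f i v)) ∧
    (∀ d v, inPiece k n p β 0 d v →
      π v ∈ (piece k n p d).map (Ideal.Quotient.mkₐ k J).toLinearMap) ∧
    (∀ i, LinearMap.range (f i) ≤
      (varIdeal k n p) • (⊤ : Submodule (PolyS k n p) (FMod k n p β i)))

theorem exists_common_mem {R ι : Type*} [CommRing R] (W : Submonoid R) [Finite ι]
    (p : ι → R → Prop) (hmul : ∀ i a b, p i a → p i (b * a))
    (h : ∀ i, ∃ w ∈ W, p i w) : ∃ w ∈ W, ∀ i, p i w := by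
  classical
  cases nonempty_fintype ι
  choose w hw hp using h
  refine ⟨∏ i, w i, prod_mem fun i _ => hw i, fun i => ?_⟩
  rw [← Finset.mul_prod_erase _ _ (Finset.mem_univ i), mul_comm]
  exact hmul _ _ _ (hp i)

/-- `a` is a nonzerodivisor modulo `I`, up to multiplication by elements of `W`. -/
def RegMod {R : Type*} [CommRing R] (W : Submonoid R) (I : Ideal R) (a : R) : Prop :=
  ∀ c, a * c ∈ I → ∃ u ∈ W, u * c ∈ I

/-- A list that is a regular sequence modulo `I`, up to multiplication by elements of `W`. -/
def LocReg {R : Type*} [CommRing R] (W : Submonoid R) : Ideal R → List R → Prop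
  | _, [] => True
  | I, a :: l => RegMod W I a ∧ LocReg W (I ⊔ Ideal.span {a}) l

theorem locReg_append {R : Type*} [CommRing R] (W : Submonoid R) (l₁ l₂ : List R) :
    ∀ I : Ideal R, LocReg W I (l₁ ++ l₂) ↔
      LocReg W I l₁ ∧ LocReg W (I ⊔ Ideal.span {a | a ∈ l₁}) l₂ := by
  induction l₁ with
  | nil => intro I; simp [LocReg]
  | cons a l ih =>
    intro I
    have : {b | b ∈ a :: l} = {a} ∪ {b | b ∈ l} := by ext; simp
    rw [this, Ideal.span_union, ← sup_assoc]
    simp only [List.cons_append, LocReg, ih, and_assoc]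

/-- Every localization at a prime has its maximal ideal generated by a regular sequence,
phrased without denominators. -/
def HasLocalParameters (R : Type*) [CommRing R] : Prop :=
  ∀ P : Ideal R, [P.IsPrime] → ∃ l : List R, (∀ a ∈ l, a ∈ P) ∧ LocReg P.primeCompl ⊥ l ∧
    ∀ g ∈ P, ∃ u ∈ P.primeCompl, u * g ∈ Ideal.span {a | a ∈ l}

theorem hasLocalParameters_of_field (k : Type*) [Field k] : HasLocalParameters k := by
  intro P hP
  refine ⟨[], by simp, trivial, fun g hg => ⟨1, one_mem _, ?_⟩⟩
  rcases Ideal.eq_bot_or_top P with h | h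
  · subst h; simp_all
  · exact absurd h hP.ne_top

theorem LocReg.map_equiv {R R' : Type*} [CommRing R] [CommRing R'] (e : R ≃+* R')
    (W : Submonoid R) (l : List R) : ∀ I : Ideal R, LocReg W I l →
      LocReg (W.map (e : R →* R')) (I.map e) (l.map e) := by
  induction l with
  | nil => intros; trivial
  | cons a l ih =>
    intro I h
    refine ⟨fun c hc => ?_, ?_⟩
    · obtain ⟨c, rfl⟩ := e.surjective c
      rw [← map_mul, Ideal.mem_map_of_equiv] at hc
      obtain ⟨x, hx, hxe⟩ := hc
      obtain ⟨u, hu, huc⟩ := h.1 c (by rw [← e.injective hxe]; exact hx)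
      refine ⟨e u, ⟨u, hu, rfl⟩, ?_⟩
      rw [← map_mul]
      exact Ideal.mem_map_of_mem _ huc
    · have := ih _ h.2
      rw [Ideal.map_sup, Ideal.map_span, Set.image_singleton] at this
      exact this

theorem HasLocalParameters.of_ringEquiv {R R' : Type*} [CommRing R] [CommRing R']
    (h : HasLocalParameters R) (e : R ≃+* R') : HasLocalParameters R' := by
  intro P hP
  obtain ⟨l, hl, hreg, hgen⟩ := h (P.comap e)
  have hW : (P.comap e).primeCompl.map (e : R →* R') = P.primeCompl := by
    ext x
    constructor
    · rintro ⟨y, hy, rfl⟩; exact hy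
    · intro hx
      refine ⟨e.symm x, fun h => hx ?_, by simp⟩
      simpa [Ideal.mem_comap] using h
  refine ⟨l.map e, ?_, ?_, ?_⟩
  · intro a ha
    obtain ⟨b, hb, rfl⟩ := List.mem_map.1 ha
    exact hl b hb
  · have := hreg.map_equiv e
    rwa [hW, Ideal.map_bot] at this
  · intro g hg
    obtain ⟨u, hu, hug⟩ := hgen (e.symm g)
      (by rw [Ideal.mem_comap, RingEquiv.apply_symm_apply]; exact hg)
    refine ⟨e u, hu, ?_⟩
    have := Ideal.mem_map_of_mem e hug
    rw [Ideal.map_span, map_mul, RingEquiv.apply_symm_apply] at this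
    convert this using 2
    ext x; simp

open Polynomial in
theorem HasLocalParameters.polynomial {R : Type*} [CommRing R]
    (h : HasLocalParameters R) : HasLocalParameters R[X] := by
  intro P hP
  set Q : Ideal R := P.comap Polynomial.C with hQdef
  obtain ⟨l, hl, hreg, hgen⟩ := h Q
  have hunit : ∀ u ∈ Q.primeCompl, Polynomial.C u ∈ P.primeCompl := fun u hu => hu
  have hQP : Q.map Polynomial.C ≤ P := Ideal.map_le_iff_le_comap.2 le_rfl
  have hlift : ∀ (I : Ideal R) (c : R[X]),
      (∀ i, ∃ u ∈ Q.primeCompl, u * c.coeff i ∈ I) →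
      ∃ u ∈ P.primeCompl, u * c ∈ I.map Polynomial.C := by
    intro I c hc
    obtain ⟨u, hu, huc⟩ := exists_common_mem Q.primeCompl
      (fun (i : Fin (c.natDegree + 1)) u => u * c.coeff i ∈ I)
      (fun i a b hab => by rw [mul_assoc]; exact I.mul_mem_left _ hab) (fun i => hc i)
    refine ⟨Polynomial.C u, hunit u hu, Ideal.mem_map_C_iff.2 fun i => ?_⟩
    rw [Polynomial.coeff_C_mul]
    by_cases hi : i < c.natDegree + 1
    · exact huc ⟨i, hi⟩
    · rw [coeff_eq_zero_of_natDegree_lt (by omega), mul_zero]; exact I.zero_mem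
  have hregC : ∀ (l : List R) (I : Ideal R), LocReg Q.primeCompl I l →
      LocReg P.primeCompl (I.map Polynomial.C) (l.map Polynomial.C) := by
    intro l
    induction l with
    | nil => intros; trivial
    | cons a l ih =>
      intro I hI
      refine ⟨fun c hc => hlift _ _ fun i => hI.1 _ ?_, ?_⟩
      · have := Ideal.mem_map_C_iff.1 hc i
        rwa [Polynomial.coeff_C_mul] at this
      · have := ih _ hI.2
        rwa [Ideal.map_sup, Ideal.map_span, Set.image_singleton] at this
  have hlset : {a | a ∈ l.map (Polynomial.C : R →+* R[X])} = Polynomial.C '' {a | a ∈ l} := by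
    ext; simp
  have hgenC : ∀ g ∈ Q.map Polynomial.C, ∃ u ∈ P.primeCompl,
      u * g ∈ Ideal.span {a | a ∈ l.map Polynomial.C} := by
    intro g hg
    rw [hlset, ← Ideal.map_span]
    exact hlift _ _ fun i => hgen _ (Ideal.mem_map_C_iff.1 hg i)
  have hlP : ∀ a ∈ l.map Polynomial.C, a ∈ P := by
    intro a ha
    obtain ⟨b, hb, rfl⟩ := List.mem_map.1 ha
    exact hl b hb
  have hreg0 : LocReg P.primeCompl ⊥ (l.map Polynomial.C) := by
    have := hregC l _ hreg
    rwa [Ideal.map_bot] at this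
  by_cases hPQ : P ≤ Q.map Polynomial.C
  · exact ⟨l.map Polynomial.C, hlP, hreg0, fun g hg => hgenC g (hPQ hg)⟩
  have hex : ∃ d, ∃ f ∈ P, f ∉ Q.map Polynomial.C ∧ f.natDegree = d := by
    obtain ⟨f, hf, hfQ⟩ := Set.not_subset.1 hPQ
    exact ⟨_, f, hf, hfQ, rfl⟩
  classical
  obtain ⟨f, hfP, hfQ, hfd⟩ := Nat.find_spec hex
  have hmin : ∀ g ∈ P, g.natDegree < f.natDegree → g ∈ Q.map Polynomial.C := by
    intro g hg hlt
    by_contra hgQ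
    exact Nat.find_min hex (hfd ▸ hlt) ⟨g, hg, hgQ, rfl⟩
  have hlead : f.leadingCoeff ∈ Q.primeCompl := by
    intro hlc
    have hmon : Polynomial.C f.leadingCoeff * Polynomial.X ^ f.natDegree ∈ Q.map Polynomial.C :=
      Ideal.mul_mem_right _ _ (Ideal.mem_map_of_mem _ hlc)
    have hdec := f.eraseLead_add_C_mul_X_pow
    have heP : f.eraseLead ∈ P := by
      have : f.eraseLead = f - Polynomial.C f.leadingCoeff * Polynomial.X ^ f.natDegree := by
        rw [eq_sub_iff_add_eq]; exact hdec
      rw [this]; exact P.sub_mem hfP (hQP hmon)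
    apply hfQ
    rw [← hdec]
    refine Ideal.add_mem _ ?_ hmon
    rcases f.eraseLead_natDegree_lt_or_eraseLead_eq_zero with h | h
    · exact hmin _ heP h
    · rw [h]; exact Ideal.zero_mem _
  have hpos : 0 < f.natDegree := by
    by_contra h0
    have h0 : f.natDegree = 0 := by omega
    rw [eq_C_of_natDegree_eq_zero h0] at hfP hlead
    rw [leadingCoeff_C] at hlead
    exact hlead hfP
  refine ⟨l.map Polynomial.C ++ [f], ?_, ?_, ?_⟩
  · intro a ha
    rcases List.mem_append.1 ha with ha | ha
    · exact hlP a ha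
    · rw [List.mem_singleton.1 ha]; exact hfP
  · rw [locReg_append]
    refine ⟨hreg0, fun c hc => ?_, trivial⟩
    rw [bot_sup_eq] at hc ⊢
    have hle : Ideal.span {a | a ∈ l.map (Polynomial.C : R →+* R[X])} ≤ Q.map Polynomial.C := by
      rw [hlset, ← Ideal.map_span]
      exact Ideal.map_mono (Ideal.span_le.2 hl)
    have hQprime : (Q.map (Polynomial.C : R →+* R[X])).IsPrime := Ideal.isPrime_map_C_of_isPrime
    exact hgenC c ((hQprime.mem_or_mem (hle hc)).resolve_left hfQ)
  · have hset : Ideal.span {a | a ∈ l.map Polynomial.C ++ [f]} =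
        Ideal.span {a | a ∈ l.map Polynomial.C} ⊔ Ideal.span {f} := by
      rw [← Ideal.span_union]; congr 1; ext; simp [or_comm]
    rw [hset]
    have key : ∀ (d : ℕ) (g : R[X]), g ∈ P → g.natDegree < d →
        ∃ u ∈ P.primeCompl, u * g ∈ Ideal.span {a | a ∈ l.map Polynomial.C} ⊔ Ideal.span {f} := by
      intro d
      induction d with
      | zero => intro g _ h; omega
      | succ d ih =>
        intro g hg hgd
        by_cases hlt : g.natDegree < f.natDegree
        · obtain ⟨u, hu, hug⟩ := hgenC g (hmin g hg hlt)
          exact ⟨u, hu, Ideal.mem_sup_left hug⟩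
        · have hle : f.natDegree ≤ g.natDegree := by omega
          have hcl := natDegree_cancelLeads_lt_of_natDegree_le_natDegree_of_comm
            (mul_comm f.leadingCoeff g.leadingCoeff) hle (by omega)
          have hdef : f.cancelLeads g = Polynomial.C f.leadingCoeff * g -
              Polynomial.C g.leadingCoeff * Polynomial.X ^ (g.natDegree - f.natDegree) * f := by
            simp [cancelLeads, Nat.sub_eq_zero_of_le hle]
          obtain ⟨u, hu, hug⟩ := ih (f.cancelLeads g)
            (by rw [hdef]; exact P.sub_mem (P.mul_mem_left _ hg) (P.mul_mem_left _ hfP))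
            (by omega)
          refine ⟨u * Polynomial.C f.leadingCoeff, mul_mem hu (hunit _ hlead), ?_⟩
          have : u * Polynomial.C f.leadingCoeff * g = u * f.cancelLeads g +
              u * (Polynomial.C g.leadingCoeff * Polynomial.X ^ (g.natDegree - f.natDegree)) * f := by
            rw [hdef]; ring
          rw [this]
          exact Ideal.add_mem _ hug (Ideal.mem_sup_right
            (Ideal.mul_mem_left _ _ (Ideal.mem_span_singleton_self f)))
    exact fun g hg => key _ g hg (Nat.lt_succ_self _)

theorem hasLocalParameters_mvPolynomial (k ι : Type*) [Field k] [Finite ι] :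
    HasLocalParameters (MvPolynomial ι k) := by
  induction ι using Finite.induction_empty_option with
  | of_equiv e H => exact H.of_ringEquiv (MvPolynomial.renameEquiv _ e).toRingEquiv
  | h_empty =>
    exact (hasLocalParameters_of_field k).of_ringEquiv (MvPolynomial.isEmptyRingEquiv k _).symm
  | h_option IH =>
    exact IH.polynomial.of_ringEquiv (MvPolynomial.optionEquivLeft _ _).toRingEquiv.symm

theorem HasLocalParameters.exists_locReg {R : Type*} [CommRing R] [IsNoetherianRing R]
    (h : HasLocalParameters R) (P : Ideal R) [hP : P.IsPrime] (m : ℕ) (hm : m ≤ P.height) :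
    ∃ l : List R, l.length = m ∧ (∀ a ∈ l, a ∈ P) ∧ LocReg P.primeCompl ⊥ l := by
  classical
  obtain ⟨l, hl, hreg, hgen⟩ := h P
  have hmin : P ∈ (Ideal.span (l.toFinset : Set R)).minimalPrimes := by
    refine ⟨⟨hP, Ideal.span_le.2 fun a ha => hl a (by simpa using ha)⟩, ?_⟩
    rintro Q' ⟨hQ', hle⟩ hQP g hg
    obtain ⟨u, hu, hug⟩ := hgen g hg
    have : u * g ∈ Q' := hle (by simpa using hug)
    exact (hQ'.mem_or_mem this).resolve_left fun hu' => hu (hQP hu')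
  have hlen : m ≤ l.length := by
    have h1 := hm.trans (Ideal.height_le_card_of_mem_minimalPrimes_span_finset hmin)
    exact (Nat.cast_le.1 h1).trans (List.toFinset_card_le l)
  refine ⟨l.take m, by simp [hlen], fun a ha => hl a (List.mem_of_mem_take ha), ?_⟩
  rw [← List.take_append_drop m l, locReg_append] at hreg
  exact hreg.1

section GradedModules

variable {k : Type} [Field k] {n p : ℕ}

/-- The family `gr` is compatible with the bigrading of the polynomial ring. -/
def GrLaw (k : Type) [Field k] (n p : ℕ) {M : Type} [AddCommGroup M] [Module (PolyS k n p) M]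
    (gr : ℤ × ℤ → AddSubgroup M) : Prop :=
  ∀ e d (s : PolyS k n p) (v : M), s ∈ piece k n p e → v ∈ gr d → s • v ∈ gr (e + d)

/-- The grading induced on a submodule. -/
def grSub {M : Type} [AddCommGroup M] [Module (PolyS k n p) M]
    (gr : ℤ × ℤ → AddSubgroup M) (N : Submodule (PolyS k n p) M) (d : ℤ × ℤ) :
    AddSubgroup N :=
  (gr d).comap N.subtype.toAddMonoidHom

/-- The grading of a product. -/
def grProd {M N : Type} [AddCommGroup M] [AddCommGroup N]
    (gM : ℤ × ℤ → AddSubgroup M) (gN : ℤ × ℤ → AddSubgroup N) (d : ℤ × ℤ) :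
    AddSubgroup (M × N) := (gM d).prod (gN d)

/-- The grading shifted by `e`. -/
def grShift {M : Type} [AddCommGroup M] (e : ℤ × ℤ) (gr : ℤ × ℤ → AddSubgroup M)
    (d : ℤ × ℤ) : AddSubgroup M := gr (d - e)

/-- A linear map respecting bidegrees. -/
def GrMap {M N : Type} [AddCommGroup M] [Module (PolyS k n p) M] [AddCommGroup N]
    [Module (PolyS k n p) N] (gM : ℤ × ℤ → AddSubgroup M) (gN : ℤ × ℤ → AddSubgroup N)
    (f : M →ₗ[PolyS k n p] N) : Prop := ∀ d v, v ∈ gM d → f v ∈ gN d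

/-- Surjectivity in every bidegree. -/
def GrSurj {M N : Type} [AddCommGroup M] [Module (PolyS k n p) M] [AddCommGroup N]
    [Module (PolyS k n p) N] (gM : ℤ × ℤ → AddSubgroup M) (gN : ℤ × ℤ → AddSubgroup N)
    (f : M →ₗ[PolyS k n p] N) : Prop := ∀ d, ∀ c ∈ gN d, ∃ v ∈ gM d, f v = c

theorem GrLaw.sub {M : Type} [AddCommGroup M] [Module (PolyS k n p) M]
    {gr : ℤ × ℤ → AddSubgroup M} (h : GrLaw k n p gr) (N : Submodule (PolyS k n p) M) :
    GrLaw k n p (grSub gr N) := fun e d s v hs hv => h e d s v hs hv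

theorem GrLaw.prod {M N : Type} [AddCommGroup M] [Module (PolyS k n p) M]
    [AddCommGroup N] [Module (PolyS k n p) N]
    {gM : ℤ × ℤ → AddSubgroup M} {gN : ℤ × ℤ → AddSubgroup N}
    (hM : GrLaw k n p gM) (hN : GrLaw k n p gN) : GrLaw k n p (grProd gM gN) :=
  fun e d s v hs hv => ⟨hM e d s v.1 hs hv.1, hN e d s v.2 hs hv.2⟩

theorem GrLaw.shift {M : Type} [AddCommGroup M] [Module (PolyS k n p) M]
    {gr : ℤ × ℤ → AddSubgroup M} (h : GrLaw k n p gr) (e : ℤ × ℤ) :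
    GrLaw k n p (grShift e gr) := fun e' d s v hs hv => by
  have := h e' (d - e) s v hs hv
  rwa [← add_sub_assoc] at this

/-- `F` behaves like a graded free module with generators of `lam`-degree at most `r`. -/
structure GrFree (k : Type) [Field k] (n p : ℕ) (lam : ℤ × ℤ →+ ℤ) (r : ℤ) {F : Type}
    [AddCommGroup F]
    [Module (PolyS k n p) F] (gr : ℤ × ℤ → AddSubgroup F) : Prop where
  law : GrLaw k n p gr
  lift : ∀ {B C : Type} [AddCommGroup B] [Module (PolyS k n p) B] [AddCommGroup C]
    [Module (PolyS k n p) C] (gB : ℤ × ℤ → AddSubgroup B) (gC : ℤ × ℤ → AddSubgroup C)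
    (g : B →ₗ[PolyS k n p] C) (f : F →ₗ[PolyS k n p] C), GrLaw k n p gB →
    GrSurj gB gC g → GrMap gr gC f → ∃ s : F →ₗ[PolyS k n p] B, GrMap gr gB s ∧ g ∘ₗ s = f
  high : ∀ d v, r < lam d → v ∈ gr d →
    v ∈ varIdeal k n p • (⊤ : Submodule (PolyS k n p) F)

variable {lam : ℤ × ℤ →+ ℤ}

/-- `M` has the first `t` steps of a graded resolution whose `i`-th term is free with
generators of `lam`-degree at most `r + i`. -/
def RegUpTo (k : Type) [Field k] (n p : ℕ) (lam : ℤ × ℤ →+ ℤ) : ℕ → ℤ → ∀ (M : Type)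
    [AddCommGroup M] [Module (PolyS k n p) M], (ℤ × ℤ → AddSubgroup M) → Prop
  | 0, _, _, _, _, _ => True
  | t + 1, r, M, _, _, gr => ∃ (F : Type) (_ : AddCommGroup F) (_ : Module (PolyS k n p) F)
      (gF : ℤ × ℤ → AddSubgroup F) (π : F →ₗ[PolyS k n p] M), GrFree k n p lam r gF ∧ GrMap gF gr π ∧
      GrSurj gF gr π ∧ RegUpTo k n p lam t (r + 1) (LinearMap.ker π) (grSub gF (LinearMap.ker π))

/-- A short exact sequence of graded modules. -/
structure GrExact {A B C : Type} [AddCommGroup A] [Module (PolyS k n p) A] [AddCommGroup B]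
    [Module (PolyS k n p) B] [AddCommGroup C] [Module (PolyS k n p) C]
    (gA : ℤ × ℤ → AddSubgroup A) (gB : ℤ × ℤ → AddSubgroup B) (gC : ℤ × ℤ → AddSubgroup C)
    (i : A →ₗ[PolyS k n p] B) (g : B →ₗ[PolyS k n p] C) : Prop where
  inj : Function.Injective i
  mem : ∀ d a, i a ∈ gB d ↔ a ∈ gA d
  exact : ∀ b, g b = 0 ↔ ∃ a, i a = b
  map : GrMap gB gC g
  surj : GrSurj gB gC g

theorem GrExact.ker {B C : Type} [AddCommGroup B]
    [Module (PolyS k n p) B] [AddCommGroup C] [Module (PolyS k n p) C]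
    {gB : ℤ × ℤ → AddSubgroup B} {gC : ℤ × ℤ → AddSubgroup C} {g : B →ₗ[PolyS k n p] C}
    (hm : GrMap gB gC g) (hs : GrSurj gB gC g) :
    GrExact (grSub gB (LinearMap.ker g)) gB gC (LinearMap.ker g).subtype g where
  inj := Subtype.val_injective
  mem _ _ := Iff.rfl
  exact b := ⟨fun h => ⟨⟨b, h⟩, rfl⟩, by rintro ⟨a, rfl⟩; exact a.2⟩
  map := hm
  surj := hs

theorem exists_linear_lift {R A B M : Type} [CommRing R] [AddCommGroup A] [Module R A]
    [AddCommGroup B] [Module R B] [AddCommGroup M] [Module R M]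
    (i : A →ₗ[R] B) (hi : Function.Injective i) (f : M →ₗ[R] B) (h : ∀ x, ∃ a, i a = f x) :
    ∃ g : M →ₗ[R] A, ∀ x, i (g x) = f x := by
  refine ⟨(LinearEquiv.ofInjective i hi).symm.toLinearMap ∘ₗ
    f.codRestrict (LinearMap.range i) h, fun x => ?_⟩
  have := congrArg Subtype.val ((LinearEquiv.ofInjective i hi).apply_symm_apply
    (f.codRestrict (LinearMap.range i) h x))
  rw [LinearEquiv.ofInjective_apply] at this
  exact this

section Rules

variable {A B C : Type} [AddCommGroup A] [Module (PolyS k n p) A] [AddCommGroup B]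
    [Module (PolyS k n p) B] [AddCommGroup C] [Module (PolyS k n p) C]
    {gA : ℤ × ℤ → AddSubgroup A} {gB : ℤ × ℤ → AddSubgroup B} {gC : ℤ × ℤ → AddSubgroup C}

theorem RegUpTo.equiv {t : ℕ} {r : ℤ} (h : RegUpTo k n p lam t r A gA)
    (e : A ≃ₗ[PolyS k n p] B) (he : ∀ d a, e a ∈ gB d ↔ a ∈ gA d) :
    RegUpTo k n p lam t r B gB := by
  cases t with
  | zero => trivial
  | succ t =>
    obtain ⟨F, _, _, gF, π, hF, hm, hs, hk⟩ := h
    refine ⟨F, _, _, gF, e.toLinearMap ∘ₗ π, hF, fun d v hv => (he d _).2 (hm d v hv),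
      fun d c hc => ?_, ?_⟩
    · obtain ⟨v, hv, hvc⟩ := hs d (e.symm c) ((he d _).1 (by simpa using hc))
      exact ⟨v, hv, by simp [hvc]⟩
    · rw [LinearEquiv.ker_comp]; exact hk

theorem GrFree.mono {r r' : ℤ} (h : GrFree k n p lam r gA) (hr : r ≤ r') :
    GrFree k n p lam r' gA :=
  ⟨h.law, h.lift, fun d v hd hv => h.high d v (hr.trans_lt hd) hv⟩

theorem RegUpTo.mono {t : ℕ} : ∀ {r r' : ℤ} {M : Type} [AddCommGroup M]
    [Module (PolyS k n p) M] {gr : ℤ × ℤ → AddSubgroup M},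
    RegUpTo k n p lam t r M gr → r ≤ r' → RegUpTo k n p lam t r' M gr := by
  induction t with
  | zero => intros; trivial
  | succ t ih =>
    rintro r r' M _ _ gr ⟨F, _, _, gF, π, hF, hm, hs, hk⟩ hr
    exact ⟨F, _, _, gF, π, hF.mono hr, hm, hs, ih hk (by omega)⟩

theorem RegUpTo.of_succ {t : ℕ} : ∀ {r : ℤ} {M : Type} [AddCommGroup M]
    [Module (PolyS k n p) M] {gr : ℤ × ℤ → AddSubgroup M},
    RegUpTo k n p lam (t + 1) r M gr → RegUpTo k n p lam t r M gr := by
  induction t with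
  | zero => intros; trivial
  | succ t ih =>
    rintro r M _ _ gr ⟨F, _, _, gF, π, hF, hm, hs, hk⟩
    exact ⟨F, _, _, gF, π, hF, hm, hs, ih hk⟩

theorem RegUpTo.of_subsingleton {t : ℕ} : ∀ {r : ℤ} {M : Type} [AddCommGroup M]
    [Module (PolyS k n p) M] {gr : ℤ × ℤ → AddSubgroup M} [Subsingleton M],
    RegUpTo k n p lam t r M gr := by
  induction t with
  | zero => intros; trivial
  | succ t ih =>
    intro r M _ _ gr _
    refine ⟨M, _, _, gr, LinearMap.id, ⟨?_, ?_, ?_⟩, fun d v hv => hv, fun d c hc => ⟨c, hc, rfl⟩, ih⟩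
    · intro e d s v _ _
      rw [Subsingleton.elim (s • v) 0]; exact zero_mem _
    · intro B C _ _ _ _ gB gC g f _ _ _
      exact ⟨0, fun d v _ => zero_mem _, LinearMap.ext fun v => by
        rw [Subsingleton.elim v 0, map_zero, map_zero]⟩
    · intro d v _ _
      rw [Subsingleton.elim v 0]; exact zero_mem _

theorem GrFree.regUpTo {r : ℤ} (h : GrFree k n p lam r gA) (t : ℕ) :
    RegUpTo k n p lam t r A gA := by
  cases t with
  | zero => trivial
  | succ t =>
    have : Subsingleton (LinearMap.ker (LinearMap.id : A →ₗ[PolyS k n p] A)) := by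
      rw [LinearMap.ker_id]; infer_instance
    exact ⟨A, _, _, gA, LinearMap.id, h, fun d v hv => hv, fun d c hc => ⟨c, hc, rfl⟩,
      RegUpTo.of_subsingleton⟩

theorem GrFree.prod {r : ℤ} (hA : GrFree k n p lam r gA) (hB : GrFree k n p lam r gB) :
    GrFree k n p lam r (grProd gA gB) where
  law := hA.law.prod hB.law
  lift := by
    intro X Y _ _ _ _ gX gY g f hl hg hf
    obtain ⟨s, hs, hs'⟩ := hA.lift gX gY g (f ∘ₗ LinearMap.inl _ _ _) hl hg
      (fun d v hv => hf d _ ⟨hv, zero_mem _⟩)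
    obtain ⟨u, hu, hu'⟩ := hB.lift gX gY g (f ∘ₗ LinearMap.inr _ _ _) hl hg
      (fun d v hv => hf d _ ⟨zero_mem _, hv⟩)
    refine ⟨s.coprod u, fun d v hv => ?_, ?_⟩
    · rw [LinearMap.coprod_apply]
      exact add_mem (hs d _ hv.1) (hu d _ hv.2)
    · rw [LinearMap.comp_coprod, hs', hu', ← LinearMap.comp_coprod]; simp
  high := by
    intro d v hd hv
    have h1 := Submodule.mem_map_of_mem (f := LinearMap.inl (PolyS k n p) A B)
      (hA.high d v.1 hd hv.1)
    have h2 := Submodule.mem_map_of_mem (f := LinearMap.inr (PolyS k n p) A B)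
      (hB.high d v.2 hd hv.2)
    rw [Submodule.map_smul''] at h1 h2
    have := add_mem (Submodule.smul_mono le_rfl le_top h1) (Submodule.smul_mono le_rfl le_top h2)
    simpa using this

theorem RegUpTo.shift {t : ℕ} (e : ℤ × ℤ) : ∀ {r : ℤ} {M : Type} [AddCommGroup M]
    [Module (PolyS k n p) M] {gr : ℤ × ℤ → AddSubgroup M},
    RegUpTo k n p lam t r M gr → RegUpTo k n p lam t (r + lam e) M (grShift e gr) := by
  induction t with
  | zero => intros; trivial
  | succ t ih =>
    rintro r M _ _ gr ⟨F, _, _, gF, π, hF, hm, hs, hk⟩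
    refine ⟨F, _, _, grShift e gF, π, ⟨hF.law.shift e, ?_, ?_⟩, fun d v hv => hm _ v hv,
      fun d c hc => hs _ c hc, ?_⟩
    · intro X Y _ _ _ _ gX gY g f hl hg hf
      obtain ⟨s, hs, hs'⟩ := hF.lift (grShift (-e) gX) (grShift (-e) gY) g f (hl.shift _)
        (fun d c hc => hg _ c hc) (fun d v hv => hf _ v (by simpa [grShift] using hv))
      refine ⟨s, fun d v hv => ?_, hs'⟩
      have := hs _ v hv
      simpa [grShift] using this
    · intro d v hd hv
      exact hF.high (d - e) v (by rw [map_sub]; omega) hv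
    · have := ih hk
      rw [add_right_comm] at this
      exact this

theorem GrExact.sub_mem_exists {i : A →ₗ[PolyS k n p] B} {g : B →ₗ[PolyS k n p] C}
    (h : GrExact gA gB gC i g) {d : ℤ × ℤ} {b : B} (hb : b ∈ gB d) (h0 : g b = 0) :
    ∃ a ∈ gA d, i a = b := by
  obtain ⟨a, rfl⟩ := (h.exact b).1 h0
  exact ⟨a, (h.mem d a).1 hb, rfl⟩

theorem RegUpTo.of_exact_middle {t : ℕ} : ∀ {r : ℤ} {A B C : Type} [AddCommGroup A]
    [Module (PolyS k n p) A] [AddCommGroup B] [Module (PolyS k n p) B] [AddCommGroup C]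
    [Module (PolyS k n p) C] {gA : ℤ × ℤ → AddSubgroup A} {gB : ℤ × ℤ → AddSubgroup B}
    {gC : ℤ × ℤ → AddSubgroup C} {i : A →ₗ[PolyS k n p] B} {g : B →ₗ[PolyS k n p] C},
    GrExact gA gB gC i g → GrLaw k n p gB → RegUpTo k n p lam t r A gA →
    RegUpTo k n p lam t r C gC → RegUpTo k n p lam t r B gB := by
  induction t with
  | zero => intros; trivial
  | succ t ih =>
    rintro r A B C _ _ _ _ _ _ gA gB gC i g hex hlaw ⟨F, _, _, gF, πA, hF, hFm, hFs, hFk⟩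
      ⟨G, _, _, gG, πC, hG, hGm, hGs, hGk⟩
    obtain ⟨s, hs, hs'⟩ := hG.lift gB gC g πC hlaw hex.surj hGm
    have hgs : ∀ y, g (s y) = πC y := fun y => LinearMap.congr_fun hs' y
    have hgi : ∀ a, g (i a) = 0 := fun a => (hex.exact _).2 ⟨a, rfl⟩
    set Θ : F × G →ₗ[PolyS k n p] B := (i ∘ₗ πA).coprod s with hΘ
    have hΘa : ∀ x y, Θ (x, y) = i (πA x) + s y := fun x y => rfl
    have hgΘ : ∀ v, g (Θ v) = πC v.2 := by
      rintro ⟨x, y⟩; rw [hΘa, map_add, hgi, hgs, zero_add]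
    refine ⟨F × G, _, _, grProd gF gG, Θ, hF.prod hG, ?_, ?_, ?_⟩
    · rintro d ⟨x, y⟩ ⟨hx, hy⟩
      rw [hΘa]
      exact add_mem ((hex.mem d _).2 (hFm d x hx)) (hs d y hy)
    · intro d b hb
      obtain ⟨y, hy, hyb⟩ := hGs d (g b) (hex.map d b hb)
      obtain ⟨a, ha, hab⟩ := hex.sub_mem_exists (b := b - s y) (sub_mem hb (hs d y hy))
        (by rw [map_sub, hgs, hyb, sub_self])
      obtain ⟨x, hx, hxa⟩ := hFs d a ha
      exact ⟨(x, y), ⟨hx, hy⟩, by rw [hΘa, hxa, hab]; abel⟩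
    · have h1 : ∀ x : LinearMap.ker πA, LinearMap.inl (PolyS k n p) F G x.1 ∈ LinearMap.ker Θ := by
        intro x
        have := x.2
        rw [LinearMap.mem_ker] at this ⊢
        rw [LinearMap.inl_apply, hΘa, this, map_zero, map_zero, zero_add]
      have h2 : ∀ v : LinearMap.ker Θ, v.1.2 ∈ LinearMap.ker πC := by
        intro v
        rw [LinearMap.mem_ker, ← hgΘ, LinearMap.mem_ker.1 v.2, map_zero]
      refine ih (i := ((LinearMap.inl _ _ _) ∘ₗ (LinearMap.ker πA).subtype).codRestrict _ h1)
        (g := ((LinearMap.snd _ _ _) ∘ₗ (LinearMap.ker Θ).subtype).codRestrict _ h2)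
        ⟨?_, ?_, ?_, ?_, ?_⟩ ((hF.law.prod hG.law).sub _) hFk hGk
      · intro x y hxy
        have := congrArg (fun v : LinearMap.ker Θ => v.1.1) hxy
        exact Subtype.ext this
      · intro d a
        exact ⟨fun h => h.1, fun h => ⟨h, zero_mem _⟩⟩
      · rintro ⟨⟨x, y⟩, hv⟩
        constructor
        · intro h
          have hy : y = 0 := congrArg Subtype.val h
          subst hy
          rw [LinearMap.mem_ker, hΘa, map_zero, add_zero] at hv
          exact ⟨⟨x, hex.inj (by rw [hv, map_zero])⟩, rfl⟩
        · rintro ⟨a, ha⟩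
          have : (0 : G) = y := congrArg (fun v : LinearMap.ker Θ => v.1.2) ha
          exact Subtype.ext this.symm
      · intro d v hv; exact hv.2
      · rintro d ⟨y, hyk⟩ hy
        obtain ⟨a, ha, hab⟩ := hex.sub_mem_exists (hs d y hy) (by rw [hgs]; exact hyk)
        obtain ⟨x, hx, hxa⟩ := hFs d a ha
        refine ⟨⟨(-x, y), ?_⟩, ⟨(gF d).neg_mem hx, hy⟩, rfl⟩
        rw [LinearMap.mem_ker, hΘa, map_neg, map_neg, hxa, hab, neg_add_cancel]

theorem RegUpTo.of_exact_right {t : ℕ} {r : ℤ}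
    {i : A →ₗ[PolyS k n p] B} {g : B →ₗ[PolyS k n p] C}
    (hex : GrExact gA gB gC i g) (hA : RegUpTo k n p lam t (r + 1) A gA)
    (hB : RegUpTo k n p lam (t + 1) r B gB) : RegUpTo k n p lam (t + 1) r C gC := by
  obtain ⟨F, _, _, gF, π, hF, hm, hs, hk⟩ := hB
  refine ⟨F, _, _, gF, g ∘ₗ π, hF, fun d v hv => hex.map _ _ (hm d v hv), fun d c hc => ?_, ?_⟩
  · obtain ⟨b, hb, rfl⟩ := hex.surj d c hc
    obtain ⟨v, hv, rfl⟩ := hs d b hb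
    exact ⟨v, hv, rfl⟩
  · obtain ⟨h, hh⟩ := exists_linear_lift i hex.inj (π ∘ₗ (LinearMap.ker (g ∘ₗ π)).subtype)
      (fun x => (hex.exact _).1 x.2)
    have hle : LinearMap.ker π ≤ LinearMap.ker (g ∘ₗ π) := by
      intro x hx
      rw [LinearMap.mem_ker] at hx ⊢
      rw [LinearMap.comp_apply, hx, map_zero]
    refine RegUpTo.of_exact_middle (i := Submodule.inclusion hle) (g := h)
      ⟨Submodule.inclusion_injective _, fun d a => Iff.rfl, ?_, ?_, ?_⟩ (hF.law.sub _) hk hA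
    · intro x
      rw [← map_eq_zero_iff i hex.inj, hh]
      constructor
      · intro hx; exact ⟨⟨x.1, hx⟩, rfl⟩
      · rintro ⟨a, rfl⟩; exact a.2
    · intro d x hx
      rw [← hex.mem, hh]
      exact hm d _ hx
    · intro d a ha
      obtain ⟨v, hv, hva⟩ := hs d (i a) ((hex.mem d a).2 ha)
      refine ⟨⟨v, ?_⟩, hv, hex.inj ?_⟩
      · rw [LinearMap.mem_ker, LinearMap.comp_apply, hva]
        exact (hex.exact _).2 ⟨a, rfl⟩
      · rw [hh]; exact hva

theorem RegUpTo.of_exact_left {t : ℕ} {r : ℤ}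
    {i : A →ₗ[PolyS k n p] B} {g : B →ₗ[PolyS k n p] C}
    (hex : GrExact gA gB gC i g) (hlaw : GrLaw k n p gB) (hB : RegUpTo k n p lam t r B gB)
    (hC : RegUpTo k n p lam (t + 1) (r - 1) C gC) : RegUpTo k n p lam t r A gA := by
  cases t with
  | zero => trivial
  | succ t =>
  obtain ⟨G, _, _, gG, π, hG, hm, hs, hk⟩ := hC
  rw [sub_add_cancel] at hk
  obtain ⟨s, hs1, hs2⟩ := hG.lift gB gC g π hlaw hex.surj hm
  have hgs : ∀ y, g (s y) = π y := fun y => LinearMap.congr_fun hs2 y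
  set Q := LinearMap.ker ((g ∘ₗ LinearMap.fst _ B G) - (π ∘ₗ LinearMap.snd _ B G)) with hQ
  have hQm : ∀ v : B × G, v ∈ Q ↔ g v.1 = π v.2 := by
    intro v; rw [hQ, LinearMap.mem_ker, LinearMap.sub_apply, sub_eq_zero]; rfl
  have hlQ : GrLaw k n p (grSub (grProd gB gG) Q) := (hlaw.prod hG.law).sub _
  have hQreg : RegUpTo k n p lam (t + 1) r Q (grSub (grProd gB gG) Q) := by
    refine RegUpTo.of_exact_middle
      (i := ((LinearMap.inr _ B G) ∘ₗ (LinearMap.ker π).subtype).codRestrict Q ?_)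
      (g := LinearMap.fst _ B G ∘ₗ Q.subtype) ⟨?_, ?_, ?_, ?_, ?_⟩ hlQ hk hB
    · intro x
      rw [hQm]
      have := x.2
      rw [LinearMap.mem_ker] at this
      simp [this]
    · intro x y hxy
      exact Subtype.ext (congrArg (fun v : Q => v.1.2) hxy)
    · intro d a
      exact ⟨fun h => h.2, fun h => ⟨zero_mem _, h⟩⟩
    · rintro ⟨⟨b, f⟩, hv⟩
      constructor
      · intro h
        have hb : b = 0 := h
        subst hb
        rw [hQm] at hv
        refine ⟨⟨f, ?_⟩, rfl⟩
        rw [LinearMap.mem_ker, ← hv]; exact map_zero g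
      · rintro ⟨a, ha⟩
        have : (0 : B) = b := congrArg (fun v : Q => v.1.1) ha
        exact this.symm
    · intro d v hv; exact hv.1
    · intro d b hb
      obtain ⟨f, hf, hfb⟩ := hs d (g b) (hex.map d b hb)
      exact ⟨⟨(b, f), (hQm _).2 hfb.symm⟩, ⟨hb, hf⟩, rfl⟩
  obtain ⟨h, hh⟩ := exists_linear_lift i hex.inj
    ((LinearMap.fst _ B G - s ∘ₗ LinearMap.snd _ B G) ∘ₗ Q.subtype) (fun x => (hex.exact _).1 (by
      have := (hQm _).1 x.2
      simp [hgs, this]))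
  have hh' : ∀ x : Q, i (h x) = x.1.1 - s x.1.2 := hh
  refine RegUpTo.of_exact_right (i := (s.prod LinearMap.id).codRestrict Q ?_) (g := h)
    ⟨?_, ?_, ?_, ?_, ?_⟩ ((hG.mono (by omega : r - 1 ≤ r + 1)).regUpTo t) hQreg
  · intro y; rw [hQm]; exact hgs y
  · intro x y hxy
    exact congrArg (fun v : Q => v.1.2) hxy
  · intro d a
    exact ⟨fun h => h.2, fun h => ⟨hs1 d a h, h⟩⟩
  · rintro ⟨⟨b, f⟩, hv⟩
    rw [← map_eq_zero_iff i hex.inj, hh', sub_eq_zero]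
    constructor
    · intro h
      have hb : b = s f := h
      subst hb
      exact ⟨f, rfl⟩
    · rintro ⟨a, ha⟩
      have h1 : s a = b := congrArg (fun v : Q => v.1.1) ha
      have h2 : a = f := congrArg (fun v : Q => v.1.2) ha
      change b = s f
      rw [← h1, h2]
  · intro d v hv
    rw [← hex.mem, hh']
    exact sub_mem hv.1 (hs1 d _ hv.2)
  · intro d a ha
    refine ⟨⟨(i a, 0), (hQm _).2 ?_⟩, ⟨(hex.mem d a).2 ha, zero_mem _⟩, hex.inj ?_⟩
    · rw [map_zero]; exact (hex.exact _).2 ⟨a, rfl⟩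
    · rw [hh']; simp

end Rules

end GradedModules

theorem iSup_mem_induction {M ι : Type} [AddCommGroup M] {gr : ι → AddSubgroup M} {C : M → Prop}
    {x : M} (hx : x ∈ ⨆ d, gr d) (h_mem : ∀ d, ∀ x ∈ gr d, C x) (h_zero : C 0)
    (h_add : ∀ x y, C x → C y → C (x + y)) : C x :=
  AddSubgroup.iSup_induction gr (C := C) hx h_mem h_zero h_add

section Pieces

variable {k : Type} [Field k] {n p : ℕ}

theorem piece_mul {d e : ℤ × ℤ} {s t : PolyS k n p} (hs : s ∈ piece k n p d)
    (ht : t ∈ piece k n p e) : s * t ∈ piece k n p (d + e) := by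
  rw [piece, mem_weightedHomogeneousSubmodule] at *
  exact hs.mul ht

theorem one_mem_piece : (1 : PolyS k n p) ∈ piece k n p 0 := by
  rw [piece, mem_weightedHomogeneousSubmodule]
  exact isWeightedHomogeneous_one _ _

theorem X_inl_mem_piece (i : Fin n) : (X (Sum.inl i) : PolyS k n p) ∈ piece k n p (1, 0) := by
  rw [piece, mem_weightedHomogeneousSubmodule]
  exact isWeightedHomogeneous_X k (bideg n p) (Sum.inl i)

/-- Projection to the component of bidegree `d`. -/
def comp (k : Type) [Field k] (n p : ℕ) (d : ℤ × ℤ) : PolyS k n p →ₗ[k] PolyS k n p :=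
  weightedHomogeneousComponent (bideg n p) d

theorem comp_mem (d : ℤ × ℤ) (s : PolyS k n p) : comp k n p d s ∈ piece k n p d :=
  weightedHomogeneousComponent_mem _ _ _

theorem comp_of_mem {d : ℤ × ℤ} {s : PolyS k n p} (hs : s ∈ piece k n p d) :
    comp k n p d s = s := by
  rw [piece, mem_weightedHomogeneousSubmodule] at hs
  exact hs.weightedHomogeneousComponent_same

theorem comp_of_mem_ne {d e : ℤ × ℤ} {s : PolyS k n p} (hs : s ∈ piece k n p d) (h : e ≠ d) :
    comp k n p e s = 0 := by
  rw [piece, mem_weightedHomogeneousSubmodule] at hs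
  exact hs.weightedHomogeneousComponent_ne e h

/-- The bigrading of the polynomial ring. -/
def grS (k : Type) [Field k] (n p : ℕ) (d : ℤ × ℤ) : AddSubgroup (PolyS k n p) :=
  (piece k n p d).toAddSubgroup

theorem grS_law : GrLaw k n p (grS k n p) := fun _ _ _ _ hs hv => piece_mul hs hv

theorem grS_gen : ⨆ d, grS k n p d = ⊤ := by
  refine eq_top_iff.2 fun s _ => ?_
  have h := sum_weightedHomogeneousComponent (bideg n p) s
  rw [← h]
  have hfin := weightedHomogeneousComponent_finsupp (w := bideg n p) s
  rw [finsum_eq_sum _ hfin]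
  exact sum_mem fun d _ => AddSubgroup.mem_iSup_of_mem d (comp_mem d s)

theorem comp_mul {e : ℤ × ℤ} {t : PolyS k n p} (ht : t ∈ piece k n p e) (d : ℤ × ℤ)
    (s : PolyS k n p) : comp k n p d (s * t) = comp k n p (d - e) s * t := by
  have hs : s ∈ ⨆ d, grS k n p d := by rw [grS_gen]; trivial
  refine iSup_mem_induction (C := fun s => comp k n p d (s * t) = comp k n p (d - e) s * t) hs
    (fun f x hx => ?_) (by simp) fun x y hx hy => ?_
  · by_cases h : d = f + e
    · subst h
      rw [comp_of_mem (piece_mul hx ht), add_sub_cancel_right, comp_of_mem hx]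
    · rw [comp_of_mem_ne (piece_mul hx ht) h,
        comp_of_mem_ne hx fun h' => h (by rw [← h', sub_add_cancel]), zero_mul]
  · rw [add_mul, map_add, hx, hy, map_add, add_mul]

theorem mem_varIdeal_of_mem_piece {d : ℤ × ℤ} {s : PolyS k n p} (hs : s ∈ piece k n p d)
    (hd : d ≠ 0) : s ∈ varIdeal k n p := by
  rw [varIdeal, ← Set.image_univ, mem_ideal_span_X_image]
  intro m hm
  by_contra hcon
  have hm0 : m = 0 := by
    ext i
    by_contra h
    exact hcon ⟨i, trivial, h⟩
  rw [piece, mem_weightedHomogeneousSubmodule] at hs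
  have := hs (mem_support_iff.1 hm)
  rw [hm0, map_zero] at this
  exact hd this.symm

end Pieces

section Gradings

variable {k : Type} [Field k] {n p : ℕ} {lam : ℤ × ℤ →+ ℤ}

theorem iSupIndep_of_proj {M T : Type} [AddCommGroup M] [AddCommGroup T]
    (gr : ℤ × ℤ → AddSubgroup M) (c : ℤ × ℤ → M →+ T)
    (h1 : ∀ d, ∀ v ∈ gr d, c d v = 0 → v = 0)
    (h2 : ∀ d e, e ≠ d → ∀ v ∈ gr e, c d v = 0) : iSupIndep gr := by
  rw [iSupIndep_def]
  intro d
  rw [AddSubgroup.disjoint_def]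
  intro v hv hv'
  refine h1 d v hv ?_
  have : (⨆ e, ⨆ (_ : e ≠ d), gr e) ≤ (c d).ker :=
    iSup_le fun e => iSup_le fun he w hw => h2 d e he w hw
  exact this hv'

theorem GrMap.exists_mem_of_mem_range {B C : Type} [AddCommGroup B]
    [Module (PolyS k n p) B] [AddCommGroup C] [Module (PolyS k n p) C]
    {gB : ℤ × ℤ → AddSubgroup B} {gC : ℤ × ℤ → AddSubgroup C} {g : B →ₗ[PolyS k n p] C}
    (hm : GrMap gB gC g) (hB : ⨆ d, gB d = ⊤) (hC : iSupIndep gC) {d : ℤ × ℤ} {c : C}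
    (hc : c ∈ gC d) (hr : ∃ b, g b = c) : ∃ b ∈ gB d, g b = c := by
  obtain ⟨b, rfl⟩ := hr
  have key : ∃ b' ∈ gB d, g b - g b' ∈ ⨆ e, ⨆ (_ : e ≠ d), gC e := by
    clear hc
    have hb : b ∈ ⨆ d, gB d := by rw [hB]; trivial
    refine iSup_mem_induction (C := fun b => ∃ b' ∈ gB d, g b - g b' ∈ ⨆ e, ⨆ (_ : e ≠ d), gC e) hb
      (fun e x hx => ?_) ⟨0, zero_mem _, by simp⟩ fun x y hx hy => ?_
    · by_cases h : e = d
      · subst h; exact ⟨x, hx, by rw [sub_self]; exact zero_mem _⟩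
      · refine ⟨0, zero_mem _, ?_⟩
        rw [map_zero, sub_zero]
        exact AddSubgroup.mem_iSup_of_mem e (AddSubgroup.mem_iSup_of_mem h (hm e x hx))
    · obtain ⟨x', hx', hx''⟩ := hx
      obtain ⟨y', hy', hy''⟩ := hy
      refine ⟨x' + y', add_mem hx' hy', ?_⟩
      rw [map_add, map_add, add_sub_add_comm]
      exact add_mem hx'' hy''
  obtain ⟨b', hb', h⟩ := key
  refine ⟨b', hb', ?_⟩
  have := AddSubgroup.disjoint_def.1 (iSupIndep_def.1 hC d) (sub_mem hc (hm d b' hb')) h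
  exact (sub_eq_zero.1 this).symm

theorem iSupIndep_grSub {M : Type} [AddCommGroup M] [Module (PolyS k n p) M]
    {gr : ℤ × ℤ → AddSubgroup M} (h : iSupIndep gr) (N : Submodule (PolyS k n p) M) :
    iSupIndep (grSub gr N) := by
  rw [iSupIndep_def] at h ⊢
  intro d
  rw [AddSubgroup.disjoint_def]
  intro v hv hv'
  refine Subtype.ext (AddSubgroup.disjoint_def.1 (h d) hv ?_)
  have : (⨆ e, ⨆ (_ : e ≠ d), grSub gr N e) ≤
      (⨆ e, ⨆ (_ : e ≠ d), gr e).comap N.subtype.toAddMonoidHom :=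
    iSup_le fun e => iSup_le fun he w hw =>
      AddSubgroup.mem_iSup_of_mem e (AddSubgroup.mem_iSup_of_mem he hw)
  exact this hv'

/-- The grading of a free module on generators of bidegrees `a`. -/
def grFin {ι : Type} (a : ι → ℤ × ℤ) (d : ℤ × ℤ) : AddSubgroup (ι →₀ PolyS k n p) where
  carrier := {v | ∀ q, v q ∈ piece k n p (d - a q)}
  add_mem' hv hw q := add_mem (hv q) (hw q)
  zero_mem' _ := zero_mem _
  neg_mem' hv q := (piece k n p _).neg_mem (hv q)

theorem single_mem_grFin {ι : Type} (a : ι → ℤ × ℤ) {e : ℤ × ℤ} {s : PolyS k n p}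
    (hs : s ∈ piece k n p e) (q : ι) : Finsupp.single q s ∈ grFin a (e + a q) := by
  classical
  intro q'
  rw [Finsupp.single_apply]
  split_ifs with h
  · subst h; rwa [add_sub_cancel_right]
  · exact zero_mem _

theorem grFin_gen {ι : Type} (a : ι → ℤ × ℤ) : ⨆ d, grFin (k := k) (n := n) (p := p) a d = ⊤ := by
  refine eq_top_iff.2 fun v _ => ?_
  rw [← v.sum_single]
  refine sum_mem fun q _ => ?_
  generalize v q = s
  have hs : s ∈ ⨆ d, grS k n p d := by rw [grS_gen]; trivial
  refine iSup_mem_induction (C := fun s => Finsupp.single q s ∈ ⨆ d, grFin a d) hs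
    (fun e x hx => AddSubgroup.mem_iSup_of_mem _ (single_mem_grFin a hx q)) (by simp)
    fun x y hx hy => ?_
  rw [Finsupp.single_add]
  exact add_mem hx hy

theorem grFin_indep {ι : Type} (a : ι → ℤ × ℤ) :
    iSupIndep (grFin (k := k) (n := n) (p := p) a) := by
  refine iSupIndep_of_proj _ (T := ι → PolyS k n p)
    (fun d => AddMonoidHom.mk' (fun v q => comp k n p (d - a q) (v q)) ?_) ?_ ?_
  · intro v w; ext1 q; simp
  · intro d v hv h
    ext1 q
    have := congrFun h q
    rwa [AddMonoidHom.mk'_apply, comp_of_mem (hv q)] at this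
  · intro d e he v hv
    ext1 q
    exact comp_of_mem_ne (hv q) fun h => he (sub_left_injective h).symm

theorem grFin_law {ι : Type} (a : ι → ℤ × ℤ) :
    GrLaw k n p (grFin (k := k) (n := n) (p := p) a) := by
  intro e d s v hs hv q
  have := piece_mul hs (hv q)
  rwa [← add_sub_assoc] at this

theorem grFin_free {ι : Type} (a : ι → ℤ × ℤ) {r : ℤ} (ha : ∀ q, lam (a q) ≤ r) :
    GrFree k n p lam r (grFin (k := k) (n := n) (p := p) a) where
  law := grFin_law a
  lift := by
    intro B C _ _ _ _ gB gC g f hl hg hf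
    have : ∀ q, ∃ b ∈ gB (a q), g b = f (Finsupp.single q 1) := fun q => hg _ _ (hf _ _ (by
      have := single_mem_grFin a (one_mem_piece (k := k) (n := n) (p := p)) q
      rwa [zero_add] at this))
    choose b hb hbf using this
    refine ⟨Finsupp.linearCombination _ b, fun d v hv => ?_, ?_⟩
    · rw [Finsupp.linearCombination_apply]
      refine sum_mem fun q _ => ?_
      have := hl _ _ (v q) (b q) (hv q) (hb q)
      rwa [sub_add_cancel] at this
    · ext q; simp [hbf]
  high := by
    intro d v hd hv
    rw [← v.sum_single]
    refine sum_mem fun q _ => ?_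
    have hv0 : v q ∈ varIdeal k n p := mem_varIdeal_of_mem_piece (hv q) fun h => by
      have h1 : d = a q := sub_eq_zero.1 h
      have := ha q
      rw [← h1] at this
      omega
    have : Finsupp.single q (v q) = v q • Finsupp.single q (1 : PolyS k n p) := by
      rw [Finsupp.smul_single, smul_eq_mul, mul_one]
    rw [this]
    exact Submodule.smul_mem_smul hv0 trivial

end Gradings

section Minimal

variable {k : Type} [Field k] {n p : ℕ} {lam : ℤ × ℤ →+ ℤ}

/-- The grading of `FMod`. -/
abbrev grF (k : Type) [Field k] (n p : ℕ) (β : ℕ → ℤ × ℤ → ℕ) (i : ℕ) (d : ℤ × ℤ) :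
    AddSubgroup (FMod k n p β i) := grFin (fun q : RIdx β i => q.1.1) d

theorem single_notMem_varIdeal_smul {ι : Type} (q : ι) :
    (Finsupp.single q 1 : ι →₀ PolyS k n p) ∉
      varIdeal k n p • (⊤ : Submodule (PolyS k n p) (ι →₀ PolyS k n p)) := by
  intro h
  have h1 := Submodule.mem_map_of_mem (f := Finsupp.lapply (R := PolyS k n p) q) h
  rw [Submodule.map_smul''] at h1
  have h2 : (1 : PolyS k n p) ∈ varIdeal k n p := by
    have h3 := Submodule.smul_mono le_rfl (le_top (a := Submodule.map (Finsupp.lapply q) ⊤)) h1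
    simpa using h3
  have h4 : varIdeal k n p ≤ RingHom.ker (constantCoeff (R := k) (σ := Fin n ⊕ Fin p)) := by
    rw [varIdeal, Ideal.span_le]
    rintro _ ⟨i, rfl⟩
    simp [RingHom.mem_ker]
  have := h4 h2
  simp [RingHom.mem_ker] at this

theorem lam_le_of_minimal {β : ℕ → ℤ × ℤ → ℕ} {j : ℕ} {N : Type} [AddCommGroup N]
    [Module (PolyS k n p) N] {gN : ℤ × ℤ → AddSubgroup N}
    {π : FMod k n p β j →ₗ[PolyS k n p] N} {r : ℤ}
    (hm : GrMap (grF k n p β j) gN π) (hs : Function.Surjective π)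
    (hker : LinearMap.ker π ≤ varIdeal k n p • ⊤)
    (hN : RegUpTo k n p lam 1 r N gN) (q : RIdx β j) : lam q.1.1 ≤ r := by
  by_contra hlt
  obtain ⟨G, _, _, gG, ρ, hG, hGm, hGs, -⟩ := hN
  set e : FMod k n p β j := Finsupp.single q 1 with he
  have heg : e ∈ grF k n p β j q.1.1 := by
    have := single_mem_grFin (fun q : RIdx β j => q.1.1)
      (one_mem_piece (k := k) (n := n) (p := p)) q
    rwa [zero_add] at this
  obtain ⟨w, hw, hwe⟩ := hGs _ _ (hm _ _ heg)
  obtain ⟨s, -, hs'⟩ := hG.lift (fun _ => (⊤ : AddSubgroup (FMod k n p β j))) gN π ρ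
    (fun _ _ _ _ _ _ => trivial) (fun d c _ => by
      obtain ⟨v, hv⟩ := hs c; exact ⟨v, trivial, hv⟩) hGm
  have h1 : e - s w ∈ LinearMap.ker π := by
    have := LinearMap.congr_fun hs' w
    rw [LinearMap.comp_apply, hwe] at this
    rw [LinearMap.mem_ker, map_sub, this, sub_self]
  have h2 : s w ∈ varIdeal k n p • (⊤ : Submodule (PolyS k n p) (FMod k n p β j)) := by
    have := Submodule.mem_map_of_mem (f := s) (hG.high _ w (not_le.1 hlt) hw)
    rw [Submodule.map_smul''] at this
    exact Submodule.smul_mono le_rfl le_top this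
  have h3 := add_mem (hker h1) h2
  rw [sub_add_cancel] at h3
  exact single_notMem_varIdeal_smul q h3

theorem lam_le_of_minimalResolution {β : ℕ → ℤ × ℤ → ℕ}
    (f : ∀ i : ℕ, FMod k n p β (i + 1) →ₗ[PolyS k n p] FMod k n p β i)
    (hex : ∀ i, Function.Exact (f (i + 1)) (f i))
    (hf : ∀ i, GrMap (grF k n p β (i + 1)) (grF k n p β i) (f i))
    (hmin : ∀ i, LinearMap.range (f i) ≤ varIdeal k n p • ⊤) (i : ℕ) :
    ∀ (j : ℕ) (r : ℤ) (N : Type) [AddCommGroup N] [Module (PolyS k n p) N]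
      (gN : ℤ × ℤ → AddSubgroup N) (π : FMod k n p β j →ₗ[PolyS k n p] N),
      GrMap (grF k n p β j) gN π → GrSurj (grF k n p β j) gN π → Function.Surjective π →
      LinearMap.ker π = LinearMap.range (f j) → RegUpTo k n p lam (i + 1) r N gN →
      ∀ q : RIdx β (j + i), lam q.1.1 ≤ r + i := by
  induction i with
  | zero =>
    intro j r N _ _ gN π hm hgs hs hk hN q
    have := lam_le_of_minimal hm hs (hk ▸ hmin j) hN q
    simpa using this
  | succ i ih =>
    intro j r N _ _ gN π hm hgs hs hk hN
    have hN1 : RegUpTo k n p lam 1 r N gN := by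
      clear ih
      induction i with
      | zero => exact hN.of_succ
      | succ i ih => exact ih hN.of_succ
    have hb := lam_le_of_minimal hm hs (hk ▸ hmin j) hN1
    have hreg : RegUpTo k n p lam (i + 1) (r + 1) (LinearMap.ker π)
        (grSub (grF k n p β j) (LinearMap.ker π)) := by
      refine RegUpTo.of_exact_left (GrExact.ker hm hgs) (grFin_law _)
        ((grFin_free _ fun q => (hb q).trans (by omega)).regUpTo _) ?_
      rwa [add_sub_cancel_right]
    have hcod : ∀ v, f j v ∈ LinearMap.ker π := fun v => hk ▸ ⟨v, rfl⟩
    have hm' : GrMap (grF k n p β (j + 1)) (grSub (grF k n p β j) (LinearMap.ker π))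
        ((f j).codRestrict _ hcod) := fun d v hv => hf j d v hv
    have hs' : Function.Surjective ((f j).codRestrict (LinearMap.ker π) hcod) := by
      rintro ⟨v, hv⟩
      rw [hk] at hv
      obtain ⟨w, rfl⟩ := hv
      exact ⟨w, rfl⟩
    have := ih (j + 1) (r + 1) (LinearMap.ker π) _ ((f j).codRestrict _ hcod) hm'
      (fun d c hc => hm'.exists_mem_of_mem_range (grFin_gen _)
        (iSupIndep_grSub (grFin_indep _) _) hc (hs' c)) hs'
      (by rw [LinearMap.ker_codRestrict]; exact LinearMap.exact_iff.1 (hex j)) hreg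
    rw [show j + (i + 1) = j + 1 + i by omega]
    intro q
    have := this q
    push_cast
    omega

end Minimal

section Koszul

/-- The sign of moving the basis vector `e_j` past the smaller elements of `T`. -/
def sg {m : ℕ} (j : Fin m) (T : Finset (Fin m)) : ℤ := (-1) ^ (T.filter (· < j)).card

theorem sg_mul_self {m : ℕ} (j : Fin m) (T : Finset (Fin m)) : sg j T * sg j T = 1 := by
  rw [sg, ← pow_add, ← two_mul, pow_mul]; simp

theorem sg_insert {m : ℕ} {j k : Fin m} {T : Finset (Fin m)} (h : k ∉ T) :
    sg j (insert k T) = if k < j then -sg j T else sg j T := by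
  rw [sg, Finset.filter_insert]
  split_ifs with hk
  · rw [Finset.card_insert_of_notMem (by simp [h]), pow_succ, sg]; ring
  · rfl

theorem sg_insert_self {m : ℕ} {j : Fin m} {T : Finset (Fin m)} (h : j ∉ T) :
    sg j (insert j T) = sg j T := by rw [sg_insert h, if_neg (lt_irrefl j)]

/-- Antisymmetry of the signs. -/
theorem sg_swap {m : ℕ} {j k : Fin m} {T : Finset (Fin m)} (hjk : j ≠ k) (hj : j ∉ T)
    (hk : k ∉ T) : sg j T * sg k (insert j T) = -(sg k T * sg j (insert k T)) := by
  rw [sg_insert hj, sg_insert hk]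
  rcases lt_or_gt_of_ne hjk with h | h
  · rw [if_pos h, if_neg h.not_gt]; ring
  · rw [if_pos h, if_neg h.not_gt]; ring

variable {R : Type} [CommRing R] {m : ℕ} {N : Type} [AddCommGroup N] [Module R N]

variable (R N) in
/-- Contraction with the `j`-th dual basis vector. -/
def ctr1 (j : Fin m) : (Finset (Fin m) → N) →ₗ[R] (Finset (Fin m) → N) where
  toFun c T := if j ∈ T then 0 else sg j T • c (insert j T)
  map_add' c d := by
    ext T; simp only [Pi.add_apply]; split_ifs <;> simp
  map_smul' r c := by
    ext T; simp only [Pi.smul_apply, RingHom.id_apply]; split_ifs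
    · simp
    · rw [smul_comm]

variable (R N) in
/-- Left multiplication by the `j`-th basis vector. -/
def wdg1 (j : Fin m) : (Finset (Fin m) → N) →ₗ[R] (Finset (Fin m) → N) where
  toFun c T := if j ∈ T then sg j T • c (T.erase j) else 0
  map_add' c d := by
    ext T; simp only [Pi.add_apply]; split_ifs <;> simp
  map_smul' r c := by
    ext T; simp only [Pi.smul_apply, RingHom.id_apply]; split_ifs
    · rw [smul_comm]
    · simp

theorem ctr1_apply (j : Fin m) (c : Finset (Fin m) → N) (T : Finset (Fin m)) :
    ctr1 R N j c T = if j ∈ T then 0 else sg j T • c (insert j T) := rfl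

theorem wdg1_apply (j : Fin m) (c : Finset (Fin m) → N) (T : Finset (Fin m)) :
    wdg1 R N j c T = if j ∈ T then sg j T • c (T.erase j) else 0 := rfl

theorem ctr1_ctr1_self (j : Fin m) (c : Finset (Fin m) → N) :
    ctr1 R N j (ctr1 R N j c) = 0 := by
  ext T
  simp [ctr1_apply]

theorem ctr1_ctr1_swap {j k : Fin m} (h : j ≠ k) (c : Finset (Fin m) → N) :
    ctr1 R N j (ctr1 R N k c) = -ctr1 R N k (ctr1 R N j c) := by
  ext T
  simp only [ctr1_apply, Pi.neg_apply, Finset.mem_insert]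
  by_cases hj : j ∈ T
  · simp [hj]
  by_cases hk : k ∈ T
  · simp [hk]
  simp only [hj, hk, h, h.symm, or_self, if_false]
  rw [smul_smul, smul_smul, sg_swap h hj hk, neg_smul, Finset.insert_comm]

theorem ctr1_wdg1_self (j : Fin m) (c : Finset (Fin m) → N) :
    ctr1 R N j (wdg1 R N j c) + wdg1 R N j (ctr1 R N j c) = c := by
  ext T
  simp only [Pi.add_apply, ctr1_apply, wdg1_apply]
  by_cases hj : j ∈ T
  · have h1 : sg j T = sg j (T.erase j) := by
      conv_lhs => rw [← Finset.insert_erase hj]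
      exact sg_insert_self (Finset.notMem_erase j T)
    simp [hj, smul_smul, h1, sg_mul_self]
  · simp [hj, smul_smul, sg_insert_self hj, sg_mul_self]

theorem ctr1_wdg1_swap {j k : Fin m} (h : j ≠ k) (c : Finset (Fin m) → N) :
    ctr1 R N j (wdg1 R N k c) = -wdg1 R N k (ctr1 R N j c) := by
  ext T
  simp only [ctr1_apply, wdg1_apply, Pi.neg_apply, Finset.mem_insert, Finset.mem_erase]
  by_cases hj : j ∈ T
  · simp [hj, h]
  by_cases hk : k ∈ T
  · have hk' := Finset.notMem_erase k T
    have hj' : j ∉ T.erase k := fun h => hj (Finset.mem_of_mem_erase h)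
    have h1 := sg_swap h hj' hk'
    rw [Finset.insert_erase hk] at h1
    have h2 : sg k (insert j (T.erase k)) = sg k (insert j T) := by
      have : insert j T = insert k (insert j (T.erase k)) := by
        rw [Finset.insert_comm, Finset.insert_erase hk]
      rw [this, sg_insert_self]
      simp [h.symm]
    have h3 : sg k T = sg k (T.erase k) := by
      conv_lhs => rw [← Finset.insert_erase hk]
      exact sg_insert_self hk'
    have h4 : sg j T * sg k (insert j T) = -(sg k T * sg j (T.erase k)) := by
      have e1 := sg_mul_self j T
      have e2 := sg_mul_self j (T.erase k)
      have e3 := sg_mul_self k T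
      rw [h2] at h1
      rw [← h3] at h1
      have : sg j T * sg j (T.erase k) * (sg j (T.erase k) * sg k (insert j T)) =
        sg j T * sg j (T.erase k) * (-(sg k T * sg j T)) := by rw [h1]
      linear_combination this - sg j T * sg k (insert j T) * e2 - sg k T * sg j (T.erase k) * e1
    simp only [hj, hk, h.symm, if_false, if_true, or_true, and_false,
      smul_smul, h4, neg_smul]
    rw [Finset.erase_insert_of_ne h]
  · simp [hj, hk, h.symm]

/-- Contraction with the vector `v`. -/
def ctr (N : Type) [AddCommGroup N] [Module R N] (v : Fin m → R) :
    (Finset (Fin m) → N) →ₗ[R] (Finset (Fin m) → N) :=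
  ∑ j, v j • ctr1 R N j

theorem ctr_apply (v : Fin m → R) (c : Finset (Fin m) → N) :
    ctr N v c = ∑ j, v j • ctr1 R N j c := by
  simp [ctr]

theorem ctr_apply_apply (v : Fin m → R) (c : Finset (Fin m) → N) (T : Finset (Fin m)) :
    ctr N v c T = ∑ j, v j • ctr1 R N j c T := by
  simp [ctr_apply]

theorem ctr_add (v w : Fin m → R) : ctr N (v + w) = ctr N v + ctr N w := by
  simp [ctr, add_smul, Finset.sum_add_distrib]

theorem ctr_ctr_self (v : Fin m → R) (c : Finset (Fin m) → N) : ctr N v (ctr N v c) = 0 := by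
  simp only [ctr_apply, map_sum, map_smul, Finset.smul_sum]
  rw [← Finset.sum_product']
  refine Finset.sum_involution (fun q _ => q.swap) ?_ ?_ ?_ ?_
  · rintro ⟨j, k⟩ -
    by_cases h : j = k
    · subst h; simp [ctr1_ctr1_self]
    · simp only [Prod.fst_swap, Prod.snd_swap]
      rw [ctr1_ctr1_swap h, smul_neg, smul_neg, smul_smul, smul_smul, mul_comm]
      exact add_neg_cancel ((v k * v j) • ctr1 R N k (ctr1 R N j c))
  · rintro ⟨j, k⟩ - h h'
    obtain rfl : k = j := congrArg Prod.fst h'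
    exact h (by simp [ctr1_ctr1_self])
  · simp
  · simp

theorem ctr_ctr_swap (v w : Fin m → R) (c : Finset (Fin m) → N) :
    ctr N v (ctr N w c) = -ctr N w (ctr N v c) := by
  have h := ctr_ctr_self (v + w) c
  simp only [ctr_add, LinearMap.add_apply, map_add, ctr_ctr_self, zero_add, add_zero] at h
  exact eq_neg_of_add_eq_zero_right h

theorem ctr_wdg1 (v : Fin m → R) (j : Fin m) (c : Finset (Fin m) → N) :
    ctr N v (wdg1 R N j c) = v j • c - wdg1 R N j (ctr N v c) := by
  rw [eq_sub_iff_add_eq]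
  simp only [ctr_apply, map_sum, map_smul]
  rw [← Finset.sum_add_distrib, Finset.sum_eq_single j]
  · rw [← smul_add, ctr1_wdg1_self]
  · intro k _ hk
    rw [ctr1_wdg1_swap hk, smul_neg, neg_add_cancel]
  · simp

theorem ctr_map {N' : Type} [AddCommGroup N'] [Module R N'] (g : N →ₗ[R] N') (v : Fin m → R)
    (c : Finset (Fin m) → N) : ctr N' v (fun T => g (c T)) = fun T => g (ctr N v c T) := by
  ext T
  simp only [ctr_apply_apply, map_sum, map_smul, ctr1_apply]
  refine Finset.sum_congr rfl fun j _ => ?_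
  split_ifs
  · simp
  · rw [map_zsmul]

variable (R N) in
/-- Elements supported on a set of indices. -/
def suppOn {ι : Type} (s : Set ι) : Submodule R (ι → N) where
  carrier := {c | ∀ q, q ∉ s → c q = 0}
  add_mem' hc hd q hq := by rw [Pi.add_apply, hc q hq, hd q hq, add_zero]
  zero_mem' _ _ := rfl
  smul_mem' r c hc q hq := by rw [Pi.smul_apply, hc q hq, smul_zero]

variable (R m N) in
/-- The part of exterior degree `i` of the Koszul complex. -/
abbrev Kd (i : ℕ) : Submodule R (Finset (Fin m) → N) := suppOn R N {T | T.card = i}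

theorem ctr1_mem {i : ℕ} {j : Fin m} {c : Finset (Fin m) → N} (hc : c ∈ Kd R m N (i + 1)) :
    ctr1 R N j c ∈ Kd R m N i := by
  intro T hT
  rw [ctr1_apply]
  split_ifs with h
  · rfl
  · rw [hc _ (by simpa [Finset.card_insert_of_notMem h] using hT), smul_zero]

theorem ctr_mem {i : ℕ} {v : Fin m → R} {c : Finset (Fin m) → N} (hc : c ∈ Kd R m N (i + 1)) :
    ctr N v c ∈ Kd R m N i := by
  rw [ctr_apply]
  exact sum_mem fun j _ => Submodule.smul_mem _ _ (ctr1_mem hc)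

theorem ctr_zero_of_Kd {v : Fin m → R} {c : Finset (Fin m) → N} (hc : c ∈ Kd R m N 0) :
    ctr N v c = 0 := by
  ext T
  rw [ctr_apply_apply]
  refine Finset.sum_eq_zero fun j _ => ?_
  rw [ctr1_apply]
  split_ifs with h
  · simp
  · rw [hc _ (by simp), smul_zero, smul_zero]

theorem wdg1_mem {i : ℕ} {j : Fin m} {c : Finset (Fin m) → N} (hc : c ∈ Kd R m N i) :
    wdg1 R N j c ∈ Kd R m N (i + 1) := by
  intro T hT
  rw [wdg1_apply]
  split_ifs with h
  · rw [hc _ fun h' => hT ((Finset.card_erase_add_one h).symm.trans (congrArg (· + 1) h')),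
      smul_zero]
  · rfl

theorem eq_zero_of_lt {i : ℕ} (hi : m < i) {c : Finset (Fin m) → N} (hc : c ∈ Kd R m N i) :
    c = 0 := by
  ext T
  refine hc T fun h => ?_
  have : T.card ≤ m := by simpa using T.card_le_univ
  have h' : T.card = i := h
  omega

/-- Iterated contraction with `v 0, …, v (t-1)` (in this order). -/
def ctrs (N : Type) [AddCommGroup N] [Module R N] (v : ℕ → Fin m → R) : ℕ →
    (Finset (Fin m) → N) →ₗ[R] (Finset (Fin m) → N)
  | 0 => LinearMap.id
  | t + 1 => (ctr N (v t)).comp (ctrs N v t)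

theorem ctrs_succ (v : ℕ → Fin m → R) (t : ℕ) (c : Finset (Fin m) → N) :
    ctrs N v (t + 1) c = ctr N (v t) (ctrs N v t c) := rfl

theorem ctrs_succ' (v : ℕ → Fin m → R) (t : ℕ) (c : Finset (Fin m) → N) :
    ctrs N v (t + 1) c = ctrs N (fun l => v (l + 1)) t (ctr N (v 0) c) := by
  induction t with
  | zero => rfl
  | succ t ih => rw [ctrs_succ, ih, ctrs_succ]

theorem ctrs_mem {v : ℕ → Fin m → R} {t i : ℕ} {c : Finset (Fin m) → N}
    (hc : c ∈ Kd R m N (i + t)) : ctrs N v t c ∈ Kd R m N i := by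
  induction t generalizing i with
  | zero => exact hc
  | succ t ih => exact ctr_mem (ih (by rwa [add_assoc, add_comm 1 t]))

theorem ctrs_map {N' : Type} [AddCommGroup N'] [Module R N'] (g : N →ₗ[R] N') (v : ℕ → Fin m → R)
    (t : ℕ) (c : Finset (Fin m) → N) :
    ctrs N' v t (fun T => g (c T)) = fun T => g (ctrs N v t c T) := by
  induction t with
  | zero => rfl
  | succ t ih => rw [ctrs_succ, ih, ctr_map, ctrs_succ]

variable (R) in
/-- Iterated wedge. -/
def wdgs : ∀ t : ℕ, (Fin t → Fin m) → (Finset (Fin m) → N) → (Finset (Fin m) → N)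
  | 0, _, a => a
  | t + 1, f, a => wdg1 R N (f 0) (wdgs t (fun j => f j.succ) a)

theorem wdgs_mem {t : ℕ} {f : Fin t → Fin m} {a : Finset (Fin m) → N} (ha : a ∈ Kd R m N 0) :
    wdgs R t f a ∈ Kd R m N t := by
  induction t with
  | zero => exact ha
  | succ t ih => exact wdg1_mem ih

theorem ctr_wdgs {t : ℕ} (v : Fin m → R) (f : Fin (t + 1) → Fin m) {a : Finset (Fin m) → N}
    (ha : a ∈ Kd R m N 0) : ctr N v (wdgs R (t + 1) f a) =
      ∑ j : Fin (t + 1), ((-1) ^ (j : ℕ) * v (f j)) • wdgs R t (fun l => f (j.succAbove l)) a := by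
  induction t with
  | zero => simp [wdgs, ctr_wdg1, ctr_zero_of_Kd ha]
  | succ t ih =>
    rw [wdgs, ctr_wdg1, ih, Fin.sum_univ_succ (n := t + 1), map_sum, sub_eq_add_neg]
    simp only [map_smul]
    congr 1
    · simp
    · rw [← Finset.sum_neg_distrib]
      refine Finset.sum_congr rfl fun j _ => ?_
      rw [← neg_smul, Fin.val_succ, pow_succ]
      congr 1
      · ring
      · rw [wdgs]
        simp

theorem ctrs_wdgs (t : ℕ) (v : ℕ → Fin m → R) (f : Fin t → Fin m) {a : Finset (Fin m) → N}
    (ha : a ∈ Kd R m N 0) : ctrs N v t (wdgs R t f a) =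
      (Matrix.of fun i j : Fin t => v i (f j)).det • a := by
  induction t generalizing v with
  | zero => simp [ctrs, wdgs]
  | succ t ih =>
    rw [ctrs_succ', ctr_wdgs _ _ ha, map_sum, Matrix.det_succ_row_zero, Finset.sum_smul]
    refine Finset.sum_congr rfl fun j _ => ?_
    rw [map_smul, ih, smul_smul]
    rfl

theorem single_mem_span_wdgs (t : ℕ) : ∀ (T : Finset (Fin m)) (b : N), T.card = t →
    Pi.single T b ∈ Submodule.span R {c | ∃ f a, a ∈ Kd R m N 0 ∧ c = wdgs R t f a} := by
  induction t with
  | zero =>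
    intro T b hT
    refine Submodule.subset_span ⟨Fin.elim0, Pi.single T b, ?_, rfl⟩
    intro T' hT'
    rw [Pi.single_eq_of_ne]
    rintro rfl
    exact hT' hT
  | succ t ih =>
    intro T b hT
    obtain ⟨j, hj⟩ : T.Nonempty := by rw [← Finset.card_pos]; omega
    have h1 := ih (T.erase j) (sg j T • b) (by rw [Finset.card_erase_of_mem hj]; omega)
    have h2 := Submodule.mem_map_of_mem (f := wdg1 R N j) h1
    have h3 : wdg1 R N j (Pi.single (T.erase j) (sg j T • b)) = Pi.single T b := by
      ext T'
      rw [wdg1_apply]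
      by_cases h : T' = T
      · subst h
        simp [hj, smul_smul, sg_mul_self]
      · rw [Pi.single_eq_of_ne h]
        split_ifs with h'
        · rw [Pi.single_eq_of_ne, smul_zero]
          intro h''
          exact h (by rw [← Finset.insert_erase hj, ← h'', Finset.insert_erase h'])
        · rfl
    rw [h3, Submodule.map_span] at h2
    refine Submodule.span_mono ?_ h2
    rintro _ ⟨_, ⟨f, a, ha, rfl⟩, rfl⟩
    exact ⟨Fin.cons j f, a, ha, by simp [wdgs]⟩

theorem mem_span_wdgs {t : ℕ} {c : Finset (Fin m) → N} (hc : c ∈ Kd R m N t) :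
    c ∈ Submodule.span R {c | ∃ f a, a ∈ Kd R m N 0 ∧ c = wdgs R t f a} := by
  rw [← Finset.univ_sum_single c]
  refine sum_mem fun T _ => ?_
  by_cases hT : T.card = t
  · exact single_mem_span_wdgs t T _ hT
  · rw [hc T hT, Pi.single_zero]
    exact zero_mem _

theorem ctrs_apply_mem {I : Ideal R} {v : ℕ → Fin m → R} {t : ℕ}
    (hI : ∀ f : Fin t → Fin m, (Matrix.of fun i j : Fin t => v i (f j)).det ∈ I)
    {c : Finset (Fin m) → R} (hc : c ∈ Kd R m R t) (T : Finset (Fin m)) :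
    ctrs R v t c T ∈ I := by
  refine Submodule.span_induction (p := fun c _ => ctrs R v t c T ∈ I) ?_ ?_ ?_ ?_
    (mem_span_wdgs hc)
  · rintro _ ⟨f, a, ha, rfl⟩
    rw [ctrs_wdgs _ _ _ ha]
    exact I.mul_mem_right _ (hI f)
  · simp
  · intro x y _ _ hx hy
    rw [map_add]
    exact add_mem hx hy
  · intro r x _ hx
    rw [map_smul]
    exact I.mul_mem_left _ hx

end Koszul

section Torsion

variable {R : Type} [CommRing R] {m : ℕ} {z : Fin m → R}

/-- Koszul chains with coefficients in the ideal `I`. -/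
def IK (m : ℕ) (I : Ideal R) : Submodule R (Finset (Fin m) → R) where
  carrier := {c | ∀ T, c T ∈ I}
  add_mem' hc hd T := add_mem (hc T) (hd T)
  zero_mem' _ := zero_mem _
  smul_mem' r _ hc T := I.mul_mem_left r (hc T)

theorem mem_IK {I : Ideal R} {c : Finset (Fin m) → R} : c ∈ IK m I ↔ ∀ T, c T ∈ I := Iff.rfl

theorem IK_mono {I I' : Ideal R} (h : I ≤ I') : IK m I ≤ IK m I' := fun _ hc T => h (hc T)

theorem IK_bot : IK m (⊥ : Ideal R) = ⊥ := by
  ext c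
  simp only [mem_IK, Ideal.mem_bot, Submodule.mem_bot, funext_iff, Pi.zero_apply]

theorem ctr_mem_IK {I : Ideal R} (v : Fin m → R) {c : Finset (Fin m) → R} (hc : c ∈ IK m I) :
    ctr R v c ∈ IK m I := by
  intro T
  rw [ctr_apply_apply]
  refine sum_mem fun j _ => I.mul_mem_left _ ?_
  rw [ctr1_apply]
  split_ifs
  · exact zero_mem _
  · rw [zsmul_eq_mul]; exact I.mul_mem_left _ (hc _)

/-- Boundaries modulo `I`. -/
def Bd (z : Fin m → R) (I : Ideal R) (i : ℕ) : Submodule R (Finset (Fin m) → R) :=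
  (Kd R m R (i + 1)).map (ctr R z) ⊔ IK m I

theorem mem_Bd {I : Ideal R} {i : ℕ} {c : Finset (Fin m) → R} :
    c ∈ Bd z I i ↔ ∃ b ∈ Kd R m R (i + 1), c - ctr R z b ∈ IK m I := by
  rw [Bd, Submodule.mem_sup]
  constructor
  · rintro ⟨_, ⟨b, hb, rfl⟩, y, hy, rfl⟩
    exact ⟨b, hb, by rwa [add_sub_cancel_left]⟩
  · rintro ⟨b, hb, h⟩
    exact ⟨_, ⟨b, hb, rfl⟩, _, h, add_sub_cancel _ _⟩

theorem Bd_mono {I I' : Ideal R} (h : I ≤ I') (i : ℕ) : Bd z I i ≤ Bd z I' i :=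
  sup_le_sup_left (IK_mono h) _

theorem exists_sub_smul_mem {I : Ideal R} {a : R} {i : ℕ} {c : Finset (Fin m) → R}
    (hc : c ∈ Kd R m R i) (h : c ∈ IK m (I ⊔ Ideal.span {a})) :
    ∃ b ∈ Kd R m R i, c - a • b ∈ IK m I := by
  have : ∀ T, ∃ b, c T - a * b ∈ I ∧ (c T = 0 → b = 0) := by
    intro T
    by_cases h0 : c T = 0
    · exact ⟨0, by simp [h0], fun _ => rfl⟩
    obtain ⟨y, hy, x, hx, hxy⟩ := Submodule.mem_sup.1 (h T)
    obtain ⟨b, rfl⟩ := Ideal.mem_span_singleton'.1 hx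
    exact ⟨b, by rw [← hxy, mul_comm a, add_sub_cancel_right]; exact hy, fun h => absurd h h0⟩
  choose b hb hb0 using this
  exact ⟨b, fun T hT => hb0 T (hc T hT), hb⟩

theorem RegMod.vec {W : Submonoid R} {I : Ideal R} {a : R} (h : RegMod W I a)
    {c : Finset (Fin m) → R} (hc : a • c ∈ IK m I) : ∃ w ∈ W, w • c ∈ IK m I :=
  exists_common_mem W (fun T w => w * c T ∈ I)
    (fun T a b hab => by rw [mul_assoc]; exact I.mul_mem_left b hab) fun T => h _ (hc T)

/-- Koszul cycles modulo `I` of degree `i` are boundaries up to multiples in `W`. -/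
def Tors (z : Fin m → R) (W : Submonoid R) (I : Ideal R) (i : ℕ) : Prop :=
  ∀ c ∈ Kd R m R i, ctr R z c ∈ IK m I → ∃ w ∈ W, w • c ∈ Bd z I i

theorem Tors.sup {W W' : Submonoid R} {I : Ideal R} {a : R} {i : ℕ} (h1 : Tors z W I (i + 1))
    (h0 : Tors z W I i) (ha : RegMod W' I a) (hW : W' ≤ W) :
    Tors z W (I ⊔ Ideal.span {a}) (i + 1) := by
  intro c hc hzc
  obtain ⟨b, hb, hcb⟩ := exists_sub_smul_mem (ctr_mem hc) hzc
  have h2 : a • ctr R z b ∈ IK m I := by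
    have := ctr_mem_IK z hcb
    rw [map_sub, ctr_ctr_self, zero_sub, map_smul] at this
    exact (neg_mem_iff).1 this
  obtain ⟨u, hu, hub⟩ := ha.vec h2
  obtain ⟨w, hw, hwb⟩ := h0 (u • b) (Submodule.smul_mem _ _ hb) (by rwa [map_smul])
  obtain ⟨e, he, hbe⟩ := mem_Bd.1 hwb
  obtain ⟨w', hw', hwc⟩ := h1 ((w * u) • c - a • e)
    (sub_mem (Submodule.smul_mem _ _ hc) (Submodule.smul_mem _ _ he)) (by
      have e1 : ctr R z ((w * u) • c - a • e) =
          (w * u) • (ctr R z c - a • b) + a • (w • u • b - ctr R z e) := by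
        simp only [map_sub, map_smul, smul_sub, smul_smul]
        rw [show w * u * a = a * (w * u) by ring]
        abel
      rw [e1]
      exact add_mem (Submodule.smul_mem _ _ hcb) (Submodule.smul_mem _ _ hbe))
  refine ⟨w' * (w * u), W.mul_mem hw' (W.mul_mem hw (hW hu)), ?_⟩
  have e2 : (w' * (w * u)) • c = w' • ((w * u) • c - a • e) + (w' * a) • e := by
    rw [smul_sub, smul_smul, smul_smul, sub_add_cancel]
  rw [e2]
  refine add_mem (Bd_mono le_sup_left _ hwc) (Submodule.mem_sup_right fun T => ?_)
  exact Ideal.mul_mem_right _ _ (Ideal.mul_mem_left _ _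
    (Ideal.mem_sup_right (Ideal.mem_span_singleton_self a)))

/-- The multiplicative set of products of elements of `U` and powers of `a`. -/
abbrev withPowers (U : Submonoid R) (a : R) : Submonoid R := U ⊔ Submonoid.powers a

theorem Tors.of_sup {U : Submonoid R} {I : Ideal R} {a : R} {i : ℕ}
    (h1 : Tors z U (I ⊔ Ideal.span {a}) (i + 1)) (h0 : Tors z (withPowers U a) I i)
    (ha : RegMod U I a) : Tors z U I i := by
  have key : ∀ s : ℕ, ∀ c ∈ Kd R m R i, ∀ u ∈ U, (u * a ^ s) • c ∈ Bd z I i →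
      ∃ u ∈ U, u • c ∈ Bd z I i := by
    intro s
    induction s with
    | zero => intro c _ u hu h; exact ⟨u, hu, by simpa using h⟩
    | succ s ih =>
      intro c hc u hu h
      obtain ⟨e, he, hce⟩ := mem_Bd.1 h
      have e1 : ctr R z e ∈ IK m (I ⊔ Ideal.span {a}) := by
        have e2 : ctr R z e = a • ((u * a ^ s) • c) - ((u * a ^ (s + 1)) • c - ctr R z e) := by
          rw [smul_smul, show a * (u * a ^ s) = u * a ^ (s + 1) by ring]; abel
        rw [e2]
        refine sub_mem (fun T => ?_) (IK_mono le_sup_left hce)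
        exact Ideal.mul_mem_right _ _ (Ideal.mem_sup_right (Ideal.mem_span_singleton_self a))
      obtain ⟨w, hw, hwe⟩ := h1 e he e1
      obtain ⟨f, hf, hef⟩ := mem_Bd.1 hwe
      have hk : w • e - ctr R z f ∈ Kd R m R (i + 1) :=
        sub_mem (Submodule.smul_mem _ _ he) (ctr_mem hf)
      obtain ⟨g, hg, hfg⟩ := exists_sub_smul_mem hk hef
      have e3 : a • ((w * u * a ^ s) • c - ctr R z g) ∈ IK m I := by
        have e4 : a • ((w * u * a ^ s) • c - ctr R z g) =
            w • ((u * a ^ (s + 1)) • c - ctr R z e) + ctr R z (w • e - ctr R z f - a • g) := by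
          simp only [map_sub, map_smul, smul_sub, smul_smul, ctr_ctr_self]
          rw [show w * (u * a ^ (s + 1)) = a * (w * u * a ^ s) by ring]
          abel
        rw [e4]
        exact add_mem (Submodule.smul_mem _ _ hce) (ctr_mem_IK z hfg)
      obtain ⟨u', hu', hug⟩ := ha.vec e3
      refine ih c hc (u' * (w * u)) (U.mul_mem hu' (U.mul_mem hw hu)) (mem_Bd.2 ⟨u' • g,
        Submodule.smul_mem _ _ hg, ?_⟩)
      rwa [map_smul, show u' * (w * u) * a ^ s = u' * (w * u * a ^ s) by ring, mul_smul,
        ← smul_sub]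
  intro c hc hzc
  obtain ⟨w, hw, hwc⟩ := h0 c hc hzc
  obtain ⟨u, hu, v, ⟨s, rfl⟩, rfl⟩ := Submonoid.mem_sup.1 hw
  exact key s c hc u hu hwc

theorem Tors.of_locReg {U : Submonoid R} (P : R → Prop) (l : List R) : ∀ {I : Ideal R} {r : ℕ},
    LocReg U I l → (∀ a ∈ l, P a) → m ≤ r + l.length →
    (∀ a, P a → ∀ i, r + 1 ≤ i → Tors z (withPowers U a) I i) →
    ∀ i, r + 1 ≤ i → Tors z U I i := by
  induction l with
  | nil =>
    intro I r _ _ hm _ i hi c hc _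
    refine ⟨1, U.one_mem, ?_⟩
    rw [eq_zero_of_lt (by simp at hm; omega) hc, smul_zero]
    exact zero_mem _
  | cons a l ih =>
    intro I r hl hP hm hT i hi
    have hTa := hT a (hP a (by simp))
    refine Tors.of_sup (ih (r := r + 1) hl.2 (fun b hb => hP b (by simp [hb]))
      (by simp at hm; omega) (fun b hb j hj => ?_) (i + 1) (by omega)) (hTa i hi) hl.1
    obtain ⟨j, rfl⟩ : ∃ j', j = j' + 1 := ⟨j - 1, by omega⟩
    exact Tors.sup (hT b hb _ (by omega)) (hT b hb _ (by omega)) hl.1 le_sup_left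

/-- The multipliers turning `c` into a boundary. -/
def annBd (z : Fin m → R) (i : ℕ) (c : Finset (Fin m) → R) : Ideal R :=
  (Bd z ⊥ i).comap (LinearMap.toSpanSingleton R _ c)

theorem mem_annBd {i : ℕ} {c : Finset (Fin m) → R} {r : R} :
    r ∈ annBd z i c ↔ r • c ∈ Bd z ⊥ i := by
  simp [annBd]

theorem exists_prime_of_not_tors {W : Submonoid R} {i : ℕ} {c : Finset (Fin m) → R}
    (h : ¬∃ w ∈ W, w • c ∈ Bd z ⊥ i) :
    ∃ Q : Ideal R, Q.IsPrime ∧ annBd z i c ≤ Q ∧ ∀ w ∈ W, w ∉ Q := by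
  have hd : Disjoint (annBd z i c : Set R) (W : Set R) := by
    rw [Set.disjoint_left]
    intro w hw hw'
    exact h ⟨w, hw', mem_annBd.1 hw⟩
  obtain ⟨Q, hQ, hle, hdis⟩ := Ideal.exists_le_prime_disjoint _ _ hd
  exact ⟨Q, hQ, hle, fun w hw hwQ => Set.disjoint_left.1 hdis hwQ hw⟩

theorem tors_primeCompl [IsNoetherianRing R] (hR : HasLocalParameters R) (x : R)
    (hx : ∀ (P : Ideal R) [P.IsPrime], x ∉ P → (∀ j, z j ∈ P) → m ≤ P.height) :
    ∀ (h : ℕ∞) (P : Ideal R) [P.IsPrime], P.height = h → x ∉ P → ∀ i, 1 ≤ i →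
      Tors z P.primeCompl ⊥ i := by
  intro h
  induction h using WellFoundedLT.induction with
  | ind h ih =>
    intro P hP hPh hxP i hi
    by_cases hz : ∀ j, z j ∈ P
    · obtain ⟨l, hlm, hlP, hl⟩ := hR.exists_locReg P m (hx P hxP hz)
      refine Tors.of_locReg (· ∈ P) l (r := 0) hl hlP (by omega) (fun a ha i hi c hc hzc => ?_)
        i (by omega)
      by_contra hcon
      obtain ⟨Q, hQ, hle, hdis⟩ := exists_prime_of_not_tors hcon
      have hQP : Q < P := by
        refine lt_of_le_of_ne (fun q hq => ?_) ?_
        · by_contra hqP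
          exact hdis q (Submonoid.mem_sup_left hqP) hq
        · rintro rfl
          exact hdis a (Submonoid.mem_sup_right (Submonoid.mem_powers a)) ha
      obtain ⟨w, hw, hwc⟩ := ih Q.height (hPh ▸ Ideal.height_strict_mono_of_isPrime hQP) Q rfl
        (fun hxQ => hxP (hQP.le hxQ)) i (by omega) c hc hzc
      exact hw (hle (mem_annBd.2 hwc))
    · push Not at hz
      obtain ⟨j, hj⟩ := hz
      intro c hc hzc
      rw [IK_bot, Submodule.mem_bot] at hzc
      refine ⟨z j, hj, mem_Bd.2 ⟨wdg1 R R j c, wdg1_mem hc, ?_⟩⟩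
      rw [ctr_wdg1, hzc, map_zero, sub_zero, sub_self]
      exact zero_mem _

theorem tors_powers [IsNoetherianRing R] (hR : HasLocalParameters R) (x : R)
    (hx : ∀ (P : Ideal R) [P.IsPrime], x ∉ P → (∀ j, z j ∈ P) → m ≤ P.height) (i : ℕ)
    (hi : 1 ≤ i) : Tors z (Submonoid.powers x) ⊥ i := by
  intro c hc hzc
  by_contra hcon
  obtain ⟨Q, hQ, hle, hdis⟩ := exists_prime_of_not_tors hcon
  obtain ⟨w, hw, hwc⟩ := tors_primeCompl hR x hx _ Q rfl (hdis x (Submonoid.mem_powers x)) i hi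
    c hc hzc
  exact hw (hle (mem_annBd.2 hwc))

end Torsion

section XIdeals

variable {k : Type} [Field k] {n p : ℕ}

theorem weight_bideg_fst (e : Fin n ⊕ Fin p →₀ ℕ) :
    (Finsupp.weight (bideg n p) e).1 = ∑ l : Fin n, (e (Sum.inl l) : ℤ) := by
  rw [Finsupp.weight_apply, Finsupp.sum_fintype _ _ (by simp), Prod.fst_sum,
    Fintype.sum_sum_type]
  simp [bideg]

theorem weight_of_mem_piece {d : ℤ × ℤ} {s : PolyS k n p} (hs : s ∈ piece k n p d)
    {e : Fin n ⊕ Fin p →₀ ℕ} (he : e ∈ s.support) : Finsupp.weight (bideg n p) e = d := by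
  rw [piece, mem_weightedHomogeneousSubmodule] at hs
  exact hs (mem_support_iff.1 he)

variable (k n p) in
/-- The ideal `(x_l : l ≥ j)`. -/
def xI (j : ℕ) : Ideal (PolyS k n p) :=
  Ideal.span (X '' {i | ∃ l : Fin n, j ≤ (l : ℕ) ∧ i = Sum.inl l})

theorem mem_xI {j : ℕ} {s : PolyS k n p} :
    s ∈ xI k n p j ↔ ∀ e ∈ s.support, ∃ l : Fin n, j ≤ (l : ℕ) ∧ e (Sum.inl l) ≠ 0 := by
  rw [xI, mem_ideal_span_X_image]
  refine forall₂_congr fun e _ => ⟨?_, ?_⟩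
  · rintro ⟨_, ⟨l, hl, rfl⟩, h⟩; exact ⟨l, hl, h⟩
  · rintro ⟨l, hl, h⟩; exact ⟨_, ⟨l, hl, rfl⟩, h⟩

theorem X_mem_xI {j : ℕ} {l : Fin n} (h : j ≤ (l : ℕ)) : X (Sum.inl l) ∈ xI k n p j :=
  Ideal.subset_span ⟨_, ⟨l, h, rfl⟩, rfl⟩

theorem xI_eq_bot : xI k n p n = ⊥ := by
  rw [xI, Ideal.span_eq_bot]
  rintro _ ⟨_, ⟨l, hl, rfl⟩, rfl⟩
  exact absurd l.2 (by omega)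

theorem xI_anti {i j : ℕ} (h : i ≤ j) : xI k n p j ≤ xI k n p i := by
  rw [xI, Ideal.span_le]
  rintro _ ⟨_, ⟨l, hl, rfl⟩, rfl⟩
  exact X_mem_xI (h.trans hl)

theorem xI_eq_sup (j : Fin n) :
    xI k n p j = xI k n p (j + 1) ⊔ Ideal.span {X (Sum.inl j)} := by
  refine le_antisymm ?_ (sup_le (xI_anti (Nat.le_succ _)) ?_)
  · rw [xI, Ideal.span_le]
    rintro _ ⟨_, ⟨l, hl, rfl⟩, rfl⟩
    rcases hl.eq_or_lt with h | h
    · obtain rfl : j = l := Fin.ext h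
      exact Ideal.mem_sup_right (Ideal.mem_span_singleton_self _)
    · exact Ideal.mem_sup_left (X_mem_xI h)
  · rw [Ideal.span_singleton_le_iff_mem]
    exact X_mem_xI le_rfl

theorem mem_xI_of_X_mul {j : Fin n} {s : PolyS k n p}
    (h : X (Sum.inl j) * s ∈ xI k n p (j + 1)) : s ∈ xI k n p (j + 1) := by
  rw [mem_xI] at h ⊢
  intro e he
  obtain ⟨l, hl, hle⟩ := h (Finsupp.single (Sum.inl j) 1 + e) (by
    rw [support_X_mul]; simpa using he)
  refine ⟨l, hl, ?_⟩
  have : j ≠ l := by rintro rfl; omega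
  simpa [Finsupp.single_apply, this] using hle

theorem comp_mem_xI {j : ℕ} {s : PolyS k n p} (d : ℤ × ℤ) (h : s ∈ xI k n p j) :
    comp k n p d s ∈ xI k n p j := by
  rw [mem_xI] at h ⊢
  intro e he
  refine h e ?_
  rw [mem_support_iff, comp, coeff_weightedHomogeneousComponent] at he
  rw [mem_support_iff]
  intro h0
  exact he (by rw [h0, ite_self])

theorem mem_xI_zero_of_piece {d : ℤ × ℤ} {s : PolyS k n p} (hs : s ∈ piece k n p d)
    (hd : 0 < d.1) : s ∈ xI k n p 0 := by
  rw [mem_xI]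
  intro e he
  rw [← weight_of_mem_piece hs he, weight_bideg_fst] at hd
  obtain ⟨l, -, hl⟩ := Finset.exists_ne_zero_of_sum_ne_zero hd.ne'
  exact ⟨l, Nat.zero_le _, by exact_mod_cast hl⟩

theorem eq_zero_of_mem_xI_zero {d : ℤ × ℤ} {s : PolyS k n p} (hs : s ∈ piece k n p d)
    (hd : d.1 ≤ 0) (hx : s ∈ xI k n p 0) : s = 0 := by
  by_contra h
  obtain ⟨e, he⟩ := support_nonempty.2 h
  obtain ⟨l, -, hl⟩ := mem_xI.1 hx e he
  rw [← weight_of_mem_piece hs he, weight_bideg_fst] at hd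
  have := Finset.single_le_sum (f := fun l : Fin n => (e (Sum.inl l) : ℤ))
    (fun _ _ => by positivity) (Finset.mem_univ l)
  have h3 : (0 : ℤ) < e (Sum.inl l) := by positivity
  omega

theorem eq_zero_of_piece_neg {d : ℤ × ℤ} {s : PolyS k n p} (hs : s ∈ piece k n p d)
    (hd : d.1 < 0) : s = 0 := by
  by_contra h
  obtain ⟨e, he⟩ := support_nonempty.2 h
  rw [← weight_of_mem_piece hs he, weight_bideg_fst] at hd
  exact absurd hd (not_lt.2 (Finset.sum_nonneg fun _ _ => by positivity))

end XIdeals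

section GradedKoszul

variable {k : Type} [Field k] {n p m : ℕ}

/-- The grading of `⊕_q N(-a_q)`, as functions. -/
def grPi {ι N : Type} [AddCommGroup N] (a : ι → ℤ × ℤ) (gN : ℤ × ℤ → AddSubgroup N)
    (d : ℤ × ℤ) : AddSubgroup (ι → N) where
  carrier := {c | ∀ q, c q ∈ gN (d - a q)}
  add_mem' hc hd q := add_mem (hc q) (hd q)
  zero_mem' _ := zero_mem _
  neg_mem' hc q := neg_mem (hc q)

theorem grPi_law {ι N : Type} [AddCommGroup N] [Module (PolyS k n p) N] (a : ι → ℤ × ℤ)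
    {gN : ℤ × ℤ → AddSubgroup N} (h : GrLaw k n p gN) : GrLaw k n p (grPi a gN) := by
  intro e d s c hs hc q
  have := h _ _ s (c q) hs (hc q)
  rwa [← add_sub_assoc] at this

/-- The bidegree of a Koszul basis element. -/
def kdeg (T : Finset (Fin m)) : ℤ × ℤ := (T.card, T.card)

theorem kdeg_insert {j : Fin m} {T : Finset (Fin m)} (h : j ∉ T) :
    kdeg (insert j T) = kdeg T + (1, 1) := by
  rw [kdeg, Finset.card_insert_of_notMem h]
  simp [kdeg]

/-- The grading of the Koszul complex. -/
abbrev grK (m : ℕ) {N : Type} [AddCommGroup N] (gN : ℤ × ℤ → AddSubgroup N) :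
    ℤ × ℤ → AddSubgroup (Finset (Fin m) → N) := grPi kdeg gN

theorem ctr_mem_grK {N : Type} [AddCommGroup N] [Module (PolyS k n p) N]
    {gN : ℤ × ℤ → AddSubgroup N} (h : GrLaw k n p gN) {e : ℤ × ℤ} {v : Fin m → PolyS k n p}
    (hv : ∀ j, v j ∈ piece k n p e) {d : ℤ × ℤ} {c : Finset (Fin m) → N}
    (hc : c ∈ grK m gN d) : ctr N v c ∈ grK m gN (d + e - (1, 1)) := by
  intro T
  rw [ctr_apply_apply]
  refine sum_mem fun j _ => ?_
  rw [ctr1_apply]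
  split_ifs with hj
  · rw [smul_zero]; exact zero_mem _
  · have h1 := h _ _ _ _ (hv j) (zsmul_mem (hc (insert j T)) (sg j T))
    rw [kdeg_insert hj] at h1
    rwa [show d + e - (1, 1) - kdeg T = e + (d - (kdeg T + (1, 1))) by abel]

/-- The projection to a bigraded component of the Koszul complex. -/
def prK (d : ℤ × ℤ) (c : Finset (Fin m) → PolyS k n p) : Finset (Fin m) → PolyS k n p :=
  fun T => comp k n p (d - kdeg T) (c T)

theorem prK_mem (d : ℤ × ℤ) (c : Finset (Fin m) → PolyS k n p) :
    prK d c ∈ grK m (grS k n p) d := fun _ => comp_mem _ _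

theorem prK_of_mem {d : ℤ × ℤ} {c : Finset (Fin m) → PolyS k n p}
    (hc : c ∈ grK m (grS k n p) d) : prK d c = c :=
  funext fun T => comp_of_mem (hc T)

theorem prK_sub (d : ℤ × ℤ) (b c : Finset (Fin m) → PolyS k n p) :
    prK d (b - c) = prK d b - prK d c := funext fun T => by simp [prK]

theorem prK_mem_Kd {d : ℤ × ℤ} {i : ℕ} {c : Finset (Fin m) → PolyS k n p}
    (hc : c ∈ Kd (PolyS k n p) m (PolyS k n p) i) :
    prK d c ∈ Kd (PolyS k n p) m (PolyS k n p) i := fun T hT => by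
  rw [prK, hc T hT, map_zero]

theorem prK_mem_IK {d : ℤ × ℤ} {j : ℕ} {c : Finset (Fin m) → PolyS k n p}
    (hc : c ∈ IK m (xI k n p j)) : prK d c ∈ IK m (xI k n p j) :=
  fun T => comp_mem_xI _ (hc T)

theorem ctr_prK {e : ℤ × ℤ} {v : Fin m → PolyS k n p} (hv : ∀ j, v j ∈ piece k n p e)
    (d : ℤ × ℤ) (c : Finset (Fin m) → PolyS k n p) :
    ctr _ v (prK d c) = prK (d + e - (1, 1)) (ctr _ v c) := by
  ext1 T
  rw [prK, ctr_apply_apply, ctr_apply_apply, map_sum]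
  refine Finset.sum_congr rfl fun j _ => ?_
  rw [ctr1_apply, ctr1_apply, smul_eq_mul, smul_eq_mul, mul_comm (v j), mul_comm (v j),
    comp_mul (hv j)]
  congr 1
  split_ifs with hj
  · rw [map_zero]
  · rw [map_zsmul, prK, kdeg_insert hj]
    congr 3
    abel

end GradedKoszul

section Vanishing

variable {k : Type} [Field k] {n p m : ℕ} {φ : Matrix (Fin n) (Fin m) (PolyS k n p)}

theorem zseq_mem_piece (hφ : ∀ i j, φ i j ∈ piece k n p (0, 1)) (j : Fin m) :
    zseq k n m p φ j ∈ piece k n p (1, 1) :=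
  sum_mem fun i _ => piece_mul (X_inl_mem_piece i) (hφ i j)

theorem ctr_zseq_mem (hφ : ∀ i j, φ i j ∈ piece k n p (0, 1)) {N : Type} [AddCommGroup N]
    [Module (PolyS k n p) N] {gN : ℤ × ℤ → AddSubgroup N} (h : GrLaw k n p gN) {d : ℤ × ℤ}
    {c : Finset (Fin m) → N} (hc : c ∈ grK m gN d) :
    ctr N (zseq k n m p φ) c ∈ grK m gN d := by
  have := ctr_mem_grK h (zseq_mem_piece hφ) hc
  rwa [add_sub_cancel_right] at this

theorem ctr_zseq_prK (hφ : ∀ i j, φ i j ∈ piece k n p (0, 1)) (d : ℤ × ℤ)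
    (c : Finset (Fin m) → PolyS k n p) :
    ctr _ (zseq k n m p φ) (prK d c) = prK d (ctr _ (zseq k n m p φ) c) := by
  have := ctr_prK (zseq_mem_piece hφ) d c
  rwa [add_sub_cancel_right] at this

theorem exists_graded_of_mem_Bd (hφ : ∀ i j, φ i j ∈ piece k n p (0, 1)) {i j : ℕ} {d : ℤ × ℤ}
    {c : Finset (Fin m) → PolyS k n p} (hc : c ∈ grK m (grS k n p) d)
    (h : c ∈ Bd (zseq k n m p φ) (xI k n p j) i) :
    ∃ b ∈ Kd (PolyS k n p) m (PolyS k n p) (i + 1), b ∈ grK m (grS k n p) d ∧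
      c - ctr _ (zseq k n m p φ) b ∈ IK m (xI k n p j) := by
  obtain ⟨b, hb, hcb⟩ := mem_Bd.1 h
  refine ⟨prK d b, prK_mem_Kd hb, prK_mem _ _, ?_⟩
  have := prK_mem_IK (d := d) hcb
  rwa [prK_sub, prK_of_mem hc, ← ctr_zseq_prK hφ] at this

theorem regMod_X (l : Fin n) (W : Submonoid (PolyS k n p)) :
    RegMod W (xI k n p (l + 1)) (X (Sum.inl l)) := fun c hc =>
  ⟨1, W.one_mem, by rw [one_mul]; exact mem_xI_of_X_mul hc⟩

theorem tors_xI {l : Fin n}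
    (h : ∀ i, 1 ≤ i → Tors (zseq k n m p φ) (Submonoid.powers (X (Sum.inl l))) ⊥ i) (t : ℕ) :
    ∀ j, j + t = n → ∀ i, t + 1 ≤ i →
      Tors (zseq k n m p φ) (Submonoid.powers (X (Sum.inl l))) (xI k n p j) i := by
  induction t with
  | zero =>
    intro j hj i hi
    obtain rfl : j = n := hj
    rw [xI_eq_bot]
    exact h i hi
  | succ t ih =>
    intro j hj i hi
    obtain ⟨i, rfl⟩ : ∃ i', i = i' + 1 := ⟨i - 1, by omega⟩
    have := xI_eq_sup (k := k) (p := p) (⟨j, by omega⟩ : Fin n)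
    rw [show xI k n p j = _ from this]
    exact Tors.sup (ih (j + 1) (by omega) _ (by omega)) (ih (j + 1) (by omega) _ (by omega))
      (regMod_X _ _) le_rfl

/-- Vanishing of Koszul homology modulo `(x_l : l ≥ j)` in high `x`-degrees. -/
theorem koszul_vanishing (hφ : ∀ i j, φ i j ∈ piece k n p (0, 1))
    (h : ∀ (l : Fin n) i, 1 ≤ i →
      Tors (zseq k n m p φ) (Submonoid.powers (X (Sum.inl l))) ⊥ i) (j : ℕ) :
    j ≤ n → ∀ i, n + 1 ≤ i + j → ∀ d : ℤ × ℤ, (i : ℤ) < d.1 →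
      ∀ c ∈ Kd (PolyS k n p) m (PolyS k n p) i, c ∈ grK m (grS k n p) d →
      ctr _ (zseq k n m p φ) c ∈ IK m (xI k n p j) →
      c ∈ Bd (zseq k n m p φ) (xI k n p j) i := by
  induction j with
  | zero =>
    intro _ i _ d hd c hc hcd _
    refine Submodule.mem_sup_right fun T => ?_
    by_cases hT : T.card = i
    · exact mem_xI_zero_of_piece (hcd T) (by simp [kdeg, hT, hd])
    · rw [hc T hT]; exact zero_mem _
  | succ j ih =>
    intro hj i hi d hd c hc hcd hzc
    set l : Fin n := ⟨j, hj⟩ with hl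
    set x : PolyS k n p := X (Sum.inl l) with hx
    have hsup : xI k n p j = xI k n p (j + 1) ⊔ Ideal.span {x} := xI_eq_sup l
    have key : ∀ s : ℕ, x ^ s • c ∈ Bd (zseq k n m p φ) (xI k n p (j + 1)) i →
        c ∈ Bd (zseq k n m p φ) (xI k n p (j + 1)) i := by
      intro s
      induction s with
      | zero => intro h; simpa using h
      | succ s ihs =>
        intro hs
        apply ihs
        have hgr : ∀ t : ℕ, x ^ t • c ∈ grK m (grS k n p) (d + ((t : ℤ), (0 : ℤ))) := by
          intro t
          induction t with
          | zero => simpa [show ((0 : ℤ), (0 : ℤ)) = 0 from rfl] using hcd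
          | succ t iht =>
            have := grPi_law (k := k) (n := n) (p := p) kdeg grS_law _ _ _ _
              (X_inl_mem_piece l) iht
            rw [smul_smul, ← pow_succ'] at this
            rw [show d + (((t + 1 : ℕ) : ℤ), (0 : ℤ)) = (1, 0) + (d + ((t : ℤ), (0 : ℤ))) by
              ext <;> simp; ring]
            exact this
        obtain ⟨e, he, hed, hce⟩ := exists_graded_of_mem_Bd hφ (hgr (s + 1)) hs
        have h1 : ctr _ (zseq k n m p φ) e ∈ IK m (xI k n p j) := by
          rw [← sub_sub_cancel (x ^ (s + 1) • c) (ctr _ (zseq k n m p φ) e)]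
          refine sub_mem (fun T => ?_) (IK_mono (xI_anti (Nat.le_succ _)) hce)
          rw [Pi.smul_apply, smul_eq_mul, pow_succ, mul_assoc]
          exact Ideal.mul_mem_left _ _ (Ideal.mul_mem_right _ _ (X_mem_xI le_rfl))
        have h2 := ih (by omega) (i + 1) (by omega) _ (by simp; omega) e he hed h1
        obtain ⟨f, hf, hef⟩ := mem_Bd.1 h2
        rw [hsup] at hef
        obtain ⟨g, hg, hfg⟩ := exists_sub_smul_mem (sub_mem he (ctr_mem hf)) hef
        refine mem_Bd.2 ⟨g, hg, fun T => mem_xI_of_X_mul (j := l) ?_⟩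
        have h3 : x • (x ^ s • c - ctr _ (zseq k n m p φ) g) ∈ IK m (xI k n p (j + 1)) := by
          have e4 : x • (x ^ s • c - ctr _ (zseq k n m p φ) g) =
              (x ^ (s + 1) • c - ctr _ (zseq k n m p φ) e) +
              ctr _ (zseq k n m p φ) (e - ctr _ (zseq k n m p φ) f - x • g) := by
            simp only [map_sub, map_smul, smul_sub, smul_smul, ctr_ctr_self]
            rw [pow_succ']
            abel
          rw [e4]
          exact add_mem hce (ctr_mem_IK _ hfg)
        exact h3 T
    obtain ⟨w, ⟨s, rfl⟩, hw⟩ := tors_xI (h l) (n - (j + 1)) (j + 1) (by omega) i (by omega) c hc hzc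
    exact key s hw

end Vanishing

section HasReg

variable {k : Type} [Field k] {n p : ℕ} {lam : ℤ × ℤ →+ ℤ}
variable {M M' : Type} [AddCommGroup M] [Module (PolyS k n p) M] [AddCommGroup M']
  [Module (PolyS k n p) M'] {gM : ℤ × ℤ → AddSubgroup M} {gM' : ℤ × ℤ → AddSubgroup M'}

/-- The submodule `A` of the graded module `M` has `lam`-regularity at most `r`. -/
def HasReg (lam : ℤ × ℤ →+ ℤ) (r : ℤ) (gM : ℤ × ℤ → AddSubgroup M)
    (A : Submodule (PolyS k n p) M) : Prop := ∀ t, RegUpTo k n p lam t r A (grSub gM A)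

theorem HasReg.mono {r r' : ℤ} {A : Submodule (PolyS k n p) M} (h : HasReg lam r gM A)
    (hr : r ≤ r') : HasReg lam r' gM A := fun t => (h t).mono hr

theorem HasReg.of_eq_zero {r : ℤ} {A : Submodule (PolyS k n p) M} (h : ∀ a ∈ A, a = 0) :
    HasReg lam r gM A := fun _ =>
  haveI : Subsingleton A := ⟨fun a b => Subtype.ext ((h a a.2).trans (h b b.2).symm)⟩
  RegUpTo.of_subsingleton

theorem GrExact.of_submodules {A B : Submodule (PolyS k n p) M} {C : Submodule (PolyS k n p) M'}
    (f : M →ₗ[PolyS k n p] M') (e : ℤ × ℤ) (hA : ∀ b, b ∈ A ↔ b ∈ B ∧ f b = 0)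
    (hC : ∀ b ∈ B, f b ∈ C) (hm : ∀ d, ∀ b ∈ B, b ∈ gM d → f b ∈ gM' (d - e))
    (hs : ∀ d, ∀ c ∈ C, c ∈ gM' (d - e) → ∃ b ∈ B, b ∈ gM d ∧ f b = c) :
    GrExact (grSub gM A) (grSub gM B) (grShift e (grSub gM' C))
      (Submodule.inclusion fun b hb => ((hA b).1 hb).1) (f.restrict hC) where
  inj := Submodule.inclusion_injective _
  mem _ _ := Iff.rfl
  exact b := by
    constructor
    · intro h
      have h' := congrArg Subtype.val h
      exact ⟨⟨b, (hA b).2 ⟨b.2, h'⟩⟩, rfl⟩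
    · rintro ⟨a, rfl⟩
      exact Subtype.ext ((hA a).1 a.2).2
  map d b hb := hm d b b.2 hb
  surj d c hc := by
    obtain ⟨b, hb, hbd, h⟩ := hs d c c.2 hc
    exact ⟨⟨b, hb⟩, hbd, Subtype.ext h⟩

theorem HasReg.of_middle {A B : Submodule (PolyS k n p) M} {C : Submodule (PolyS k n p) M'}
    (f : M →ₗ[PolyS k n p] M') (hl : GrLaw k n p gM) (hA : ∀ b, b ∈ A ↔ b ∈ B ∧ f b = 0)
    (hC : ∀ b ∈ B, f b ∈ C) (e : ℤ × ℤ) (hm : ∀ d, ∀ b ∈ B, b ∈ gM d → f b ∈ gM' (d - e))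
    (hs : ∀ d, ∀ c ∈ C, c ∈ gM' (d - e) → ∃ b ∈ B, b ∈ gM d ∧ f b = c) {r : ℤ}
    (h1 : HasReg lam r gM A) (h2 : HasReg lam (r - lam e) gM' C) : HasReg lam r gM B := fun t =>
  RegUpTo.of_exact_middle (GrExact.of_submodules f e hA hC hm hs) (hl.sub _) (h1 t) (by
    simpa using (h2 t).shift e)

theorem HasReg.of_right {A B : Submodule (PolyS k n p) M} {C : Submodule (PolyS k n p) M'}
    (f : M →ₗ[PolyS k n p] M') (hA : ∀ b, b ∈ A ↔ b ∈ B ∧ f b = 0)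
    (hC : ∀ b ∈ B, f b ∈ C) (e : ℤ × ℤ) (hm : ∀ d, ∀ b ∈ B, b ∈ gM d → f b ∈ gM' (d - e))
    (hs : ∀ d, ∀ c ∈ C, c ∈ gM' (d - e) → ∃ b ∈ B, b ∈ gM d ∧ f b = c) {r : ℤ}
    (h1 : HasReg lam (r + 1) gM A) (h2 : HasReg lam r gM B) :
    HasReg lam (r - lam e) gM' C := fun t => by
  have h := (RegUpTo.of_exact_right (GrExact.of_submodules f e hA hC hm hs) (h1 t)
    (h2 (t + 1))).of_succ.shift (-e)
  have hg : grShift (-e) (grShift e (grSub gM' C)) = grSub gM' C := by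
    funext d
    simp [grShift]
  rwa [hg, map_neg, ← sub_eq_add_neg] at h

theorem HasReg.suppOn {ι : Type} [DecidableEq ι] {a : ι → ℤ × ℤ} (hl : GrLaw k n p gM) {r c : ℤ}
    (h : HasReg lam r gM (⊤ : Submodule (PolyS k n p) M)) (s : Finset ι)
    (hs : ∀ q ∈ s, lam (a q) ≤ c) :
    HasReg lam (r + c) (grPi a gM) (suppOn (PolyS k n p) M (s : Set ι)) := by
  induction s using Finset.induction_on with
  | empty => exact .of_eq_zero fun v hv => funext fun q => hv q (by simp)
  | insert q s hq ih =>
    refine HasReg.of_middle (A := _root_.suppOn (PolyS k n p) M (s : Set ι)) (C := ⊤)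
      (gM' := gM) (LinearMap.proj q) (grPi_law a hl) (fun b => ⟨fun hb => ?_, fun hb => ?_⟩)
      (fun _ _ => trivial) (a q) (fun d b _ hb => hb q) (fun d x _ hx => ?_)
      (ih fun q' hq' => hs q' (Finset.mem_insert_of_mem hq')) (h.mono ?_)
    · exact ⟨fun q' hq' => hb q' fun h => hq' (by simpa using Or.inr h), hb q (by simpa using hq)⟩
    · intro q' hq'
      by_cases hqq : q' = q
      · subst hqq; exact hb.2
      · exact hb.1 q' (by simpa [hqq] using hq')
    · refine ⟨Pi.single q x, fun q' hq' => ?_, fun q' => ?_, by simp⟩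
      · exact Pi.single_eq_of_ne (fun h => hq' (by simp [h])) _
      · by_cases hqq : q' = q
        · subst hqq; simpa using hx
        · rw [Pi.single_eq_of_ne hqq]; exact zero_mem _
    · have := hs q (Finset.mem_insert_self _ _)
      omega

theorem HasReg.kd {m : ℕ} (hl : GrLaw k n p gM) (h1 : lam (1, 1) = 1) {r : ℤ}
    (h : HasReg lam r gM (⊤ : Submodule (PolyS k n p) M)) (i : ℕ) :
    HasReg lam (r + i) (grK m gM) (Kd (PolyS k n p) m M i) := by
  have hk : ∀ T : Finset (Fin m), lam (kdeg T) = T.card := fun T => by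
    have : kdeg T = T.card • ((1 : ℤ), (1 : ℤ)) := by simp [kdeg]
    rw [this, map_nsmul, h1]; simp
  have := HasReg.suppOn (a := kdeg) hl h (Finset.univ.filter fun T : Finset (Fin m) => T.card = i)
    (c := i) (fun T hT => by rw [hk, (Finset.mem_filter.1 hT).2])
  have hs : ((Finset.univ.filter fun T : Finset (Fin m) => T.card = i : Finset _) :
      Set (Finset (Fin m))) = {T | T.card = i} := by ext; simp
  rwa [hs] at this

/-- The grading of a cyclic module. -/
def grQ (I : Ideal (PolyS k n p)) (d : ℤ × ℤ) : AddSubgroup (PolyS k n p ⧸ I) :=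
  (grS k n p d).map I.mkQ.toAddMonoidHom

theorem grQ_law (I : Ideal (PolyS k n p)) : GrLaw k n p (grQ I) := by
  rintro e d s _ hs ⟨t, ht, rfl⟩
  exact ⟨s * t, piece_mul hs ht, by simp [← smul_eq_mul]⟩

theorem regUpTo_grS (t : ℕ) : RegUpTo k n p lam t 0 (PolyS k n p) (grS k n p) := by
  have h := (grFin_free (k := k) (n := n) (p := p) (lam := lam) (ι := Unit) (fun _ => 0) (r := 0)
    (by simp)).regUpTo t
  refine h.equiv (Finsupp.uniqueLinearEquiv (PolyS k n p) (PolyS k n p) ()) fun d a =>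
    ⟨fun ha q => ?_, fun ha => ?_⟩
  · rw [sub_zero]; exact ha
  · have := ha default
    rwa [sub_zero] at this

theorem hasReg_top {r : ℤ} (h : ∀ t, RegUpTo k n p lam t r M gM) :
    HasReg lam r gM (⊤ : Submodule (PolyS k n p) M) := fun t =>
  (h t).equiv Submodule.topEquiv.symm fun _ _ => Iff.rfl

theorem hasReg_grQ_xI (h10 : lam (1, 0) ≤ 1) (i : ℕ) :
    ∀ j, j + i = n → ∀ t, RegUpTo k n p lam t 0 (PolyS k n p ⧸ xI k n p j) (grQ (xI k n p j)) := by
  induction i with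
  | zero =>
    rintro j hj t
    obtain rfl : j = n := by omega
    refine (regUpTo_grS t).equiv
      (Submodule.quotEquivOfEqBot _ xI_eq_bot).symm fun d a => ⟨?_, fun ha => ⟨a, ha, rfl⟩⟩
    rintro ⟨s, hs, h⟩
    have h' := congrArg (Submodule.quotEquivOfEqBot _ (xI_eq_bot (k := k) (n := j) (p := p))) h
    rw [LinearEquiv.apply_symm_apply] at h'
    rw [← h']
    exact hs
  | succ i ih =>
    intro j hj t
    have hjn : j < n := by omega
    have ih := ih (j + 1) (by omega)
    set l : Fin n := ⟨j, hjn⟩ with hl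
    have hle : xI k n p (j + 1) ≤ xI k n p j := xI_anti (Nat.le_succ _)
    have hex : GrExact (grShift (1, 0) (grQ (xI k n p (j + 1)))) (grQ (xI k n p (j + 1)))
        (grQ (xI k n p j))
        (LinearMap.lsmul (PolyS k n p) _ (X (Sum.inl l)))
        (Submodule.factor hle) := by
      refine ⟨?_, ?_, ?_, ?_, ?_⟩
      · rw [injective_iff_map_eq_zero]
        intro a ha
        obtain ⟨s, rfl⟩ := Submodule.mkQ_surjective _ a
        rw [LinearMap.lsmul_apply, ← map_smul, Submodule.mkQ_apply, Submodule.Quotient.mk_eq_zero,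
          smul_eq_mul] at ha
        rw [Submodule.mkQ_apply, Submodule.Quotient.mk_eq_zero]
        exact mem_xI_of_X_mul (j := l) ha
      · intro d a
        constructor
        · rintro ⟨u, hu, hua⟩
          obtain ⟨s, rfl⟩ := Submodule.mkQ_surjective _ a
          refine ⟨comp k n p (d - (1, 0)) s, comp_mem _ _, ?_⟩
          have hua' : (xI k n p (j + 1)).mkQ u = (xI k n p (j + 1)).mkQ (X (Sum.inl l) * s) := hua
          rw [Submodule.mkQ_apply, Submodule.mkQ_apply,
      Submodule.Quotient.eq] at hua'
          have h2 := comp_mem_xI d hua'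
          rw [map_sub, comp_of_mem hu, mul_comm, comp_mul (X_inl_mem_piece l)] at h2
          have h3 := sub_mem hua' h2
          refine (Submodule.Quotient.eq _).2 ?_
          have h4 : X (Sum.inl l) * (comp k n p (d - (1, 0)) s - s) ∈ xI k n p (j + 1) := by
            convert h3 using 1; ring
          exact mem_xI_of_X_mul (j := l) h4
        · intro ha
          have := grQ_law (xI k n p (j + 1)) (1, 0) (d - (1, 0)) _ a (X_inl_mem_piece l) ha
          rwa [add_sub_cancel] at this
      · intro b
        obtain ⟨s, rfl⟩ := Submodule.mkQ_surjective _ b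
        change (xI k n p j).mkQ s = 0 ↔ _
        rw [Submodule.mkQ_apply, Submodule.Quotient.mk_eq_zero]
        rw [show xI k n p j = _ from xI_eq_sup l, Submodule.mem_sup]
        constructor
        · rintro ⟨y, hy, z, hz, rfl⟩
          obtain ⟨a, rfl⟩ := Ideal.mem_span_singleton.1 hz
          refine ⟨(xI k n p (j + 1)).mkQ a, ?_⟩
          rw [LinearMap.lsmul_apply, ← map_smul, Submodule.mkQ_apply, Submodule.mkQ_apply,
      Submodule.Quotient.eq]
          rw [smul_eq_mul]
          rw [sub_add_cancel_right]
          exact neg_mem hy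
        · rintro ⟨a, ha⟩
          obtain ⟨a, rfl⟩ := Submodule.mkQ_surjective _ a
          rw [LinearMap.lsmul_apply, ← map_smul, Submodule.mkQ_apply, Submodule.mkQ_apply,
      Submodule.Quotient.eq] at ha
          refine ⟨_, neg_mem ha, _, Ideal.mem_span_singleton.2 ⟨a, rfl⟩, by simp⟩
      · rintro d _ ⟨s, hs, rfl⟩
        exact ⟨s, hs, rfl⟩
      · rintro d _ ⟨s, hs, rfl⟩
        exact ⟨_, ⟨s, hs, rfl⟩, rfl⟩
    refine (RegUpTo.of_exact_right hex (t := t) ?_ (ih _)).of_succ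
    exact ((ih t).shift (1, 0)).mono (by omega)

end HasReg

section Reduction

variable {k : Type} [Field k] {n p m : ℕ} {φ : Matrix (Fin n) (Fin m) (PolyS k n p)}

/-- The rows of `φ`, indexed by natural numbers. -/
def rowv (φ : Matrix (Fin n) (Fin m) (PolyS k n p)) (l : ℕ) : Fin m → PolyS k n p :=
  if h : l < n then φ ⟨l, h⟩ else 0

theorem rowv_coe (φ : Matrix (Fin n) (Fin m) (PolyS k n p)) (l : Fin n) : rowv φ l = φ l :=
  dif_pos l.2

theorem rowv_mem (hφ : ∀ i j, φ i j ∈ piece k n p (0, 1)) (l : ℕ) (j : Fin m) :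
    rowv φ l j ∈ piece k n p (0, 1) := by
  rw [rowv]
  split_ifs
  · exact hφ _ _
  · exact zero_mem _

theorem ctr_zseq_apply (c : Finset (Fin m) → PolyS k n p) (T : Finset (Fin m)) :
    ctr _ (zseq k n m p φ) c T =
      ∑ l : Fin n, X (Sum.inl l) * ctr (PolyS k n p) (rowv φ l) c T := by
  simp_rw [ctr_apply_apply, Finset.mul_sum]
  rw [Finset.sum_comm]
  refine Finset.sum_congr rfl fun j _ => ?_
  rw [zseq, Finset.sum_smul]
  refine Finset.sum_congr rfl fun l _ => ?_
  rw [rowv_coe, mul_smul, smul_eq_mul]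

theorem ctr_row_mem (hφ : ∀ i j, φ i j ∈ piece k n p (0, 1)) {N : Type} [AddCommGroup N]
    [Module (PolyS k n p) N] {gN : ℤ × ℤ → AddSubgroup N} (h : GrLaw k n p gN) {d : ℤ × ℤ}
    {c : Finset (Fin m) → N} (hc : c ∈ grK m gN d) (l : ℕ) :
    ctr N (rowv φ l) c ∈ grK m gN (d - (1, 0)) := by
  have := ctr_mem_grK h (rowv_mem hφ l) hc
  convert this using 2
  ext <;> simp

theorem ctr_row_prK (hφ : ∀ i j, φ i j ∈ piece k n p (0, 1)) (d : ℤ × ℤ)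
    (c : Finset (Fin m) → PolyS k n p) (l : ℕ) :
    ctr _ (rowv φ l) (prK d c) = prK (d - (1, 0)) (ctr _ (rowv φ l) c) := by
  rw [ctr_prK (rowv_mem hφ l)]
  congr 1
  ext <;> simp

theorem pderiv_mem_xI {j : ℕ} {l : Fin n} (hl : (l : ℕ) < j) {s : PolyS k n p}
    (hs : s ∈ xI k n p j) : pderiv (Sum.inl l) s ∈ xI k n p j := by
  refine Submodule.span_induction (p := fun s _ => pderiv (Sum.inl l) s ∈ xI k n p j)
    ?_ (by simp) (fun x y _ _ hx hy => by rw [map_add]; exact add_mem hx hy) (fun a x hx h => ?_) hs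
  · rintro _ ⟨_, ⟨r, hr, rfl⟩, rfl⟩
    rw [pderiv_X_of_ne (by rintro h; cases Sum.inl.inj h; omega)]
    exact zero_mem _
  · rw [smul_eq_mul, Derivation.leibniz, smul_eq_mul, smul_eq_mul]
    exact add_mem (Ideal.mul_mem_left _ _ h) (Ideal.mul_mem_right _ _ hx)

theorem coeff_mem_xI {j : ℕ} (g : Fin n → PolyS k n p)
    (h : ∑ r, X (Sum.inl r) * g r ∈ xI k n p j) {l : Fin n} (hl : (l : ℕ) < j) :
    g l ∈ xI k n p 0 := by
  have h1 := xI_anti (Nat.zero_le _) (pderiv_mem_xI hl h)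
  have h2 : g l = pderiv (Sum.inl l) (∑ r, X (Sum.inl r) * g r) -
      ∑ r, X (Sum.inl r) * pderiv (Sum.inl l) (g r) := by
    rw [map_sum, ← Finset.sum_sub_distrib, Finset.sum_eq_single l]
    · simp
    · intro r _ hr
      have : (Sum.inl r : Fin n ⊕ Fin p) ≠ Sum.inl l := fun h => hr (Sum.inl.inj h)
      simp [pderiv_X_of_ne this]
    · simp
  rw [h2]
  exact sub_mem h1 (sum_mem fun r _ => Ideal.mul_mem_right _ _ (X_mem_xI (Nat.zero_le _)))

/-- The quotient by the ideal `(x)`. -/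
abbrev Sbar (k : Type) [Field k] (n p : ℕ) : Type := PolyS k n p ⧸ xI k n p 0

/-- The grading of the quotient by `(x)`. -/
abbrev grB (k : Type) [Field k] (n p : ℕ) : ℤ × ℤ → AddSubgroup (Sbar k n p) :=
  grQ (xI k n p 0)

/-- Reduction modulo `(x)`. -/
def redK (k : Type) [Field k] (n p m : ℕ) :
    (Finset (Fin m) → PolyS k n p) →ₗ[PolyS k n p] (Finset (Fin m) → Sbar k n p) :=
  LinearMap.compLeft (xI k n p 0).mkQ _

theorem redK_apply (c : Finset (Fin m) → PolyS k n p) (T : Finset (Fin m)) :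
    redK k n p m c T = (xI k n p 0).mkQ (c T) := rfl

theorem redK_eq_zero {c : Finset (Fin m) → PolyS k n p} :
    redK k n p m c = 0 ↔ c ∈ IK m (xI k n p 0) := by
  rw [mem_IK, funext_iff]
  exact forall_congr' fun T => Submodule.Quotient.mk_eq_zero _

theorem ctr_redK (v : Fin m → PolyS k n p) (c : Finset (Fin m) → PolyS k n p) :
    ctr _ v (redK k n p m c) = redK k n p m (ctr _ v c) :=
  ctr_map (xI k n p 0).mkQ v c

theorem ctrs_redK (v : ℕ → Fin m → PolyS k n p) (t : ℕ) (c : Finset (Fin m) → PolyS k n p) :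
    ctrs _ v t (redK k n p m c) = redK k n p m (ctrs _ v t c) :=
  ctrs_map (xI k n p 0).mkQ v t c

theorem redK_mem_Kd {i : ℕ} {c : Finset (Fin m) → PolyS k n p}
    (hc : c ∈ Kd (PolyS k n p) m (PolyS k n p) i) :
    redK k n p m c ∈ Kd (PolyS k n p) m (Sbar k n p) i := fun T hT => by
  rw [redK_apply, hc T hT, map_zero]

theorem redK_mem_grK {d : ℤ × ℤ} {c : Finset (Fin m) → PolyS k n p}
    (hc : c ∈ grK m (grS k n p) d) : redK k n p m c ∈ grK m (grB k n p) d :=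
  fun T => ⟨c T, hc T, rfl⟩

theorem exists_redK {i : ℕ} {c : Finset (Fin m) → Sbar k n p}
    (hc : c ∈ Kd (PolyS k n p) m (Sbar k n p) i) :
    ∃ C ∈ Kd (PolyS k n p) m (PolyS k n p) i, redK k n p m C = c := by
  choose g hg using fun T => Submodule.mkQ_surjective _ (c T)
  refine ⟨fun T => if T.card = i then g T else 0, fun T hT => if_neg hT, funext fun T => ?_⟩
  rw [redK_apply]
  split_ifs with h
  · exact hg T
  · rw [map_zero, hc T h]

theorem exists_redK_graded {i : ℕ} {d : ℤ × ℤ} {c : Finset (Fin m) → Sbar k n p}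
    (hc : c ∈ Kd (PolyS k n p) m (Sbar k n p) i) (hd : c ∈ grK m (grB k n p) d) :
    ∃ C ∈ Kd (PolyS k n p) m (PolyS k n p) i, C ∈ grK m (grS k n p) d ∧ redK k n p m C = c := by
  choose g hgd hg using hd
  refine ⟨fun T => if T.card = i then g T else 0, fun T hT => if_neg hT, fun T => ?_,
    funext fun T => ?_⟩
  · dsimp only
    split_ifs
    · exact hgd T
    · exact zero_mem _
  · rw [redK_apply]
    split_ifs with h
    · exact hg T
    · rw [map_zero, hc T h]

theorem eq_zero_of_mem_grK_neg {i : ℕ} {d : ℤ × ℤ} {C : Finset (Fin m) → PolyS k n p}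
    (hc : C ∈ Kd (PolyS k n p) m (PolyS k n p) i) (hd : C ∈ grK m (grS k n p) d)
    (h : d.1 < i) : C = 0 := by
  funext T
  by_cases hT : T.card = i
  · refine eq_zero_of_piece_neg (hd T) ?_
    simp only [kdeg, Prod.fst_sub]
    omega
  · exact hc T hT

theorem eq_zero_of_redK_eq_zero {i : ℕ} {d : ℤ × ℤ} {C : Finset (Fin m) → PolyS k n p}
    (hc : C ∈ Kd (PolyS k n p) m (PolyS k n p) i) (hd : C ∈ grK m (grS k n p) d)
    (h : d.1 ≤ i) (h0 : redK k n p m C = 0) : C = 0 := by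
  funext T
  by_cases hT : T.card = i
  · refine eq_zero_of_mem_xI_zero (hd T) ?_ (redK_eq_zero.1 h0 T)
    simp only [kdeg, Prod.fst_sub]
    omega
  · exact hc T hT

theorem redK_eq_zero_of_lt {i : ℕ} {d : ℤ × ℤ} {C : Finset (Fin m) → PolyS k n p}
    (hc : C ∈ Kd (PolyS k n p) m (PolyS k n p) i) (hd : C ∈ grK m (grS k n p) d)
    (h : (i : ℤ) < d.1) : redK k n p m C = 0 := by
  rw [redK_eq_zero]
  intro T
  by_cases hT : T.card = i
  · refine mem_xI_zero_of_piece (hd T) ?_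
    simp only [kdeg, Prod.fst_sub]
    omega
  · rw [hc T hT]; exact zero_mem _

theorem mem_of_prK_mem {Q : AddSubgroup (Finset (Fin m) → PolyS k n p)}
    {c : Finset (Fin m) → PolyS k n p} (h : ∀ d, prK d c ∈ Q) : c ∈ Q := by
  have hf : ∀ T, (Function.support fun d => comp k n p (d - kdeg T) (c T)).Finite := fun T => by
    have := weightedHomogeneousComponent_finsupp (w := bideg n p) (c T)
    exact this.preimage sub_left_injective.injOn
  have hfin : (Function.support fun d => prK d c).Finite := by
    refine (Set.finite_iUnion hf).subset fun d hd => ?_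
    obtain ⟨T, hT⟩ := Function.ne_iff.1 hd
    exact Set.mem_iUnion.2 ⟨T, hT⟩
  have hc : c = ∑ᶠ d, prK d c := by
    funext T
    have h1 := (Pi.evalAddMonoidHom (fun _ : Finset (Fin m) => PolyS k n p) T).map_finsum hfin
    refine Eq.trans ?_ h1.symm
    have h2 := sum_weightedHomogeneousComponent (bideg n p) (c T)
    rw [← finsum_comp_equiv (Equiv.subRight (kdeg T))] at h2
    exact h2.symm
  rw [hc, finsum_eq_sum _ hfin]
  exact sum_mem fun d _ => h d

/-- Elements of exterior degree `i` killed by the contractions with the first `j` rows. -/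
def rowCyc (φ : Matrix (Fin n) (Fin m) (PolyS k n p)) (j i : ℕ) :
    Submodule (PolyS k n p) (Finset (Fin m) → Sbar k n p) :=
  Kd (PolyS k n p) m (Sbar k n p) i ⊓ ⨅ l : Fin j, LinearMap.ker (ctr _ (rowv φ l))

theorem mem_rowCyc {j i : ℕ} {c : Finset (Fin m) → Sbar k n p} :
    c ∈ rowCyc φ j i ↔ c ∈ Kd (PolyS k n p) m (Sbar k n p) i ∧
      ∀ l < j, ctr _ (rowv φ l) c = 0 := by
  rw [rowCyc, Submodule.mem_inf, Submodule.mem_iInf]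
  exact and_congr_right fun _ => ⟨fun h l hl => h ⟨l, hl⟩, fun h l => h l l.2⟩

theorem exists_lift_rowCyc (hφ : ∀ i j, φ i j ∈ piece k n p (0, 1)) {j i : ℕ} {d : ℤ × ℤ}
    {c : Finset (Fin m) → Sbar k n p} (hc : c ∈ rowCyc φ j i) (hd : c ∈ grK m (grB k n p) d) :
    ∃ C ∈ Kd (PolyS k n p) m (PolyS k n p) i, C ∈ grK m (grS k n p) d ∧ redK k n p m C = c ∧
      (C ≠ 0 → d.1 = i) ∧ ∀ l < j, ctr _ (rowv φ l) C = 0 := by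
  obtain ⟨hc, hl⟩ := mem_rowCyc.1 hc
  obtain ⟨C, hC, hCd, rfl⟩ := exists_redK_graded hc hd
  rcases lt_trichotomy d.1 i with h | h | h
  · obtain rfl := eq_zero_of_mem_grK_neg hC hCd h
    exact ⟨0, zero_mem _, zero_mem _, rfl, by simp, by simp⟩
  · refine ⟨C, hC, hCd, rfl, fun _ => h, fun l hlj => ?_⟩
    have h0 := hl l hlj
    rw [ctr_redK] at h0
    cases i with
    | zero => exact ctr_zero_of_Kd hC
    | succ i =>
      refine eq_zero_of_redK_eq_zero (ctr_mem hC) (ctr_row_mem hφ grS_law hCd l) ?_ h0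
      simp only [Prod.fst_sub]
      push_cast at h
      omega
  · refine ⟨0, zero_mem _, zero_mem _, ?_, by simp, by simp⟩
    rw [map_zero, redK_eq_zero_of_lt hC hCd h]

theorem exists_ctr_row_eq (hφ : ∀ i j, φ i j ∈ piece k n p (0, 1))
    (h : ∀ (l : Fin n) i, 1 ≤ i →
      Tors (zseq k n m p φ) (Submonoid.powers (X (Sum.inl l))) ⊥ i) {j i : ℕ} (hj : j < n)
    (hi : n ≤ i + j) {d : ℤ × ℤ} {c : Finset (Fin m) → Sbar k n p} (hc : c ∈ rowCyc φ (j + 1) i)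
    (hd : c ∈ grK m (grB k n p) (d - (1, 0))) :
    ∃ b ∈ rowCyc φ j (i + 1), b ∈ grK m (grB k n p) d ∧ ctr _ (rowv φ j) b = c := by
  obtain ⟨C, hC, hCd, rfl, hdi, hl⟩ := exists_lift_rowCyc hφ hc hd
  by_cases hC0 : C = 0
  · exact ⟨0, zero_mem _, zero_mem _, by simp [hC0]⟩
  have hdi := hdi hC0
  have hXd : (X (Sum.inl ⟨j, hj⟩) : PolyS k n p) • C ∈ grK m (grS k n p) d := by
    have := grPi_law kdeg grS_law _ _ _ _ (X_inl_mem_piece (k := k) (p := p) ⟨j, hj⟩) hCd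
    rwa [add_sub_cancel] at this
  have hXz : ctr _ (zseq k n m p φ) ((X (Sum.inl ⟨j, hj⟩) : PolyS k n p) • C) ∈
      IK m (xI k n p (j + 1)) := by
    rw [map_smul]
    refine Submodule.smul_mem _ _ fun T => ?_
    rw [ctr_zseq_apply]
    refine sum_mem fun l _ => ?_
    by_cases hlj : (l : ℕ) < j + 1
    · rw [hl l hlj]; simp
    · exact Ideal.mul_mem_right _ _ (X_mem_xI (not_lt.1 hlj))
  have hdi' : (i : ℤ) < d.1 := by
    rw [Prod.fst_sub] at hdi; omega
  have hB := koszul_vanishing hφ h (j + 1) hj i (by omega) d hdi' _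
    (Submodule.smul_mem _ _ hC) hXd hXz
  obtain ⟨B, hB, hBd, hBC⟩ := exists_graded_of_mem_Bd hφ hXd hB
  have key : ∀ T (l : Fin n), (l : ℕ) < j + 1 →
      (if l = ⟨j, hj⟩ then C T else 0) - ctr (PolyS k n p) (rowv φ l) B T ∈ xI k n p 0 := by
    intro T l hl
    refine coeff_mem_xI (fun l => (if l = ⟨j, hj⟩ then C T else 0) -
      ctr (PolyS k n p) (rowv φ l) B T) ?_ hl
    convert hBC T using 1
    simp_rw [mul_sub, Finset.sum_sub_distrib, ← ctr_zseq_apply]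
    simp
  refine ⟨redK k n p m B, mem_rowCyc.2 ⟨redK_mem_Kd hB, fun l hl => ?_⟩, redK_mem_grK hBd, ?_⟩
  · rw [ctr_redK, redK_eq_zero]
    intro T
    have := key T ⟨l, hl.trans hj⟩ (hl.trans (Nat.lt_succ_self _))
    rw [if_neg (by simpa using hl.ne), zero_sub, neg_mem_iff] at this
    exact this
  · rw [ctr_redK, ← sub_eq_zero, ← map_sub, redK_eq_zero]
    intro T
    have := key T ⟨j, hj⟩ (Nat.lt_succ_self _)
    rw [if_pos rfl] at this
    rw [← neg_mem_iff, Pi.sub_apply, neg_sub]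
    exact this

end Reduction

section RowRegularity

variable {k : Type} [Field k] {n p m : ℕ} {φ : Matrix (Fin n) (Fin m) (PolyS k n p)}
  {lam : ℤ × ℤ →+ ℤ} {ε : ℤ}

theorem redK_prK_mem_rowCyc (hφ : ∀ i j, φ i j ∈ piece k n p (0, 1)) {j i : ℕ}
    {C : Finset (Fin m) → PolyS k n p} (hC : C ∈ Kd (PolyS k n p) m (PolyS k n p) i)
    (h : redK k n p m C ∈ rowCyc φ j i) (d : ℤ × ℤ) :
    redK k n p m (prK d C) ∈ rowCyc φ j i := by
  refine mem_rowCyc.2 ⟨redK_mem_Kd (prK_mem_Kd hC), fun l hl => ?_⟩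
  have := (mem_rowCyc.1 h).2 l hl
  rw [ctr_redK, redK_eq_zero] at this ⊢
  rw [ctr_row_prK hφ]
  exact prK_mem_IK this

/-- The image of the iterated contraction with the first `j` rows. -/
def rowIm (φ : Matrix (Fin n) (Fin m) (PolyS k n p)) (j i : ℕ) :
    Submodule (PolyS k n p) (Finset (Fin m) → Sbar k n p) :=
  (Kd (PolyS k n p) m (Sbar k n p) i).map (ctrs _ (rowv φ) j)

theorem ctr_ctrs_comm {R N : Type} [CommRing R] [AddCommGroup N] [Module R N]
    (w : Fin m → R) (v : ℕ → Fin m → R) (t : ℕ) (c : Finset (Fin m) → N) :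
    ctr N w (ctrs N v t c) = (-1 : R) ^ t • ctrs N v t (ctr N w c) := by
  induction t with
  | zero => simp [ctrs]
  | succ t ih => rw [ctrs_succ, ctr_ctr_swap, ih, map_smul, ctrs_succ, pow_succ]; simp

theorem ctr_ctrs_eq_zero {R N : Type} [CommRing R] [AddCommGroup N] [Module R N]
    (v : ℕ → Fin m → R) {t l : ℕ} (hl : l < t) (c : Finset (Fin m) → N) :
    ctr N (v l) (ctrs N v t c) = 0 := by
  induction t with
  | zero => omega
  | succ t ih =>
    rw [ctrs_succ]
    rcases Nat.lt_succ_iff_lt_or_eq.1 hl with h | rfl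
    · rw [ctr_ctr_swap, ih h, map_zero, neg_zero]
    · exact ctr_ctr_self _ _

theorem rowIm_le_rowCyc {j i i' : ℕ} (h : i' = i + j) : rowIm φ j i' ≤ rowCyc φ j i := by
  subst h
  rintro _ ⟨c, hc, rfl⟩
  exact mem_rowCyc.2 ⟨ctrs_mem hc, fun l hl => ctr_ctrs_eq_zero _ hl c⟩

theorem rowIm_succ_le {j i : ℕ} : rowIm φ (j + 1) (i + 1) ≤ rowIm φ j i := by
  rintro _ ⟨c, hc, rfl⟩
  rw [ctrs_succ, ctr_ctrs_comm]
  exact Submodule.smul_mem _ _ ⟨_, ctr_mem hc, rfl⟩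

theorem rowCyc_le_rowIm (hφ : ∀ i j, φ i j ∈ piece k n p (0, 1))
    (h : ∀ (l : Fin n) i, 1 ≤ i →
      Tors (zseq k n m p φ) (Submonoid.powers (X (Sum.inl l))) ⊥ i) (j : ℕ) :
    j ≤ n → ∀ i, n + 1 ≤ i + j → rowCyc φ j i ≤ rowIm φ j (i + j) := by
  induction j with
  | zero => exact fun _ i _ c hc => ⟨c, (mem_rowCyc.1 hc).1, rfl⟩
  | succ j ih =>
    intro hj i hi c hc
    obtain ⟨C, hC, rfl⟩ := exists_redK (mem_rowCyc.1 hc).1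
    have key : C ∈ ((rowIm φ (j + 1) (i + (j + 1))).comap (redK k n p m)).toAddSubgroup := by
      refine mem_of_prK_mem fun d => ?_
      obtain ⟨b, hb, -, hbc⟩ := exists_ctr_row_eq hφ h hj (by omega)
        (redK_prK_mem_rowCyc hφ hC hc d) (d := d + (1, 0))
        (by rw [add_sub_cancel_right]; exact redK_mem_grK (prK_mem d C))
      obtain ⟨a, ha, hab⟩ := ih (by omega) (i + 1) (by omega) hb
      refine ⟨a, by rwa [add_assoc, add_comm 1 j] at ha, ?_⟩
      rw [← hbc, ← hab, ctrs_succ]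
    exact key

theorem hasReg_rowCyc (hφ : ∀ i j, φ i j ∈ piece k n p (0, 1))
    (h : ∀ (l : Fin n) i, 1 ≤ i →
      Tors (zseq k n m p φ) (Submonoid.powers (X (Sum.inl l))) ⊥ i)
    (h10 : lam (1, 0) = 1 - ε) (h11 : lam (1, 1) = 1) (hε : 0 ≤ ε) (hε' : ε ≤ 1) (j : ℕ) :
    j ≤ n → ∀ i, n + 1 ≤ i + j →
      HasReg lam (i + j * ε) (grK m (grB k n p)) (rowCyc φ j i) := by
  induction j with
  | zero =>
    intro _ i _
    have h0 : rowCyc φ 0 i = Kd (PolyS k n p) m (Sbar k n p) i := by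
      ext c; rw [mem_rowCyc]; simp
    have := HasReg.kd (m := m) (grQ_law (xI k n p 0)) h11
      (hasReg_top (hasReg_grQ_xI (lam := lam) (by omega) n 0 (by omega))) i
    rw [h0]
    simpa using this
  | succ j ih =>
    intro hj
    have key : ∀ t i, m + 1 ≤ i + t → n + 1 ≤ i + (j + 1) →
        HasReg lam (i + (j + 1 : ℕ) * ε) (grK m (grB k n p)) (rowCyc φ (j + 1) i) := by
      intro t
      induction t with
      | zero =>
        exact fun i hi _ => .of_eq_zero fun c hc =>
          eq_zero_of_lt (by omega) (mem_rowCyc.1 hc).1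
      | succ t iht =>
        intro i hi hin
        have h1 := iht (i + 1) (by omega) (by omega)
        have h2 := ih (by omega) (i + 1) (by omega)
        have h3 := HasReg.of_right (lam := lam) (C := rowCyc φ (j + 1) i)
          (gM' := grK m (grB k n p)) (ctr _ (rowv φ j)) ?_ ?_ (1, 0)
          (fun d b _ hb => ctr_row_mem hφ (grQ_law _) hb j)
          (fun d c hc hd => ?_) (h1.mono ?_) h2
        · convert h3 using 1
          rw [h10]; push_cast; ring
        · intro b
          rw [mem_rowCyc, mem_rowCyc, and_assoc]
          refine and_congr_right fun _ => ⟨fun h => ⟨fun l hl => h l (by omega), h j (by omega)⟩,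
            fun h l hl => ?_⟩
          rcases Nat.lt_succ_iff_lt_or_eq.1 hl with hl | rfl
          · exact h.1 l hl
          · exact h.2
        · intro b hb
          obtain ⟨hb, hbl⟩ := mem_rowCyc.1 hb
          refine mem_rowCyc.2 ⟨ctr_mem hb, fun l hl => ?_⟩
          rcases Nat.lt_succ_iff_lt_or_eq.1 hl with hl | rfl
          · rw [ctr_ctr_swap, hbl l hl, map_zero, neg_zero]
          · exact ctr_ctr_self _ _
        · exact exists_ctr_row_eq hφ h hj (by omega) hc hd
        · push_cast; linarith
    exact fun i hi => key (m + 1) i (by omega) hi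

theorem ctrs_row_mem (hφ : ∀ i j, φ i j ∈ piece k n p (0, 1)) {N : Type} [AddCommGroup N]
    [Module (PolyS k n p) N] {gN : ℤ × ℤ → AddSubgroup N} (h : GrLaw k n p gN) (t : ℕ)
    {d : ℤ × ℤ} {c : Finset (Fin m) → N} (hc : c ∈ grK m gN (d + ((t : ℤ), (0 : ℤ)))) :
    ctrs N (rowv φ) t c ∈ grK m gN d := by
  induction t generalizing d with
  | zero => simpa [ctrs, Prod.mk_zero_zero] using hc
  | succ t ih =>
    have h1 : ctrs N (rowv φ) t c ∈ grK m gN (d + (1, 0)) := ih (by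
      convert hc using 2
      ext <;> simp <;> ring)
    have := ctr_row_mem hφ h h1 t
    rwa [add_sub_cancel_right] at this

theorem ctrs_row_prK (hφ : ∀ i j, φ i j ∈ piece k n p (0, 1)) (t : ℕ) (d : ℤ × ℤ)
    (c : Finset (Fin m) → PolyS k n p) :
    ctrs _ (rowv φ) t (prK (d + ((t : ℤ), (0 : ℤ))) c) = prK d (ctrs _ (rowv φ) t c) := by
  induction t generalizing d with
  | zero => simp [ctrs, Prod.mk_zero_zero]
  | succ t ih =>
    have h1 : d + (((t + 1 : ℕ) : ℤ), (0 : ℤ)) = d + (1, 0) + ((t : ℤ), (0 : ℤ)) := by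
      ext <;> simp <;> ring
    rw [ctrs_succ, h1, ih, ctr_row_prK hφ, add_sub_cancel_right, ctrs_succ]

theorem exists_lift_rowIm (hφ : ∀ i j, φ i j ∈ piece k n p (0, 1)) {t i : ℕ} (ht : t ≤ i)
    {d : ℤ × ℤ} {c : Finset (Fin m) → Sbar k n p} (hc : c ∈ rowIm φ t i)
    (hd : c ∈ grK m (grB k n p) d) :
    ∃ B ∈ Kd (PolyS k n p) m (PolyS k n p) i, B ∈ grK m (grS k n p) (d + ((t : ℤ), (0 : ℤ))) ∧
      redK k n p m (ctrs _ (rowv φ) t B) = c := by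
  obtain ⟨q, rfl⟩ := Nat.exists_eq_add_of_le' ht
  obtain ⟨b, hb, rfl⟩ := hc
  obtain ⟨B, hB, rfl⟩ := exists_redK hb
  obtain ⟨C, hC, hCd, hCB⟩ := exists_redK_graded (ctrs_mem hb) hd
  refine ⟨prK (d + ((t : ℤ), (0 : ℤ))) B, prK_mem_Kd hB, prK_mem _ _, ?_⟩
  rw [ctrs_row_prK hφ, ← hCB, ← sub_eq_zero, ← map_sub, redK_eq_zero]
  rw [ctrs_redK, ← sub_eq_zero, ← map_sub, redK_eq_zero] at hCB
  have := prK_mem_IK (d := d) (neg_mem hCB)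
  rwa [neg_sub, prK_sub, prK_of_mem hCd] at this

theorem hasReg_rowIm (hφ : ∀ i j, φ i j ∈ piece k n p (0, 1))
    (h : ∀ (l : Fin n) i, 1 ≤ i →
      Tors (zseq k n m p φ) (Submonoid.powers (X (Sum.inl l))) ⊥ i)
    (h10 : lam (1, 0) = 1 - ε) (h11 : lam (1, 1) = 1) (hε : 0 ≤ ε) (hε' : ε ≤ 1) (j : ℕ) :
    j ≤ n → HasReg lam ((n : ℤ) - j + j * ε) (grK m (grB k n p)) (rowIm φ j n) := by
  induction j with
  | zero =>
    intro _
    have h0 : rowIm φ 0 n = Kd (PolyS k n p) m (Sbar k n p) n := by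
      rw [rowIm]; exact Submodule.map_id _
    have := HasReg.kd (m := m) (grQ_law (xI k n p 0)) h11
      (hasReg_top (hasReg_grQ_xI (lam := lam) (by omega) n 0 (by omega))) n
    rw [h0]
    simpa using this
  | succ j ih =>
    intro hj
    have hnj : n = n - j + j := by omega
    have h1 := hasReg_rowCyc hφ h h10 h11 hε hε' (j + 1) hj (n - j) (by omega)
    have h3 := HasReg.of_right (lam := lam) (C := rowIm φ (j + 1) n)
      (gM' := grK m (grB k n p)) (ctr _ (rowv φ j)) ?_ ?_ (1, 0)
      (fun d b _ hb => ctr_row_mem hφ (grQ_law _) hb j)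
      (fun d c hc hd => ?_) (h1.mono ?_) (ih (by omega))
    · convert h3 using 1
      rw [h10]; push_cast; ring
    · intro b
      constructor
      · intro hb
        refine ⟨?_, (mem_rowCyc.1 hb).2 j (Nat.lt_succ_self _)⟩
        have := rowCyc_le_rowIm hφ h (j + 1) hj (n - j) (by omega) hb
        rw [show n - j + (j + 1) = n + 1 by omega] at this
        exact rowIm_succ_le this
      · rintro ⟨hb, hb0⟩
        obtain ⟨hb, hbl⟩ := mem_rowCyc.1 (rowIm_le_rowCyc hnj hb)
        refine mem_rowCyc.2 ⟨hb, fun l hl => ?_⟩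
        rcases Nat.lt_succ_iff_lt_or_eq.1 hl with hl | rfl
        · exact hbl l hl
        · exact hb0
    · rintro _ ⟨b, hb, rfl⟩
      exact ⟨b, hb, rfl⟩
    · obtain ⟨B, hB, hBd, rfl⟩ := exists_lift_rowIm hφ hj hc hd
      refine ⟨_, ⟨_, redK_mem_Kd hB, rfl⟩, ctrs_row_mem hφ (grQ_law _) j (redK_mem_grK ?_), ?_⟩
      · convert hBd using 2
        ext <;> simp [add_comm]
      · rw [← ctrs_succ, ctrs_redK]
    · push_cast [Nat.cast_sub (show j ≤ n by omega)]; linarith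

end RowRegularity

section Assembly

variable {k : Type} [Field k] {n p m : ℕ} {φ : Matrix (Fin n) (Fin m) (PolyS k n p)}
  {lam : ℤ × ℤ →+ ℤ} {ε : ℤ}

/-- The ideal `(z_1, …, z_m)`. -/
abbrev zI (φ : Matrix (Fin n) (Fin m) (PolyS k n p)) : Ideal (PolyS k n p) :=
  Ideal.span (Set.range (zseq k n m p φ))

theorem X_mul_minor_mem (l : Fin n) (r : Fin n ↪ Fin n) (c : Fin n ↪ Fin m) :
    X (Sum.inl l) * (φ.submatrix r c).det ∈ zI φ := by
  obtain ⟨i, rfl⟩ := (Finite.injective_iff_surjective.1 r.injective) l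
  set M := φ.submatrix r c with hM
  have h1 : Matrix.vecMul (fun i => X (Sum.inl (r i))) M = fun j => zseq k n m p φ (c j) := by
    funext j
    rw [Matrix.vecMul_eq_sum]
    simp only [Finset.sum_apply, Pi.smul_apply, hM, Matrix.submatrix_apply, smul_eq_mul, zseq]
    exact (Function.Bijective.sum_comp (Finite.injective_iff_bijective.1 r.injective)
      fun i => (X (Sum.inl i) : PolyS k n p) * φ i (c j))
  have h2 := congrFun (congrArg (fun v => Matrix.vecMul v M.adjugate) h1) i
  simp only [Matrix.vecMul_vecMul, Matrix.mul_adjugate] at h2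
  have h3 : X (Sum.inl (r i)) * M.det =
      Matrix.vecMul (fun j => zseq k n m p φ (c j)) M.adjugate i := by
    rw [← h2]
    simp [Matrix.vecMul_smul, mul_comm]
  rw [h3, Matrix.vecMul_eq_sum, Finset.sum_apply]
  exact sum_mem fun j _ => Ideal.mul_mem_right _ _ (Ideal.subset_span ⟨_, rfl⟩)

theorem height_le_of_not_mem (hht : (m : ℕ∞) ≤ idealHeight (resJ k n m p φ)) (l : Fin n)
    (P : Ideal (PolyS k n p)) [hP : P.IsPrime] (hx : X (Sum.inl l) ∉ P)
    (hz : ∀ j, zseq k n m p φ j ∈ P) : (m : ℕ∞) ≤ P.height := by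
  have hzP : zI φ ≤ P := Ideal.span_le.2 (by rintro _ ⟨j, rfl⟩; exact hz j)
  have hJ : resJ k n m p φ ≤ P := by
    refine sup_le hzP (Ideal.span_le.2 ?_)
    rintro _ ⟨r, c, rfl⟩
    exact (hP.mem_or_mem (hzP (X_mul_minor_mem l r c))).resolve_left hx
  have h : idealHeight (resJ k n m p φ) ≤ Order.height (⟨P, hP⟩ : PrimeSpectrum (PolyS k n p)) :=
    iInf₂_le (f := fun (Q : PrimeSpectrum (PolyS k n p)) (_ : resJ k n m p φ ≤ Q.asIdeal) =>
      Order.height Q) ⟨P, hP⟩ hJ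
  exact (hht.trans h).trans_eq (PrimeSpectrum.height_eq_orderHeight ⟨P, hP⟩).symm

theorem tors_zseq (hht : (m : ℕ∞) ≤ idealHeight (resJ k n m p φ)) (l : Fin n) (i : ℕ)
    (hi : 1 ≤ i) : Tors (zseq k n m p φ) (Submonoid.powers (X (Sum.inl l))) ⊥ i :=
  tors_powers (hasLocalParameters_mvPolynomial k _) _
    (fun P _ hx hz => height_le_of_not_mem hht l P hx hz) i hi

variable (φ) in
/-- The cycles of the Koszul complex on `z`. -/
def zCyc (i : ℕ) : Submodule (PolyS k n p) (Finset (Fin m) → PolyS k n p) :=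
  Kd (PolyS k n p) m (PolyS k n p) i ⊓ LinearMap.ker (ctr _ (zseq k n m p φ))

theorem redK_mem_rowCyc {i : ℕ} {c : Finset (Fin m) → PolyS k n p} (hc : c ∈ zCyc φ i) :
    redK k n p m c ∈ rowCyc φ n i := by
  refine mem_rowCyc.2 ⟨redK_mem_Kd hc.1, fun l hl => ?_⟩
  rw [ctr_redK, redK_eq_zero]
  intro T
  have h : ∑ l : Fin n, X (Sum.inl l) * ctr (PolyS k n p) (rowv φ l) c T = 0 := by
    rw [← ctr_zseq_apply, LinearMap.mem_ker.1 hc.2]; rfl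
  exact coeff_mem_xI (j := n) (l := ⟨l, hl⟩) (fun l : Fin n => ctr (PolyS k n p) (rowv φ l) c T)
    (by rw [h]; exact zero_mem _) hl

theorem mem_zCyc_of_rows {i : ℕ} {c : Finset (Fin m) → PolyS k n p}
    (hc : c ∈ Kd (PolyS k n p) m (PolyS k n p) i) (h : ∀ l < n, ctr _ (rowv φ l) c = 0) :
    c ∈ zCyc φ i := by
  refine ⟨hc, LinearMap.mem_ker.2 (funext fun T => ?_)⟩
  rw [ctr_zseq_apply]
  exact Finset.sum_eq_zero fun l _ => by rw [h l l.2]; simp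

theorem zseq_mem_xI (j : Fin m) : zseq k n m p φ j ∈ xI k n p 0 :=
  sum_mem fun _ _ => Ideal.mul_mem_right _ _ (X_mem_xI (Nat.zero_le _))

theorem redK_ctr_zseq (c : Finset (Fin m) → PolyS k n p) :
    redK k n p m (ctr _ (zseq k n m p φ) c) = 0 := by
  rw [redK_eq_zero]
  intro T
  rw [ctr_apply_apply]
  exact sum_mem fun j _ => Ideal.mul_mem_right _ _ (zseq_mem_xI j)

theorem hasReg_Kd_S (h11 : lam (1, 1) = 1) (i : ℕ) :
    HasReg lam i (grK m (grS k n p)) (Kd (PolyS k n p) m (PolyS k n p) i) := by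
  have := HasReg.kd (m := m) (grS_law (k := k) (n := n) (p := p)) h11
    (hasReg_top (fun t => regUpTo_grS (lam := lam) t)) i
  rwa [zero_add] at this

theorem hasReg_zCyc (hφ : ∀ i j, φ i j ∈ piece k n p (0, 1))
    (h : ∀ (l : Fin n) i, 1 ≤ i →
      Tors (zseq k n m p φ) (Submonoid.powers (X (Sum.inl l))) ⊥ i)
    (h10 : lam (1, 0) = 1 - ε) (h11 : lam (1, 1) = 1) (hε : 0 ≤ ε) (hε' : ε ≤ 1) {e : ℤ}
    (he1 : 1 ≤ e) (he : n * ε ≤ e) (t : ℕ) : ∀ i, 1 ≤ i → m + 1 ≤ i + t →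
      HasReg lam (i + e) (grK m (grS k n p)) (zCyc φ i) := by
  induction t with
  | zero =>
    intro i _ hi
    exact .of_eq_zero fun c hc => eq_zero_of_lt (by omega) hc.1
  | succ t ih =>
    intro i hi hit
    have h1 := ih (i + 1) (by omega) (by omega)
    have h2 := (hasReg_Kd_S (k := k) (n := n) (p := p) (m := m) h11 (i + 1)).mono
      (r' := i + e) (by push_cast; linarith)
    have h3 : HasReg lam (i + e) (grK m (grS k n p))
        (zCyc φ i ⊓ LinearMap.ker (redK k n p m)) := by
      have := HasReg.of_right (lam := lam) (C := zCyc φ i ⊓ LinearMap.ker (redK k n p m))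
        (gM' := grK m (grS k n p)) (ctr _ (zseq k n m p φ)) (A := zCyc φ (i + 1))
        (fun _ => Iff.rfl) (fun b hb => ⟨⟨ctr_mem hb, ctr_ctr_self _ _⟩, redK_ctr_zseq b⟩) 0
        (fun d b _ hb => by rw [sub_zero]; exact ctr_zseq_mem hφ grS_law hb)
        (fun d c hc hd => ?_) (h1.mono (by push_cast; linarith)) h2
      · rwa [map_zero, sub_zero] at this
      · rw [sub_zero] at hd
        by_cases hdi : (i : ℤ) < d.1
        · have hz : ctr _ (zseq k n m p φ) c ∈ IK m (xI k n p n) := by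
            rw [LinearMap.mem_ker.1 hc.1.2]; exact zero_mem _
          have hin : n + 1 ≤ i + n := by omega
          have hB := koszul_vanishing hφ h n le_rfl i hin d hdi c hc.1.1 hd hz
          obtain ⟨b, hb, hbd, hcb⟩ := exists_graded_of_mem_Bd hφ hd hB
          refine ⟨b, hb, hbd, ?_⟩
          rw [xI_eq_bot, IK_bot, Submodule.mem_bot, sub_eq_zero] at hcb
          exact hcb.symm
        · refine ⟨0, zero_mem _, zero_mem _, ?_⟩
          rw [eq_zero_of_redK_eq_zero hc.1.1 hd (not_lt.1 hdi) hc.2, map_zero]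
    have h4 := (hasReg_rowCyc hφ h h10 h11 hε hε' n le_rfl i (by omega)).mono
      (r' := i + e - lam 0) (by rw [map_zero]; linarith)
    refine HasReg.of_middle (redK k n p m) (grPi_law _ grS_law) (fun _ => Iff.rfl)
      (fun b hb => redK_mem_rowCyc hb) 0
      (fun d b _ hb => by rw [sub_zero]; exact redK_mem_grK hb) (fun d c hc hd => ?_) h3 h4
    rw [sub_zero] at hd
    obtain ⟨C, hC, hCd, hCc, -, hl⟩ := exists_lift_rowCyc hφ hc hd
    exact ⟨C, mem_zCyc_of_rows hC hl, hCd, hCc⟩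

theorem hasReg_zI (hφ : ∀ i j, φ i j ∈ piece k n p (0, 1))
    (h : ∀ (l : Fin n) i, 1 ≤ i →
      Tors (zseq k n m p φ) (Submonoid.powers (X (Sum.inl l))) ⊥ i)
    (h10 : lam (1, 0) = 1 - ε) (h11 : lam (1, 1) = 1) (hε : 0 ≤ ε) (hε' : ε ≤ 1) {e : ℤ}
    (he1 : 1 ≤ e) (he : n * ε ≤ e) : HasReg lam e (grS k n p) (zI φ) := by
  have h1 := (hasReg_zCyc hφ h h10 h11 hε hε' he1 he m 1 le_rfl (by omega)).mono
    (r' := e + 1) (by push_cast; linarith)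
  have h2 := (hasReg_Kd_S (k := k) (n := n) (p := p) (m := m) h11 1).mono
    (r' := e) (by push_cast; linarith)
  have := HasReg.of_right (lam := lam) (C := zI φ) (gM' := grS k n p)
    ((LinearMap.proj (∅ : Finset (Fin m))).comp (ctr _ (zseq k n m p φ))) (fun b => ?_)
    (fun b _ => ?_) 0 (fun d b _ hb => ?_) (fun d c hc hd => ?_) h1 h2
  · rwa [map_zero, sub_zero] at this
  · refine and_congr_right fun hb => ⟨fun h => congrFun h ∅, fun h => funext fun T => ?_⟩
    by_cases hT : T = ∅
    · rw [hT]; exact h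
    · exact ctr_mem (v := zseq k n m p φ) hb T (by simpa using hT)
  · rw [LinearMap.comp_apply, LinearMap.proj_apply, ctr_apply_apply]
    exact sum_mem fun j _ => Ideal.mul_mem_right _ _ (Ideal.subset_span ⟨j, rfl⟩)
  · have := ctr_zseq_mem hφ grS_law hb ∅
    simpa [kdeg, Prod.mk_zero_zero] using this
  · obtain ⟨a, rfl⟩ := (Submodule.mem_span_range_iff_exists_fun _).1 hc
    set δ : Finset (Fin m) → PolyS k n p := Pi.single ∅ 1 with hδ
    have hδ0 : δ ∈ Kd (PolyS k n p) m (PolyS k n p) 0 := fun T hT =>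
      Pi.single_eq_of_ne (by rintro rfl; simp at hT) _
    set b := ∑ j, a j • wdg1 (PolyS k n p) (PolyS k n p) j δ with hb
    have hbz : ctr _ (zseq k n m p φ) b ∅ = ∑ j, a j • zseq k n m p φ j := by
      rw [hb, map_sum, Finset.sum_apply]
      refine Finset.sum_congr rfl fun j _ => ?_
      rw [map_smul, ctr_wdg1, ctr_zero_of_Kd hδ0, map_zero, sub_zero]
      simp [hδ]
    refine ⟨prK d b, prK_mem_Kd (sum_mem fun j _ => Submodule.smul_mem _ _ (wdg1_mem hδ0)),
      prK_mem _ _, ?_⟩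
    rw [LinearMap.comp_apply, LinearMap.proj_apply, ctr_zseq_prK hφ, prK, hbz]
    rw [sub_zero] at hd
    simpa [kdeg, Prod.mk_zero_zero] using comp_of_mem hd

end Assembly

section Quotient

variable {k : Type} [Field k] {n p m : ℕ} {φ : Matrix (Fin n) (Fin m) (PolyS k n p)}
  {lam : ℤ × ℤ →+ ℤ} {ε : ℤ}

variable (k n p) in
/-- The endomorphism of `S` sending the `x`-variables to zero. -/
def killX : PolyS k n p →ₐ[k] PolyS k n p :=
  aeval (Sum.elim (fun _ => 0) fun j => X (Sum.inr j))

theorem sub_killX_mem (s : PolyS k n p) : s - killX k n p s ∈ xI k n p 0 := by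
  induction s using MvPolynomial.induction_on with
  | C a => simp [killX]
  | add s t hs ht =>
    rw [map_add, add_sub_add_comm]; exact add_mem hs ht
  | mul_X s i hs =>
    have : s * X i - killX k n p (s * X i) =
        (s - killX k n p s) * X i + killX k n p s * (X i - killX k n p (X i)) := by
      rw [map_mul]; ring
    rw [this]
    refine add_mem (Ideal.mul_mem_right _ _ hs) (Ideal.mul_mem_left _ _ ?_)
    rcases i with l | j
    · simpa [killX] using X_mem_xI (Nat.zero_le _)
    · simp [killX]

theorem killX_eq_zero {s : PolyS k n p} (hs : s ∈ xI k n p 0) : killX k n p s = 0 := by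
  have : xI k n p 0 ≤ RingHom.ker (killX k n p) := by
    rw [xI, Ideal.span_le]
    rintro _ ⟨_, ⟨l, -, rfl⟩, rfl⟩
    simp [killX, RingHom.mem_ker]
  exact this hs

theorem killX_of_mem {d : ℤ × ℤ} {s : PolyS k n p} (hs : s ∈ piece k n p d) (hd : d.1 = 0) :
    killX k n p s = s := by
  refine hom_congr_vars (f₁ := (killX k n p : PolyS k n p →+* PolyS k n p))
    (f₂ := RingHom.id _) (by ext; simp [killX]) (fun i hi _ => ?_) rfl
  rcases i with l | j
  · obtain ⟨e, he, hl⟩ := (mem_vars_iff_mem_support _).1 hi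
    rw [← weight_of_mem_piece hs he, weight_bideg_fst, Finset.sum_eq_zero_iff_of_nonneg
      (fun _ _ => by positivity)] at hd
    exact absurd (by exact_mod_cast hd l (Finset.mem_univ _)) (Finsupp.mem_support_iff.1 hl)
  · simp [killX]

theorem det_mem_piece {t : ℕ} {M : Matrix (Fin t) (Fin t) (PolyS k n p)}
    (hM : ∀ i j, M i j ∈ piece k n p (0, 1)) : M.det ∈ piece k n p (0, (t : ℤ)) := by
  rw [Matrix.det_apply]
  refine sum_mem fun σ _ => ?_
  have h : ∏ i, M (σ i) i ∈ piece k n p (0, (t : ℤ)) := by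
    have := IsWeightedHomogeneous.prod (w := bideg n p) Finset.univ (fun i => M (σ i) i)
      (fun _ => ((0 : ℤ), (1 : ℤ))) (fun i _ => hM _ _)
    rw [piece, mem_weightedHomogeneousSubmodule]
    simpa using this
  rcases Int.units_eq_one_or (Equiv.Perm.sign σ) with hσ | hσ
  · rwa [hσ, one_smul]
  · rw [hσ, Units.neg_smul, one_smul]; exact neg_mem h

theorem minor_mem_piece (hφ : ∀ i j, φ i j ∈ piece k n p (0, 1)) {t : ℕ} (r : Fin t ↪ Fin n)
    (c : Fin t ↪ Fin m) : (φ.submatrix r c).det ∈ piece k n p (0, (t : ℤ)) :=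
  det_mem_piece fun _ _ => hφ _ _

theorem sub_killX_mem_zI (hφ : ∀ i j, φ i j ∈ piece k n p (0, 1)) {g : PolyS k n p}
    (hg : g ∈ minorsIdeal n φ) : g - killX k n p g ∈ zI φ := by
  refine Submodule.span_induction (p := fun g _ => g - killX k n p g ∈ zI φ) ?_ (by simp)
    (fun x y _ _ hx hy => by rw [map_add, add_sub_add_comm]; exact add_mem hx hy) ?_ hg
  · rintro _ ⟨r, c, rfl⟩
    rw [killX_of_mem (minor_mem_piece hφ r c) rfl, sub_self]
    exact zero_mem _
  · intro a x hx h
    have hxz : ∀ b ∈ xI k n p 0, b * x ∈ zI φ := by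
      intro b hb
      refine Submodule.span_induction (p := fun b _ => b * x ∈ zI φ) ?_ (by simp)
        (fun _ _ _ _ h1 h2 => by rw [add_mul]; exact add_mem h1 h2)
        (fun q b _ hb => by rw [smul_eq_mul, mul_assoc]; exact Ideal.mul_mem_left _ _ hb) hb
      rintro _ ⟨_, ⟨l, -, rfl⟩, rfl⟩
      refine Submodule.span_induction (p := fun x _ => X (Sum.inl l) * x ∈ zI φ) ?_ (by simp)
        (fun _ _ _ _ h1 h2 => by rw [mul_add]; exact add_mem h1 h2)
        (fun q b _ hb => by
          rw [smul_eq_mul, mul_left_comm]; exact Ideal.mul_mem_left _ _ hb) hx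
      rintro _ ⟨r, c, rfl⟩
      exact X_mul_minor_mem l r c
    have : a • x - killX k n p (a • x) =
        (a - killX k n p a) * x + killX k n p a * (x - killX k n p x) := by
      rw [smul_eq_mul, map_mul]; ring
    rw [this]
    exact add_mem (hxz _ (sub_killX_mem a)) (Ideal.mul_mem_left _ _ h)

theorem zI_le_xI : zI φ ≤ xI k n p 0 :=
  Ideal.span_le.2 (by rintro _ ⟨j, rfl⟩; exact zseq_mem_xI j)

theorem mem_zI_iff (hφ : ∀ i j, φ i j ∈ piece k n p (0, 1)) {b : PolyS k n p} :
    b ∈ zI φ ↔ b ∈ resJ k n m p φ ∧ b ∈ xI k n p 0 := by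
  refine ⟨fun h => ⟨Submodule.mem_sup_left h, zI_le_xI h⟩, ?_⟩
  rintro ⟨hJ, hx⟩
  obtain ⟨w, hw, g, hg, rfl⟩ := Submodule.mem_sup.1 hJ
  have h1 := sub_killX_mem_zI hφ hg
  have h2 : g ∈ xI k n p 0 := by
    have := sub_mem hx (zI_le_xI hw)
    rwa [add_sub_cancel_left] at this
  rw [killX_eq_zero h2, sub_zero] at h1
  exact add_mem hw h1

theorem minor_smul_mem_rowIm (r : Fin n ↪ Fin n) (c : Fin n ↪ Fin m) :
    (Pi.single ∅ ((xI k n p 0).mkQ (φ.submatrix r c).det) : Finset (Fin m) → Sbar k n p) ∈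
      rowIm φ n n := by
  have hr := Finite.injective_iff_bijective.1 r.injective
  have h1 : (φ.submatrix r c).det =
      Equiv.Perm.sign (Equiv.ofBijective r hr) * (φ.submatrix id c).det := by
    rw [← Matrix.det_permute]
    rfl
  set δ : Finset (Fin m) → Sbar k n p := Pi.single ∅ ((xI k n p 0).mkQ 1) with hδ
  have hδ0 : δ ∈ Kd (PolyS k n p) m (Sbar k n p) 0 := fun T hT =>
    Pi.single_eq_of_ne (by rintro rfl; simp at hT) _
  have h2 : (φ.submatrix id c).det • δ ∈ rowIm φ n n := by
    refine ⟨wdgs (PolyS k n p) n c δ, wdgs_mem hδ0, ?_⟩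
    rw [ctrs_wdgs _ _ _ hδ0]
    congr 2
    ext i j
    simp [rowv_coe]
  have h3 := Submodule.smul_mem (rowIm φ n n)
    (((Equiv.Perm.sign (Equiv.ofBijective r hr) : ℤ) : PolyS k n p)) h2
  rw [smul_smul, ← h1, hδ, ← Pi.single_smul, ← map_smul, smul_eq_mul, mul_one] at h3
  exact h3

theorem hasReg_resJ (hφ : ∀ i j, φ i j ∈ piece k n p (0, 1))
    (h : ∀ (l : Fin n) i, 1 ≤ i →
      Tors (zseq k n m p φ) (Submonoid.powers (X (Sum.inl l))) ⊥ i)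
    (h10 : lam (1, 0) = 1 - ε) (h11 : lam (1, 1) = 1) (hε : 0 ≤ ε) (hε' : ε ≤ 1) {e : ℤ}
    (he1 : 1 ≤ e) (he : n * ε ≤ e) : HasReg lam e (grS k n p) (resJ k n m p φ) := by
  have h1 := hasReg_zI hφ h h10 h11 hε hε' he1 he
  have h2 := (hasReg_rowIm hφ h h10 h11 hε hε' n le_rfl).mono (r' := e - lam 0)
    (by rw [map_zero]; linarith)
  have hf : ∀ b, ((LinearMap.single (PolyS k n p) (fun _ : Finset (Fin m) => Sbar k n p) ∅).comp
      (xI k n p 0).mkQ) b = Pi.single ∅ ((xI k n p 0).mkQ b) := fun _ => rfl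
  refine HasReg.of_middle (A := zI φ) (C := rowIm φ n n)
    ((LinearMap.single (PolyS k n p) (fun _ : Finset (Fin m) => Sbar k n p) ∅).comp
      (xI k n p 0).mkQ) grS_law (fun b => ?_) (fun b hb => ?_) 0 (fun d b _ hb => ?_)
      (fun d c hc hd => ?_) h1 h2
  · rw [mem_zI_iff hφ, hf, Pi.single_eq_zero_iff]
    exact and_congr_right fun _ => (Submodule.Quotient.mk_eq_zero _).symm
  · have : resJ k n m p φ ≤ (rowIm φ n n).comap
        ((LinearMap.single (PolyS k n p) (fun _ : Finset (Fin m) => Sbar k n p) ∅).comp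
          (xI k n p 0).mkQ) := by
      refine sup_le (Ideal.span_le.2 ?_) (Ideal.span_le.2 ?_)
      · rintro _ ⟨j, rfl⟩
        rw [SetLike.mem_coe, Submodule.mem_comap, hf]
        have h0 : (xI k n p 0).mkQ (zseq k n m p φ j) = 0 :=
          (Submodule.Quotient.mk_eq_zero _).2 (zseq_mem_xI j)
        rw [h0, Pi.single_zero]
        exact zero_mem _
      · rintro _ ⟨r, c, rfl⟩
        exact minor_smul_mem_rowIm r c
    exact this hb
  · rw [hf, sub_zero]
    intro T
    by_cases hT : T = ∅
    · subst hT
      rw [Pi.single_eq_same]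
      exact ⟨b, by simpa [kdeg, Prod.mk_zero_zero] using hb, rfl⟩
    · rw [Pi.single_eq_of_ne hT]
      exact zero_mem _
  · rw [sub_zero] at hd
    obtain ⟨B, hB, hBd, rfl⟩ := exists_lift_rowIm hφ le_rfl hc hd
    have hB0 : ctrs _ (rowv φ) n B ∈ Kd (PolyS k n p) m (PolyS k n p) 0 :=
      ctrs_mem (by rwa [zero_add])
    refine ⟨ctrs _ (rowv φ) n B ∅, Submodule.mem_sup_right (ctrs_apply_mem (fun f => ?_) hB ∅),
      ?_, ?_⟩
    · by_cases hf : Function.Injective f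
      · refine Ideal.subset_span ⟨Function.Embedding.refl _, ⟨f, hf⟩, ?_⟩
        congr 1
        ext i j
        simp [rowv_coe]
      · obtain ⟨a, b, hab, hne⟩ := Function.not_injective_iff.1 hf
        rw [Matrix.det_zero_of_column_eq hne fun i => by simp [hab]]
        exact zero_mem _
    · simpa [kdeg, Prod.mk_zero_zero] using ctrs_row_mem hφ grS_law n hBd ∅
    · rw [hf]
      funext T
      by_cases hT : T = ∅
      · subst hT; rw [Pi.single_eq_same]; rfl
      · rw [Pi.single_eq_of_ne hT, redK_apply, hB0 T (by simpa using hT), map_zero]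

theorem hasReg_quot (hφ : ∀ i j, φ i j ∈ piece k n p (0, 1))
    (h : ∀ (l : Fin n) i, 1 ≤ i →
      Tors (zseq k n m p φ) (Submonoid.powers (X (Sum.inl l))) ⊥ i)
    (h10 : lam (1, 0) = 1 - ε) (h11 : lam (1, 1) = 1) (hε : 0 ≤ ε) (hε' : ε ≤ 1) {e : ℤ}
    (he1 : 0 ≤ e) (he : n * ε ≤ e + 1) (t : ℕ) :
    RegUpTo k n p lam t e (PolyS k n p ⧸ resJ k n m p φ) (grQ (resJ k n m p φ)) := by
  have h1 := hasReg_resJ hφ h h10 h11 hε hε' (by omega) he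
  have h2 := (hasReg_top (fun t => regUpTo_grS (k := k) (n := n) (p := p) (lam := lam) t)).mono he1
  have h3 := HasReg.of_right (lam := lam) (C := (⊤ : Submodule (PolyS k n p) _))
    (gM' := grQ (resJ k n m p φ)) (resJ k n m p φ).mkQ
    (fun b => by simp [Ideal.Quotient.eq_zero_iff_mem]) (fun _ _ => trivial) 0
    (fun d b _ hb => by rw [sub_zero]; exact ⟨b, hb, rfl⟩)
    (fun d c _ hd => by
      rw [sub_zero] at hd
      obtain ⟨b, hb, rfl⟩ := hd
      exact ⟨b, trivial, hb, rfl⟩) h1 h2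
  rw [map_zero, sub_zero] at h3
  exact (h3 t).equiv Submodule.topEquiv fun _ _ => Iff.rfl

theorem comp_mem_resJ (hφ : ∀ i j, φ i j ∈ piece k n p (0, 1)) (d : ℤ × ℤ) {s : PolyS k n p}
    (hs : s ∈ resJ k n m p φ) : comp k n p d s ∈ resJ k n m p φ := by
  have hgen : ∀ e, ∀ s ∈ piece k n p e, s ∈ resJ k n m p φ → ∀ d,
      comp k n p d s ∈ resJ k n m p φ := by
    intro e s hs hJ d
    by_cases h : d = e
    · subst h; rwa [comp_of_mem hs]
    · rw [comp_of_mem_ne hs h]; exact zero_mem _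
  rw [resJ, minorsIdeal, ← Ideal.span_union] at hs
  refine Submodule.span_induction (p := fun s _ => ∀ d, comp k n p d s ∈ resJ k n m p φ)
    ?_ (by simp) (fun x y _ _ hx hy d => by rw [map_add]; exact add_mem (hx d) (hy d)) ?_ hs d
  · rintro s (⟨j, rfl⟩ | ⟨r, c, rfl⟩)
    · exact hgen _ _ (zseq_mem_piece hφ j)
        (Submodule.mem_sup_left (Ideal.subset_span ⟨j, rfl⟩))
    · exact hgen _ _ (minor_mem_piece hφ r c)
        (Submodule.mem_sup_right (Ideal.subset_span ⟨r, c, rfl⟩))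
  · intro a x _ hx d
    have ha : a ∈ ⨆ d, grS k n p d := by rw [grS_gen]; trivial
    rw [smul_eq_mul]
    refine iSup_mem_induction (C := fun a => comp k n p d (a * x) ∈ resJ k n m p φ) ha
      (fun e a ha => ?_) (by simp) fun x y hx hy => by rw [add_mul, map_add]; exact add_mem hx hy
    rw [mul_comm, comp_mul ha]
    exact Ideal.mul_mem_right _ _ (hx _)

theorem grQ_indep (hφ : ∀ i j, φ i j ∈ piece k n p (0, 1)) :
    iSupIndep (grQ (resJ k n m p φ)) := by
  refine iSupIndep_of_proj _ (T := PolyS k n p ⧸ resJ k n m p φ)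
    (fun d => QuotientAddGroup.map (resJ k n m p φ).toAddSubgroup
      (resJ k n m p φ).toAddSubgroup (comp k n p d).toAddMonoidHom
      fun s hs => comp_mem_resJ hφ d hs) ?_ ?_
  · rintro d _ ⟨s, hs, rfl⟩ h0
    have : (resJ k n m p φ).mkQ (comp k n p d s) = 0 := h0
    rwa [comp_of_mem hs] at this
  · rintro d e hde _ ⟨s, hs, rfl⟩
    have : (resJ k n m p φ).mkQ (comp k n p d s) = 0 := by
      rw [comp_of_mem_ne hs hde.symm, map_zero]
    exact this

end Quotient

section Generators

variable {k : Type} [Field k] {n p m : ℕ} {φ : Matrix (Fin n) (Fin m) (PolyS k n p)}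

theorem weight_bideg_snd (e : Fin n ⊕ Fin p →₀ ℕ) :
    (Finsupp.weight (bideg n p) e).2 = ∑ l : Fin p, (e (Sum.inr l) : ℤ) := by
  rw [Finsupp.weight_apply, Finsupp.sum_fintype _ _ (by simp), Prod.snd_sum,
    Fintype.sum_sum_type]
  simp [bideg]

theorem comp_eq_zero_of_neg {d : ℤ × ℤ} (hd : d.1 < 0 ∨ d.2 < 0) (s : PolyS k n p) :
    comp k n p d s = 0 := by
  rcases hd with hd | hd
  · exact eq_zero_of_piece_neg (comp_mem d s) hd
  · by_contra h
    obtain ⟨e, he⟩ := support_nonempty.2 h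
    rw [← weight_of_mem_piece (comp_mem d s) he, weight_bideg_snd] at hd
    exact absurd hd (not_lt.2 (Finset.sum_nonneg fun _ _ => by positivity))

/-- An ideal generated in bidegrees not bounded by `d` has no component of bidegree `d`. -/
theorem comp_eq_zero_of_mem_span {G : Set (PolyS k n p)} {d : ℤ × ℤ}
    (hG : ∀ g ∈ G, ∃ e, g ∈ piece k n p e ∧ (d.1 < e.1 ∨ d.2 < e.2)) {s : PolyS k n p}
    (hs : s ∈ Ideal.span G) : comp k n p d s = 0 := by
  have : ∀ a, comp k n p d (a * s) = 0 := by
    refine Submodule.span_induction (p := fun s _ => ∀ a, comp k n p d (a * s) = 0) ?_ (by simp)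
      (fun x y _ _ hx hy a => by rw [mul_add, map_add, hx, hy, add_zero])
      (fun b x _ hx a => by rw [smul_eq_mul, ← mul_assoc]; exact hx _) hs
    intro g hg a
    obtain ⟨e, he, hde⟩ := hG g hg
    rw [comp_mul he, comp_eq_zero_of_neg (by simpa using hde), zero_mul]
  simpa using this 1

theorem resJ_eq_span : resJ k n m p φ = Ideal.span (Set.range (zseq k n m p φ) ∪
    {d | ∃ (r : Fin n ↪ Fin n) (c : Fin n ↪ Fin m), d = (φ.submatrix r c).det}) :=
  (Ideal.span_union _ _).symm

theorem X_mem_piece (i : Fin n ⊕ Fin p) : (X i : PolyS k n p) ∈ piece k n p (bideg n p i) := by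
  rw [piece, mem_weightedHomogeneousSubmodule]
  exact isWeightedHomogeneous_X k (bideg n p) i

theorem resJ_gen_mem_piece (hφ : ∀ i j, φ i j ∈ piece k n p (0, 1)) {g : PolyS k n p}
    (hg : g ∈ Set.range (zseq k n m p φ) ∪
      {d | ∃ (r : Fin n ↪ Fin n) (c : Fin n ↪ Fin m), d = (φ.submatrix r c).det}) :
    g ∈ piece k n p (1, 1) ∨ g ∈ piece k n p (0, (n : ℤ)) := by
  rcases hg with ⟨j, rfl⟩ | ⟨r, c, rfl⟩
  · exact .inl (zseq_mem_piece hφ j)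
  · exact .inr (minor_mem_piece hφ r c)

theorem comp_zero_of_mem_resJ (hn : 0 < n) (hφ : ∀ i j, φ i j ∈ piece k n p (0, 1))
    {s : PolyS k n p} (hs : s ∈ resJ k n m p φ) : comp k n p 0 s = 0 := by
  rw [resJ_eq_span] at hs
  refine comp_eq_zero_of_mem_span (fun g hg => ?_) hs
  rcases resJ_gen_mem_piece hφ hg with h | h
  · exact ⟨_, h, .inl (by simp)⟩
  · exact ⟨_, h, .inr (by simpa using hn)⟩

theorem one_notMem_varIdeal : (1 : PolyS k n p) ∉ varIdeal k n p := by
  intro h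
  have := comp_eq_zero_of_mem_span (d := 0) (fun g hg => ?_) h
  · rw [comp_of_mem one_mem_piece] at this
    exact one_ne_zero this
  · obtain ⟨i, rfl⟩ := hg
    refine ⟨_, X_mem_piece i, ?_⟩
    rcases i with l | j <;> simp [bideg]

theorem comp_eq_zero_of_mem_varIdeal_mul (hφ : ∀ i j, φ i j ∈ piece k n p (0, 1))
    {s : PolyS k n p} (hs : s ∈ varIdeal k n p * resJ k n m p φ) :
    comp k n p (0, (n : ℤ)) s = 0 := by
  rw [resJ_eq_span, varIdeal, Ideal.span_mul_span'] at hs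
  refine comp_eq_zero_of_mem_span (fun g hg => ?_) hs
  obtain ⟨_, ⟨i, rfl⟩, b, hb, rfl⟩ := Set.mem_mul.1 hg
  rcases resJ_gen_mem_piece hφ hb with h | h
  · refine ⟨_, piece_mul (X_mem_piece i) h, .inl ?_⟩
    rcases i with l | j <;> simp [bideg]
  · refine ⟨_, piece_mul (X_mem_piece i) h, ?_⟩
    rcases i with l | j <;> simp [bideg]

theorem exists_minor_ne_zero {t : ℕ} (h : gradeGE (minorsIdeal n φ) (t + 1)) :
    ∃ (r : Fin n ↪ Fin n) (c : Fin n ↪ Fin m), (φ.submatrix r c).det ≠ 0 := by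
  obtain ⟨rs, hlen, hmem, hreg⟩ := h
  by_contra! hcon
  have hbot : minorsIdeal n φ = ⊥ := by
    rw [minorsIdeal, Ideal.span_eq_bot]
    rintro _ ⟨r, c, rfl⟩
    exact hcon r c
  cases rs with
  | nil => simp at hlen
  | cons a rs =>
    have ha : a = 0 := by simpa [hbot] using hmem a (by simp)
    have h1 := ((RingTheory.Sequence.isWeaklyRegular_cons_iff _ _ _).1 hreg.toIsWeaklyRegular).1
    exact one_ne_zero (h1 (show a • (1 : PolyS k n p) = a • 0 by simp [ha]))

theorem mem_smul_top_of_forall {ι : Type} {I : Ideal (PolyS k n p)} {v : ι →₀ PolyS k n p}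
    (h : ∀ q, v q ∈ I) : v ∈ I • (⊤ : Submodule (PolyS k n p) (ι →₀ PolyS k n p)) := by
  rw [← v.sum_single]
  refine sum_mem fun q _ => ?_
  rw [← mul_one (v q), ← smul_eq_mul, ← Finsupp.smul_single]
  exact Submodule.smul_mem_smul (h q) trivial

/-- A bihomogeneous vector whose bidegree is not that of a basis element has coefficients in the
irrelevant ideal. -/
theorem mem_varIdeal_smul_of_inPiece {β : ℕ → ℤ × ℤ → ℕ} {i : ℕ} {d : ℤ × ℤ}
    (hβ : β i d = 0) {v : FMod k n p β i} (hv : v ∈ grF k n p β i d) :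
    v ∈ varIdeal k n p • (⊤ : Submodule (PolyS k n p) (FMod k n p β i)) := by
  refine mem_smul_top_of_forall fun q => mem_varIdeal_of_mem_piece (hv q) fun h => ?_
  replace h : d = q.1.1 := sub_eq_zero.1 h
  have := q.2
  rw [← h, hβ] at this
  omega

section Resolution

variable {β : ℕ → ℤ × ℤ → ℕ} {f : FMod k n p β 1 →ₗ[PolyS k n p] FMod k n p β 0}
  {π : FMod k n p β 0 →ₗ[PolyS k n p] (PolyS k n p ⧸ resJ k n m p φ)}

theorem exists_lift_presentation (hn : 0 < n) (hφ : ∀ i j, φ i j ∈ piece k n p (0, 1))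
    (hm : GrMap (grF k n p β 0) (grQ (resJ k n m p φ)) π)
    (hs : GrSurj (grF k n p β 0) (grQ (resJ k n m p φ)) π) :
    ∃ (θ : FMod k n p β 0 →ₗ[PolyS k n p] PolyS k n p) (v : FMod k n p β 0),
      (resJ k n m p φ).mkQ ∘ₗ θ = π ∧ v ∈ grF k n p β 0 0 ∧ θ v = 1 ∧
      π v = (resJ k n m p φ).mkQ 1 := by
  have hfree := grFin_free (k := k) (n := n) (p := p) (lam := 0) (r := 0)
    (fun q : RIdx β 0 => q.1.1) (fun _ => by simp)
  obtain ⟨θ, hθ, hθπ⟩ := hfree.lift (grS k n p) (grQ (resJ k n m p φ)) (resJ k n m p φ).mkQ π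
    grS_law (fun d c hc => hc) hm
  obtain ⟨v, hv, hv1⟩ := hs 0 ((resJ k n m p φ).mkQ 1) ⟨1, one_mem_piece, rfl⟩
  refine ⟨θ, v, hθπ, hv, ?_, hv1⟩
  have h1 : θ v - 1 ∈ resJ k n m p φ := by
    rw [← Submodule.ker_mkQ (resJ k n m p φ), LinearMap.mem_ker, map_sub, sub_eq_zero, ← hv1,
      ← hθπ]
    rfl
  have h2 := comp_zero_of_mem_resJ hn hφ h1
  rwa [comp_of_mem ((piece k n p 0).sub_mem (hθ 0 v hv) one_mem_piece), sub_eq_zero] at h2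

theorem betti_zero_ne_zero (hn : 0 < n) (hφ : ∀ i j, φ i j ∈ piece k n p (0, 1))
    (hm : GrMap (grF k n p β 0) (grQ (resJ k n m p φ)) π)
    (hs : GrSurj (grF k n p β 0) (grQ (resJ k n m p φ)) π) : β 0 (0, 0) ≠ 0 := by
  intro h
  obtain ⟨θ, v, -, hv, hv1, -⟩ := exists_lift_presentation hn hφ hm hs
  have h1 := Submodule.mem_map_of_mem (f := θ) (mem_varIdeal_smul_of_inPiece h hv)
  rw [Submodule.map_smul'', hv1] at h1
  have h2 := Submodule.smul_mono le_rfl (le_top (a := Submodule.map θ ⊤)) h1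
  exact one_notMem_varIdeal (by simpa using h2)

theorem betti_one_ne_zero (hn : 0 < n) (hφ : ∀ i j, φ i j ∈ piece k n p (0, 1))
    (hm : GrMap (grF k n p β 0) (grQ (resJ k n m p φ)) π)
    (hs : GrSurj (grF k n p β 0) (grQ (resJ k n m p φ)) π) (hex : Function.Exact f π)
    (hf : GrMap (grF k n p β 1) (grF k n p β 0) f) {r : Fin n ↪ Fin n} {c : Fin n ↪ Fin m}
    (hrc : (φ.submatrix r c).det ≠ 0) : β 1 (0, (n : ℤ)) ≠ 0 := by
  intro h
  obtain ⟨θ, v, hθπ, hv, hv1, hπv⟩ := exists_lift_presentation hn hφ hm hs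
  set d := (φ.submatrix r c).det with hd
  have hdp : d ∈ piece k n p (0, (n : ℤ)) := minor_mem_piece hφ r c
  have hdJ : d ∈ resJ k n m p φ := Submodule.mem_sup_right (Ideal.subset_span ⟨r, c, rfl⟩)
  have hdv : d • v ∈ grF k n p β 0 (0, (n : ℤ)) := by
    have := grFin_law (fun q : RIdx β 0 => q.1.1) _ _ d v hdp hv
    rwa [add_zero] at this
  have hker : π (d • v) = 0 := by
    rw [map_smul, hπv, ← map_smul, smul_eq_mul, mul_one]
    exact (Submodule.Quotient.mk_eq_zero _).2 hdJ
  obtain ⟨w, hw, hwd⟩ := hf.exists_mem_of_mem_range (grFin_gen _) (grFin_indep _) hdv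
    ((hex _).1 hker)
  have h1 := Submodule.mem_map_of_mem (f := θ ∘ₗ f) (mem_varIdeal_smul_of_inPiece h hw)
  have hle : Submodule.map (θ ∘ₗ f) ⊤ ≤ resJ k n m p φ := by
    rintro _ ⟨w, -, rfl⟩
    rw [← Submodule.ker_mkQ (resJ k n m p φ), LinearMap.mem_ker]
    have h3 : (resJ k n m p φ).mkQ ((θ ∘ₗ f) w) = π (f w) := by rw [← hθπ]; rfl
    rw [h3]
    exact (hex _).2 ⟨w, rfl⟩
  have h5 : d • (1 : PolyS k n p) = d := by rw [smul_eq_mul, mul_one]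
  rw [Submodule.map_smul'', LinearMap.comp_apply, hwd, map_smul, hv1, h5] at h1
  have h2 : d ∈ varIdeal k n p * resJ k n m p φ := Submodule.smul_mono le_rfl hle h1
  have h4 := comp_eq_zero_of_mem_varIdeal_mul hφ h2
  rw [comp_of_mem hdp] at h4
  exact hrc h4

end Resolution

end Generators

/-- Under the residual-intersection hypotheses, the `x`-regularity of
`S/J` equals `0` and the `y`-regularity equals `n-1`: for any minimal bigraded free
resolution with multiplicities `β`, `sup{a - i : β i (a,b) ≠ 0} = 0` and
`sup{b - i : β i (a,b) ≠ 0} = n-1`. -/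
theorem stmt2
    (k : Type) [Field k] (n m p : ℕ)
    (hn : 0 < n) (hp : 0 < p) (hnm : n ≤ m)
    (φ : Matrix (Fin n) (Fin m) (PolyS k n p))
    (hφ : ∀ i j, φ i j ∈ piece k n p (0, 1))
    (hgrade : gradeGE (minorsIdeal n φ) (m - n + 1))
    (hhtJ : (m : ℕ∞) ≤ idealHeight (resJ k n m p φ))
    (hgeom : geomResCond k n m p φ) :
    ∀ β : ℕ → ℤ × ℤ → ℕ, IsMinBigradedFreeRes k n p (resJ k n m p φ) β →
      IsGreatest { r : ℤ | ∃ (i : ℕ) (a b : ℤ), β i (a, b) ≠ 0 ∧ r = a - i } 0 ∧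
      IsGreatest { r : ℤ | ∃ (i : ℕ) (a b : ℤ), β i (a, b) ≠ 0 ∧ r = b - i }
        ((n : ℤ) - 1) := by
  rintro β ⟨f, π, hsurj, hex0, hex, hf, hπ, hmin⟩
  have hm : GrMap (grF k n p β 0) (grQ (resJ k n m p φ)) π := fun d v hv => hπ d v hv
  have hs : GrSurj (grF k n p β 0) (grQ (resJ k n m p φ)) π := fun d c hc =>
    hm.exists_mem_of_mem_range (grFin_gen _) (grQ_indep hφ) hc (hsurj c)
  have hfg : ∀ i, GrMap (grF k n p β (i + 1)) (grF k n p β i) (f i) := fun i d v hv => hf i d v hv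
  have hker : LinearMap.ker π = LinearMap.range (f 0) := LinearMap.exact_iff.1 hex0
  have bound : ∀ (lam : ℤ × ℤ →+ ℤ) (r : ℤ),
      (∀ t, RegUpTo k n p lam t r (PolyS k n p ⧸ resJ k n m p φ) (grQ (resJ k n m p φ))) →
      ∀ i a b, β i (a, b) ≠ 0 → lam (a, b) ≤ r + i := by
    intro lam r hreg i a b hβ
    have h := lam_le_of_minimalResolution f hex hfg hmin i 0 r _ _ π hm hs hsurj hker
      (hreg (i + 1))
    rw [zero_add] at h
    exact h ⟨((a, b), 0), Nat.pos_of_ne_zero hβ⟩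
  have hT := tors_zseq hhtJ
  obtain ⟨r, c, hrc⟩ := exists_minor_ne_zero hgrade
  refine ⟨⟨⟨0, 0, 0, betti_zero_ne_zero hn hφ hm hs, by simp⟩, ?_⟩,
    ⟨⟨1, 0, n, betti_one_ne_zero hn hφ hm hs hex0 (hfg 0) hrc, by simp⟩, ?_⟩⟩
  · rintro _ ⟨i, a, b, hβ, rfl⟩
    have h := bound (AddMonoidHom.fst ℤ ℤ) 0 (hasReg_quot hφ hT (ε := 0) (by simp) (by simp)
      le_rfl (by norm_num) le_rfl (by simp)) i a b hβ
    simp only [AddMonoidHom.coe_fst] at h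
    linarith
  · rintro _ ⟨i, a, b, hβ, rfl⟩
    have h := bound (AddMonoidHom.snd ℤ ℤ) (n - 1) (hasReg_quot hφ hT (ε := 1) (by simp) (by simp)
      (by norm_num) le_rfl (by omega) (by simp)) i a b hβ
    simp only [AddMonoidHom.coe_snd] at h
    linarith
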